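/- Let Ω = Ω_θ ⊂ ℝ² be a sector with opening angle θ ∈ (0,π) or θ ∈ (π,2π), and let φ ∈ C_0^∞(ℝ²) be real-valued. Then the positive and negative eigenvalues of the compact self-adjoint operator A_Ω[φ] satisfy lim_{k→∞} λ_k^{(±)}(A_Ω[φ]) · k / log k = |φ(0,0)| / (4π²). -/

import Mathlib

open MeasureTheory Filter Complex
open scoped ENNReal InnerProductSpace RealInnerProductSpace

noncomputable section

/-- `λ_{k+1}^{(+)}(A)` via the Courant–Fischer min-max principle: for a compact self-adjoint
operator this gives the `(k+1)`-st positive eigenvalue in non-increasing order counting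
multiplicity (and `0` once the positive eigenvalues are exhausted). -/
def eigPlus {H : Type*} [NormedAddCommGroup H] [InnerProductSpace ℂ H]
    (A : H →L[ℂ] H) (k : ℕ) : ℝ :=
  ⨅ V : {V : Submodule ℂ H // Module.rank ℂ V ≤ (k : Cardinal)},
    ⨆ u : {u : H // u ∈ (V : Submodule ℂ H)ᗮ ∧ ‖u‖ = 1},
      (⟪A u.1, u.1⟫_ℂ).re

/-- `λ_{k+1}^{(-)}(A)`, the `(k+1)`-st negative eigenvalue sequence member (absolute value). -/
def eigMinus {H : Type*} [NormedAddCommGroup H] [InnerProductSpace ℂ H]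
    (A : H →L[ℂ] H) (k : ℕ) : ℝ :=
  eigPlus (-A) k

/-- the argument of a complex number, taken in `[0, 2π)` -/
def arg2pi (z : ℂ) : ℝ := if 0 ≤ z.arg then z.arg else z.arg + 2 * Real.pi

/-- the open sector `Ω_θ = {(x,ξ) : 0 < arg (x + iξ) < θ}` in the phase plane -/
def sector (θ : ℝ) : Set (ℝ × ℝ) :=
  {p | 0 < arg2pi (p.1 + p.2 * Complex.I) ∧ arg2pi (p.1 + p.2 * Complex.I) < θ}

abbrev L2R := MeasureTheory.Lp ℂ 2 (volume : Measure ℝ)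

/-- the Weyl quantization integral formula in dimension one -/
def weylIntegral (a : ℝ × ℝ → ℂ) (u : ℝ → ℂ) (x : ℝ) : ℂ :=
  (2 * Real.pi : ℝ)⁻¹ *
    ∫ ξ : ℝ, ∫ y : ℝ,
      Complex.exp (Complex.I * ((x - y) * ξ : ℝ)) * a ((x + y) / 2, ξ) * u y

/-- `T` is the Weyl pseudodifferential operator `Op^w(a)` on `L²(ℝ)` -/
def IsWeylOp (a : ℝ × ℝ → ℂ) (T : L2R →L[ℂ] L2R) : Prop :=
  ∀ u : SchwartzMap ℝ ℂ, ∀ f : L2R, (⇑f =ᵐ[volume] ⇑u) →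
    ⇑(T f) =ᵐ[volume] weylIntegral a ⇑u

/-- the symbol `1_Ω φ` of the operator `A_Ω[φ]` -/
def symbAOm (Ω : Set (ℝ × ℝ)) (φ : ℝ × ℝ → ℝ) : ℝ × ℝ → ℂ :=
  Set.indicator Ω fun τ => (φ τ : ℂ)

section MinMax

variable {H : Type*} [NormedAddCommGroup H] [InnerProductSpace ℂ H]

lemma abs_re_inner_apply_le (A : H →L[ℂ] H) {u : H} (hu : ‖u‖ = 1) :
    |(⟪A u, u⟫_ℂ).re| ≤ ‖A‖ := by
  calc |(⟪A u, u⟫_ℂ).re| ≤ ‖⟪A u, u⟫_ℂ‖ := Complex.abs_re_le_norm _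
    _ ≤ ‖A u‖ * ‖u‖ := norm_inner_le_norm _ _
    _ ≤ ‖A‖ := by
      have := A.le_opNorm u
      rw [hu] at this ⊢
      linarith

lemma bddAbove_range_re_inner (A : H →L[ℂ] H) (V : Submodule ℂ H) :
    BddAbove (Set.range fun u : {u : H // u ∈ Vᗮ ∧ ‖u‖ = 1} => (⟪A u.1, u.1⟫_ℂ).re) := by
  refine ⟨‖A‖, ?_⟩
  rintro _ ⟨u, rfl⟩
  exact (abs_le.1 (abs_re_inner_apply_le A u.2.2)).2

lemma eigPlus_le (A : H →L[ℂ] H) {k : ℕ} {c : ℝ} (hc : 0 ≤ c) (V : Submodule ℂ H)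
    (hV : Module.rank ℂ V ≤ (k : Cardinal))
    (h : ∀ u ∈ Vᗮ, (⟪A u, u⟫_ℂ).re ≤ c * ‖u‖ ^ 2) : eigPlus A k ≤ c := by
  unfold eigPlus
  refine ciInf_le_of_le ⟨-‖A‖, ?_⟩ ⟨V, hV⟩ ?_
  · rintro _ ⟨W, rfl⟩
    by_cases hne : Nonempty {u : H // u ∈ (W : Submodule ℂ H)ᗮ ∧ ‖u‖ = 1}
    · obtain ⟨u⟩ := hne
      exact le_ciSup_of_le (bddAbove_range_re_inner A W.1) u
        (abs_le.1 (abs_re_inner_apply_le A u.2.2)).1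
    · rw [not_nonempty_iff] at hne
      change -‖A‖ ≤ ⨆ u : {u : H // u ∈ (W.1 : Submodule ℂ H)ᗮ ∧ ‖u‖ = 1}, (⟪A u.1, u.1⟫_ℂ).re
      rw [Real.iSup_of_isEmpty]
      simp
  · refine Real.iSup_le (fun u => ?_) hc
    have := h u.1 u.2.1
    rw [u.2.2] at this
    simpa using this

lemma exists_unit_mem_inf_orthogonal (L V : Submodule ℂ H) [FiniteDimensional ℂ L]
    [FiniteDimensional ℂ V] (h : Module.finrank ℂ V < Module.finrank ℂ L) :
    ∃ u ∈ L, u ∈ Vᗮ ∧ ‖u‖ = 1 := by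
  let f : L →ₗ[ℂ] V := (V.orthogonalProjectionOnto : H →L[ℂ] V).toLinearMap ∘ₗ L.subtype
  have hker : f.ker ≠ ⊥ := LinearMap.ker_ne_bot_of_finrank_lt h
  obtain ⟨x, hx, hx0⟩ := Submodule.exists_mem_ne_zero_of_ne_bot hker
  have hxV : (x : H) ∈ Vᗮ := by
    have : V.orthogonalProjectionOnto (x : H) = 0 := hx
    exact (Submodule.orthogonalProjectionOnto_eq_zero_iff).1 this
  have hn : ‖(x : H)‖ ≠ 0 := by simpa using hx0
  refine ⟨((‖(x : H)‖⁻¹ : ℝ) : ℂ) • (x : H), L.smul_mem _ x.2, Vᗮ.smul_mem _ hxV, ?_⟩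
  rw [norm_smul]
  simp [hn]

lemma le_eigPlus (A : H →L[ℂ] H) {k r : ℕ} {c : ℝ} (L W : Submodule ℂ H)
    [FiniteDimensional ℂ L] (hL : k + r < Module.finrank ℂ L)
    (hW : Module.rank ℂ W ≤ (r : Cardinal))
    (h : ∀ u ∈ L, u ∈ Wᗮ → c * ‖u‖ ^ 2 ≤ (⟪A u, u⟫_ℂ).re) : c ≤ eigPlus A k := by
  unfold eigPlus
  have : Nonempty {V : Submodule ℂ H // Module.rank ℂ V ≤ (k : Cardinal)} :=
    ⟨⟨⊥, by simp⟩⟩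
  refine le_ciInf fun V => ?_
  have fin {s : ℕ} {X : Submodule ℂ H} (hX : Module.rank ℂ X ≤ (s : Cardinal)) :
      FiniteDimensional ℂ X ∧ Module.finrank ℂ X ≤ s := by
    have : FiniteDimensional ℂ X :=
      Module.rank_lt_aleph0_iff.1 (hX.trans_lt Cardinal.natCast_lt_aleph0)
    refine ⟨this, ?_⟩
    rw [← Module.finrank_eq_rank] at hX
    exact_mod_cast hX
  obtain ⟨i1, h1⟩ := fin V.2
  obtain ⟨i2, h2⟩ := fin hW
  have h3 : Module.finrank ℂ ((V.1 ⊔ W : Submodule ℂ H)) < Module.finrank ℂ L :=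
    ((Submodule.finrank_add_le_finrank_add_finrank V.1 W).trans (add_le_add h1 h2)).trans_lt hL
  obtain ⟨u, huL, hu, hu1⟩ := exists_unit_mem_inf_orthogonal L (V.1 ⊔ W) h3
  have huV : u ∈ V.1ᗮ := Submodule.orthogonal_le le_sup_left hu
  have huW : u ∈ Wᗮ := Submodule.orthogonal_le le_sup_right hu
  refine le_ciSup_of_le (bddAbove_range_re_inner A V.1) ⟨u, huV, hu1⟩ ?_
  have := h u huL huW
  rw [hu1] at this
  simpa using this

/-- A function on `H` is at most `c` on unit vectors off a subspace of controlled dimension,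
provided it cannot exceed `c` on long orthonormal families. -/
lemma exists_submodule_forall_unit_le (q : H → ℝ) (c : ℝ) (V : Submodule ℂ H) (r B : ℕ)
    (hV : Module.rank ℂ V ≤ (r : Cardinal))
    (h : ∀ (n : ℕ) (u : Fin n → H), Orthonormal ℂ u → (∀ i, u i ∈ Vᗮ) → (∀ i, c < q (u i)) →
      n ≤ B) :
    ∃ W : Submodule ℂ H, V ≤ W ∧ Module.rank ℂ W ≤ ((r + B : ℕ) : Cardinal) ∧
      ∀ u ∈ Wᗮ, ‖u‖ = 1 → q u ≤ c := by
  classical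
  let P : ℕ → Prop := fun n => ∃ u : Fin n → H, Orthonormal ℂ u ∧ (∀ i, u i ∈ Vᗮ) ∧
    ∀ i, c < q (u i)
  have hP0 : P 0 := ⟨Fin.elim0, ⟨fun i => i.elim0, fun i => i.elim0⟩, fun i => i.elim0,
    fun i => i.elim0⟩
  obtain ⟨n, hnB, ⟨u, huo, huV, huc⟩, hmax⟩ : ∃ n ≤ B, P n ∧ ∀ m, P m → m ≤ n := by
    refine ⟨Nat.findGreatest P B, Nat.findGreatest_le B,
      Nat.findGreatest_spec (Nat.zero_le B) hP0, fun m hm => Nat.le_findGreatest ?_ hm⟩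
    obtain ⟨w, hwo, hwV, hwc⟩ := hm
    exact h _ w hwo hwV hwc
  refine ⟨V ⊔ Submodule.span ℂ (Set.range u), le_sup_left, ?_, ?_⟩
  · refine (Submodule.rank_add_le_rank_add_rank _ _).trans ?_
    push_cast
    refine add_le_add hV ((rank_span_le _).trans ?_)
    have := Cardinal.mk_range_le_lift (f := u)
    simp only [Cardinal.lift_uzero, Cardinal.mk_fin, Cardinal.lift_natCast] at this
    exact this.trans (by exact_mod_cast hnB)
  · intro v hv hv1
    by_contra hcv
    push Not at hcv
    have hvV : v ∈ Vᗮ := Submodule.orthogonal_le le_sup_left hv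
    have hvu : ∀ i, ⟪u i, v⟫_ℂ = 0 := fun i =>
      (Submodule.mem_orthogonal _ _).1 hv _
        (Submodule.mem_sup_right (Submodule.subset_span ⟨i, rfl⟩))
    have hPs : P (n + 1) := by
      refine ⟨Fin.cons v u, ?_, ?_, ?_⟩
      · constructor
        · intro i
          refine Fin.cases ?_ (fun j => ?_) i
          · simpa using hv1
          · simpa using huo.1 j
        · intro i j
          refine Fin.cases ?_ (fun i => ?_) i <;> refine Fin.cases ?_ (fun j => ?_) j
          · simp
          · intro _
            simpa using inner_eq_zero_symm.1 (hvu j)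
          · intro _
            simpa using hvu i
          · intro hij
            simpa using huo.2 (fun e : i = j => hij (congrArg Fin.succ e))
      · intro i
        refine Fin.cases ?_ (fun j => ?_) i
        · simpa using hvV
        · simpa using huV j
      · intro i
        refine Fin.cases ?_ (fun j => ?_) i
        · simpa using hcv
        · simpa using huc j
    have := hmax _ hPs
    omega

end MinMax

section Asymptotics

open Topology

/-- The number of exponential cells of ratio `exp (1 / n)` needed to cover `[0, n - 1)`. -/
def cellCount (n : ℕ) : ℕ := ⌈(n : ℝ) * Real.log n⌉₊

lemma tendsto_natCast_log : Tendsto (fun k : ℕ => Real.log k) atTop atTop :=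
  Real.tendsto_log_atTop.comp tendsto_natCast_atTop_atTop

lemma tendsto_div_mul_log {a : ℝ} (ha : 0 < a) :
    Tendsto (fun k : ℕ => (k : ℝ) / (a * Real.log k)) atTop atTop := by
  have h1 : Tendsto (fun x : ℝ => Real.log x / x) atTop (𝓝[>] 0) := by
    refine tendsto_nhdsWithin_iff.2 ⟨?_, ?_⟩
    · simpa using Real.isLittleO_log_id_atTop.tendsto_div_nhds_zero
    · filter_upwards [eventually_gt_atTop (1 : ℝ)] with x hx
      exact div_pos (Real.log_pos hx) (by linarith)
  have h2 := (h1.inv_tendsto_nhdsGT_zero.const_mul_atTop (inv_pos.2 ha)).comp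
    (tendsto_natCast_atTop_atTop (R := ℝ))
  refine h2.congr fun k => ?_
  simp only [Function.comp, Pi.inv_apply, inv_div]
  rw [inv_mul_eq_div, div_div, mul_comm]

lemma tendsto_ceil_div_mul_log {a : ℝ} (ha : 0 < a) :
    Tendsto (fun k : ℕ => ⌈(k : ℝ) / (a * Real.log k)⌉₊) atTop atTop :=
  tendsto_nat_ceil_atTop.comp (tendsto_div_mul_log ha)

lemma tendsto_div_ceil_mul_log {a : ℝ} (ha : 0 < a) :
    Tendsto (fun k : ℕ => (k : ℝ) / (⌈(k : ℝ) / (a * Real.log k)⌉₊ * Real.log k)) atTop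
      (𝓝 a) := by
  have h := ((tendsto_nat_ceil_div_atTop (R := ℝ)).comp (tendsto_div_mul_log ha)).inv₀ one_ne_zero
  have h' := h.const_mul a
  rw [inv_one, mul_one] at h'
  refine h'.congr' ?_
  filter_upwards [eventually_gt_atTop 1] with k hk
  have hl : Real.log k ≠ 0 := (Real.log_pos (by exact_mod_cast hk)).ne'
  simp only [Function.comp, inv_div]
  field_simp

lemma tendsto_log_ceil_div_log {a : ℝ} (ha : 0 < a) :
    Tendsto (fun k : ℕ => Real.log ⌈(k : ℝ) / (a * Real.log k)⌉₊ / Real.log k) atTop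
      (𝓝 1) := by
  have hlog := tendsto_natCast_log
  have h1 : Tendsto (fun k : ℕ => Real.log (k / (⌈(k : ℝ) / (a * Real.log k)⌉₊ * Real.log k)) /
      Real.log k) atTop (𝓝 0) :=
    (((Real.continuousAt_log ha.ne').tendsto.comp (tendsto_div_ceil_mul_log ha))).div_atTop hlog
  have h2 : Tendsto (fun k : ℕ => Real.log (Real.log k) / Real.log k) atTop (𝓝 0) := by
    have := (Real.isLittleO_log_id_atTop.tendsto_div_nhds_zero).comp hlog
    simpa [Function.comp_def] using this
  have h3 := ((tendsto_const_nhds (x := (1 : ℝ))).sub h1).sub h2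
  rw [sub_zero, sub_zero] at h3
  refine h3.congr' ?_
  filter_upwards [eventually_gt_atTop 1, hlog.eventually_gt_atTop 0,
    (tendsto_ceil_div_mul_log ha).eventually_gt_atTop 0] with k hk hl hn
  have hk0 : (k : ℝ) ≠ 0 := by positivity
  have hn0 : ((⌈(k : ℝ) / (a * Real.log k)⌉₊ : ℕ) : ℝ) ≠ 0 := by exact_mod_cast hn.ne'
  rw [Real.log_div hk0 (mul_ne_zero hn0 hl.ne'), Real.log_mul hn0 hl.ne']
  field_simp
  ring

lemma tendsto_mul_exp_inv_sub_one :
    Tendsto (fun n : ℕ => (n : ℝ) * (Real.exp (1 / n) - 1)) atTop (𝓝 1) := by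
  have h := (Real.hasDerivAt_exp 0).tendsto_slope_zero_right
  simp only [zero_add, Real.exp_zero, smul_eq_mul] at h
  have h2 : Tendsto (fun n : ℕ => ((n : ℝ))⁻¹) atTop (𝓝[>] 0) :=
    tendsto_inv_atTop_nhdsGT_zero.comp tendsto_natCast_atTop_atTop
  refine (h.comp h2).congr fun n => ?_
  simp

/-- The limiting value of the bound with `N` modes per cell, along `n ~ k / (a log k)`. -/
lemma tendsto_mode_bound {a κ c : ℝ} (ha : 0 < a) (N : ℝ) :
    Tendsto (fun k : ℕ => (κ * (Real.exp (1 / ⌈(k : ℝ) / (a * Real.log k)⌉₊) - 1) /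
      (2 * Real.pi * N) + c / ⌈(k : ℝ) / (a * Real.log k)⌉₊) * k / Real.log k) atTop
      (𝓝 ((κ / (2 * Real.pi * N) + c) * a)) := by
  have h1 := tendsto_mul_exp_inv_sub_one.comp (tendsto_ceil_div_mul_log ha)
  have h2 := ((h1.const_mul (κ / (2 * Real.pi * N))).add_const c).mul (tendsto_div_ceil_mul_log ha)
  rw [mul_one] at h2
  refine h2.congr' ?_
  filter_upwards [tendsto_natCast_log.eventually_gt_atTop 0,
    (tendsto_ceil_div_mul_log ha).eventually_gt_atTop 0] with k hl hn
  have hn0 : ((⌈(k : ℝ) / (a * Real.log k)⌉₊ : ℕ) : ℝ) ≠ 0 := by exact_mod_cast hn.ne'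
  simp only [Function.comp]
  generalize ((⌈(k : ℝ) / (a * Real.log k)⌉₊ : ℕ) : ℝ) = n at *
  field_simp

lemma tendsto_eig_of_mode_bounds (e : ℕ → ℝ) (κ : ℝ)
    (up : ∀ N : ℕ, 1 ≤ N → ∀ δ : ℝ, 0 < δ → ∃ B : ℕ, ∀ n : ℕ, 1 ≤ n → ∀ k : ℕ,
      2 * cellCount n * N + B * n ≤ k →
      e k ≤ κ * (Real.exp (1 / n) - 1) / (2 * Real.pi * N) + δ / n)
    (low : ∀ N : ℕ, 1 ≤ N → ∀ δ : ℝ, 0 < δ → ∃ B : ℕ, ∀ n : ℕ, 1 ≤ n → ∀ k : ℕ,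
      k + (2 * cellCount n + B * n) < 2 * cellCount n * N →
      κ * (Real.exp (1 / n) - 1) / (2 * Real.pi * N) - δ / n ≤ e k) :
    Tendsto (fun k : ℕ => e k * k / Real.log k) atTop (𝓝 (κ / Real.pi)) := by
  have hπ := Real.pi_pos
  refine tendsto_order.2 ⟨fun c hc => ?_, fun c hc => ?_⟩
  · obtain ⟨N, hN, hNc⟩ : ∃ N : ℕ, 3 ≤ N ∧ c < κ / (2 * Real.pi * N) * (2 * (N - 2)) := by
      have h1 : Tendsto (fun N : ℕ => κ / Real.pi - 2 * κ / Real.pi / N) atTop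
          (𝓝 (κ / Real.pi - 0)) :=
        tendsto_const_nhds.sub (tendsto_const_nhds.div_atTop tendsto_natCast_atTop_atTop)
      rw [sub_zero] at h1
      obtain ⟨N, h2, h3⟩ := ((h1.eventually_const_lt hc).and (eventually_ge_atTop 3)).exists
      refine ⟨N, h3, h2.trans_le (le_of_eq ?_)⟩
      have : (N : ℝ) ≠ 0 := by positivity
      field_simp
    have hN' : (3 : ℝ) ≤ N := by exact_mod_cast hN
    set a : ℝ := 2 * (N - 2) with ha_def
    have ha : 0 < a := by rw [ha_def]; linarith
    obtain ⟨δ, hδ, hδc⟩ : ∃ δ : ℝ, 0 < δ ∧ c < (κ / (2 * Real.pi * N) + -δ) * a := by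
      refine ⟨(κ / (2 * Real.pi * N) * a - c) / (2 * a), by
        apply div_pos <;> linarith, ?_⟩
      field_simp
      field_simp at hNc
      linarith
    obtain ⟨B, hB⟩ := low N (by omega) δ hδ
    have hlim := tendsto_mode_bound (κ := κ) (c := -δ) ha N
    have hcount : Tendsto (fun k : ℕ => (k : ℝ) / (⌈(k : ℝ) / (a * Real.log k)⌉₊ * Real.log k) +
        B / Real.log k - 2 * (N - 1) *
          (Real.log ⌈(k : ℝ) / (a * Real.log k)⌉₊ / Real.log k)) atTop
        (𝓝 (a + 0 - 2 * (N - 1) * 1)) :=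
      ((tendsto_div_ceil_mul_log ha).add (tendsto_const_nhds.div_atTop tendsto_natCast_log)).sub
        ((tendsto_log_ceil_div_log ha).const_mul _)
    have hneg : a + 0 - 2 * ((N : ℝ) - 1) * 1 < 0 := by rw [ha_def]; linarith
    filter_upwards [hlim.eventually_const_lt hδc, hcount.eventually_lt_const hneg,
      tendsto_natCast_log.eventually_gt_atTop 0,
      (tendsto_ceil_div_mul_log ha).eventually_gt_atTop 0] with k h1 h2 hl hn
    set n := ⌈(k : ℝ) / (a * Real.log k)⌉₊
    have hn' : (0 : ℝ) < n := by exact_mod_cast hn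
    have hk : k + (2 * cellCount n + B * n) < 2 * cellCount n * N := by
      have hJ : (n : ℝ) * Real.log n ≤ cellCount n := Nat.le_ceil _
      have h3 : (k : ℝ) + B * n < 2 * (N - 1) * (n * Real.log n) := by
        have := mul_neg_of_neg_of_pos h2 (mul_pos hn' hl)
        field_simp at this
        nlinarith
      have h4 : (k : ℝ) + B * n < 2 * (N - 1) * cellCount n :=
        h3.trans_le (mul_le_mul_of_nonneg_left hJ (by linarith))
      have h5 : (k : ℝ) + (2 * cellCount n + B * n) < 2 * cellCount n * N := by linarith
      exact_mod_cast h5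
    refine h1.trans_le ?_
    have h6 := hB n hn k hk
    rw [neg_div, ← sub_eq_add_neg]
    gcongr
  · obtain ⟨N, hN, hNc⟩ : ∃ N : ℕ, 1 ≤ N ∧ κ / (2 * Real.pi * N) * (2 * (N + 1)) < c := by
      have h1 : Tendsto (fun N : ℕ => κ / Real.pi + κ / Real.pi / N) atTop
          (𝓝 (κ / Real.pi + 0)) :=
        tendsto_const_nhds.add (tendsto_const_nhds.div_atTop tendsto_natCast_atTop_atTop)
      rw [add_zero] at h1
      obtain ⟨N, h2, h3⟩ := ((h1.eventually_lt_const hc).and (eventually_ge_atTop 1)).exists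
      refine ⟨N, h3, (le_of_eq ?_).trans_lt h2⟩
      have : (N : ℝ) ≠ 0 := by positivity
      field_simp
    have hN' : (1 : ℝ) ≤ N := by exact_mod_cast hN
    set a : ℝ := 2 * (N + 1) with ha_def
    have ha : 0 < a := by rw [ha_def]; linarith
    obtain ⟨δ, hδ, hδc⟩ : ∃ δ : ℝ, 0 < δ ∧ (κ / (2 * Real.pi * N) + δ) * a < c := by
      refine ⟨(c - κ / (2 * Real.pi * N) * a) / (2 * a), by
        apply div_pos <;> linarith, ?_⟩
      field_simp
      field_simp at hNc
      linarith
    obtain ⟨B, hB⟩ := up N hN δ hδ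
    have hlim := tendsto_mode_bound (κ := κ) (c := δ) ha N
    have hnlog : Tendsto (fun k : ℕ => (⌈(k : ℝ) / (a * Real.log k)⌉₊ : ℝ) * Real.log k) atTop
        atTop :=
      (tendsto_natCast_atTop_atTop.comp (tendsto_ceil_div_mul_log ha)).atTop_mul_atTop₀
        tendsto_natCast_log
    have hcount : Tendsto (fun k : ℕ => (k : ℝ) / (⌈(k : ℝ) / (a * Real.log k)⌉₊ * Real.log k) -
        B / Real.log k - 2 * N * (Real.log ⌈(k : ℝ) / (a * Real.log k)⌉₊ / Real.log k)
        - 2 * N / (⌈(k : ℝ) / (a * Real.log k)⌉₊ * Real.log k)) atTop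
        (𝓝 (a - 0 - 2 * N * 1 - 0)) :=
      (((tendsto_div_ceil_mul_log ha).sub (tendsto_const_nhds.div_atTop tendsto_natCast_log)).sub
        ((tendsto_log_ceil_div_log ha).const_mul _)).sub (tendsto_const_nhds.div_atTop hnlog)
    have hpos : 0 < a - 0 - 2 * (N : ℝ) * 1 - 0 := by rw [ha_def]; linarith
    filter_upwards [hlim.eventually_lt_const hδc, hcount.eventually_const_lt hpos,
      tendsto_natCast_log.eventually_gt_atTop 0,
      (tendsto_ceil_div_mul_log ha).eventually_gt_atTop 0] with k h1 h2 hl hn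
    set n := ⌈(k : ℝ) / (a * Real.log k)⌉₊
    have hn' : (0 : ℝ) < n := by exact_mod_cast hn
    have hk : 2 * cellCount n * N + B * n ≤ k := by
      have hJ : (cellCount n : ℝ) ≤ n * Real.log n + 1 :=
        (Nat.ceil_lt_add_one (mul_nonneg hn'.le (Real.log_natCast_nonneg n))).le
      have h3 : 2 * N * (n * Real.log n + 1) + B * n ≤ (k : ℝ) := by
        have := mul_pos h2 (mul_pos hn' hl)
        field_simp at this
        nlinarith
      have h4 : 2 * cellCount n * N + B * n ≤ (k : ℝ) := by
        nlinarith [mul_le_mul_of_nonneg_left hJ (by linarith : (0 : ℝ) ≤ 2 * N)]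
      exact_mod_cast h4
    refine lt_of_le_of_lt ?_ h1
    have h6 := hB n hn k hk
    gcongr

end Asymptotics

section KernelForm

open scoped ComplexConjugate

lemma memLp_conj {α : Type*} [MeasurableSpace α] {μ : Measure α} {p : ℝ≥0∞} {f : α → ℂ}
    (hf : MemLp f p μ) : MemLp (fun x => conj (f x)) p μ :=
  hf.of_le (Complex.continuous_conj.comp_aestronglyMeasurable hf.1)
    (ae_of_all _ fun x => by simp)

lemma memLp_two_tensor {f g : ℝ → ℂ} (hf : MemLp f 2 volume) (hg : MemLp g 2 volume) :
    MemLp (fun p : ℝ × ℝ => f p.2 * conj (g p.1)) 2 volume := by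
  have hm : AEStronglyMeasurable (fun p : ℝ × ℝ => f p.2 * conj (g p.1)) volume :=
    (hf.1.comp_snd).mul (Complex.continuous_conj.comp_aestronglyMeasurable hg.1.comp_fst)
  rw [memLp_two_iff_integrable_sq_norm hm]
  have h := ((memLp_two_iff_integrable_sq_norm hg.1).1 hg).mul_prod
    ((memLp_two_iff_integrable_sq_norm hf.1).1 hf)
  refine h.congr (ae_of_all _ fun p => ?_)
  simp [mul_pow, mul_comm]

/-- The tensor product `(w, v) ↦ f v * conj (g w)` in `L²(ℝ²)`. -/
def tensorLp (f g : L2R) : Lp ℂ 2 (volume : Measure (ℝ × ℝ)) :=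
  (memLp_two_tensor (Lp.memLp f) (Lp.memLp g)).toLp _

lemma coeFn_tensorLp (f g : L2R) :
    tensorLp f g =ᵐ[volume] fun p : ℝ × ℝ => f p.2 * conj (g p.1) :=
  MemLp.coeFn_toLp _

lemma ae_comp_fst {P : ℝ → Prop} (h : ∀ᵐ x : ℝ, P x) : ∀ᵐ p : ℝ × ℝ, P p.1 :=
  Measure.quasiMeasurePreserving_fst.ae h

lemma ae_comp_snd {P : ℝ → Prop} (h : ∀ᵐ x : ℝ, P x) : ∀ᵐ p : ℝ × ℝ, P p.2 :=
  Measure.quasiMeasurePreserving_snd.ae h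

lemma inner_tensorLp (f g f' g' : L2R) :
    ⟪tensorLp f g, tensorLp f' g'⟫_ℂ = ⟪f, f'⟫_ℂ * ⟪g', g⟫_ℂ := by
  rw [L2.inner_def, L2.inner_def, L2.inner_def, mul_comm, ← integral_prod_mul]
  refine integral_congr_ae ?_
  filter_upwards [coeFn_tensorLp f g, coeFn_tensorLp f' g'] with p h1 h2
  rw [h1, h2]
  simp only [RCLike.inner_apply, map_mul, Complex.conj_conj]
  ring

lemma norm_tensorLp (f g : L2R) : ‖tensorLp f g‖ = ‖f‖ * ‖g‖ := by
  have h := inner_tensorLp f g f g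
  rw [inner_self_eq_norm_sq_to_K, inner_self_eq_norm_sq_to_K, inner_self_eq_norm_sq_to_K] at h
  have h' : ‖tensorLp f g‖ ^ 2 = (‖f‖ * ‖g‖) ^ 2 := by
    rw [mul_pow]
    exact_mod_cast h
  exact (sq_eq_sq₀ (norm_nonneg _) (by positivity)).1 h'

lemma tensorLp_sub_left (f f' g : L2R) :
    tensorLp (f - f') g = tensorLp f g - tensorLp f' g := by
  apply Lp.ext
  filter_upwards [coeFn_tensorLp (f - f') g, coeFn_tensorLp f g, coeFn_tensorLp f' g,
    Lp.coeFn_sub (tensorLp f g) (tensorLp f' g), ae_comp_snd (Lp.coeFn_sub f f')]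
    with p h1 h2 h3 h4 h5
  rw [h1, h4, Pi.sub_apply, h2, h3, h5, Pi.sub_apply]
  ring

lemma tensorLp_sub_right (f g g' : L2R) :
    tensorLp f (g - g') = tensorLp f g - tensorLp f g' := by
  apply Lp.ext
  filter_upwards [coeFn_tensorLp f (g - g'), coeFn_tensorLp f g, coeFn_tensorLp f g',
    Lp.coeFn_sub (tensorLp f g) (tensorLp f g'), ae_comp_fst (Lp.coeFn_sub g g')]
    with p h1 h2 h3 h4 h5
  rw [h1, h4, Pi.sub_apply, h2, h3, h5, Pi.sub_apply, map_sub]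
  ring

lemma continuous_tensorLp_self : Continuous fun f : L2R => tensorLp f f := by
  rw [continuous_iff_continuousAt]
  intro f
  rw [ContinuousAt, tendsto_iff_norm_sub_tendsto_zero]
  have hlim : Tendsto (fun g : L2R => ‖g - f‖ * ‖g‖ + ‖f‖ * ‖g - f‖) (nhds f) (nhds 0) := by
    have hc : Continuous fun g : L2R => ‖g - f‖ * ‖g‖ + ‖f‖ * ‖g - f‖ := by fun_prop
    simpa using hc.tendsto f
  refine squeeze_zero (fun _ => norm_nonneg _) (fun g => ?_) hlim
  have : tensorLp g g - tensorLp f f = tensorLp (g - f) g + tensorLp f (g - f) := by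
    rw [tensorLp_sub_left, tensorLp_sub_right]
    abel
  rw [this, ← norm_tensorLp, ← norm_tensorLp]
  exact norm_add_le _ _

/-- The quadratic form of the integral operator with kernel `k`. -/
def kernelForm (k : ℝ × ℝ → ℂ) (f : L2R) : ℂ := ∫ p : ℝ × ℝ, k p * (f p.2 * conj (f p.1))

variable {k : ℝ × ℝ → ℂ}

lemma kernelForm_eq_inner (hk : MemLp k 2 volume) (f : L2R) :
    kernelForm k f = ⟪(memLp_conj hk).toLp _, tensorLp f f⟫_ℂ := by
  rw [L2.inner_def, kernelForm]
  refine integral_congr_ae ?_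
  filter_upwards [coeFn_tensorLp f f, (memLp_conj hk).coeFn_toLp] with p h1 h2
  rw [h1, h2]
  simp [mul_comm]

lemma integrable_kernelForm (hk : MemLp k 2 volume) (f : L2R) :
    Integrable fun p : ℝ × ℝ => k p * (f p.2 * conj (f p.1)) :=
  hk.integrable_mul (memLp_two_tensor (Lp.memLp f) (Lp.memLp f))

lemma continuous_kernelForm (hk : MemLp k 2 volume) : Continuous (kernelForm k) := by
  have : kernelForm k = fun f => ⟪(memLp_conj hk).toLp _, tensorLp f f⟫_ℂ :=
    funext (kernelForm_eq_inner hk)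
  rw [this]
  exact continuous_const.inner continuous_tensorLp_self

lemma kernelForm_add {k' : ℝ × ℝ → ℂ} (hk : MemLp k 2 volume) (hk' : MemLp k' 2 volume)
    (f : L2R) : kernelForm (fun p => k p + k' p) f = kernelForm k f + kernelForm k' f := by
  rw [kernelForm, kernelForm, kernelForm, ← integral_add (integrable_kernelForm hk f)
    (integrable_kernelForm hk' f)]
  simp only [add_mul]

lemma norm_sq_toLp_conj (hk : MemLp k 2 volume) :
    ‖(memLp_conj hk).toLp _‖ ^ 2 = ∫ p, ‖k p‖ ^ 2 := by
  have h := L2.inner_def (𝕜 := ℂ) ((memLp_conj hk).toLp _) ((memLp_conj hk).toLp _)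
  rw [inner_self_eq_norm_sq_to_K] at h
  have h2 : ∫ p, ⟪(memLp_conj hk).toLp _ p, (memLp_conj hk).toLp _ p⟫_ℂ
      = ((∫ p, ‖k p‖ ^ 2 : ℝ) : ℂ) := by
    rw [← integral_complex_ofReal]
    refine integral_congr_ae ?_
    filter_upwards [(memLp_conj hk).coeFn_toLp] with p hp
    rw [hp, inner_self_eq_norm_sq_to_K]
    simp
  rw [h2] at h
  exact Complex.ofReal_injective (by simpa using h)

lemma sum_norm_sq_kernelForm_le (hk : MemLp k 2 volume) {n : ℕ} {u : Fin n → L2R}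
    (hu : Orthonormal ℂ u) : ∑ i, ‖kernelForm k (u i)‖ ^ 2 ≤ ∫ p, ‖k p‖ ^ 2 := by
  have ht : Orthonormal ℂ fun i => tensorLp (u i) (u i) := by
    rw [orthonormal_iff_ite] at hu ⊢
    intro i j
    rw [inner_tensorLp, hu i j, hu j i]
    by_cases h : i = j <;> simp [h]
  rw [← norm_sq_toLp_conj hk]
  refine le_trans (le_of_eq ?_) (ht.sum_inner_products_le (s := Finset.univ) _)
  refine Finset.sum_congr rfl fun i _ => ?_
  rw [kernelForm_eq_inner hk, norm_inner_symm]

lemma exists_submodule_kernelForm_le (hk : MemLp k 2 volume) (V : Submodule ℂ L2R) {r B : ℕ}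
    (hV : Module.rank ℂ V ≤ (r : Cardinal)) {c : ℝ} (hc : 0 < c)
    (hB : (∫ p, ‖k p‖ ^ 2) ≤ c ^ 2 * B) :
    ∃ W : Submodule ℂ L2R, V ≤ W ∧ Module.rank ℂ W ≤ ((r + B : ℕ) : Cardinal) ∧
      ∀ u ∈ Wᗮ, ‖kernelForm k u‖ ≤ c * ‖u‖ ^ 2 := by
  obtain ⟨W, hVW, hW, h⟩ := exists_submodule_forall_unit_le (fun u => ‖kernelForm k u‖) c V r B hV
    (by
      intro n u hu _ huc
      have h1 := sum_norm_sq_kernelForm_le hk hu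
      have h2 : ∑ i : Fin n, c ^ 2 ≤ ∑ i, ‖kernelForm k (u i)‖ ^ 2 :=
        Finset.sum_le_sum fun i _ => pow_le_pow_left₀ hc.le (huc i).le 2
      rw [Finset.sum_const, Finset.card_univ, Fintype.card_fin, nsmul_eq_mul] at h2
      have h3 : c ^ 2 * (n : ℝ) ≤ c ^ 2 * B := by linarith
      exact_mod_cast le_of_mul_le_mul_left h3 (by positivity))
  refine ⟨W, hVW, hW, fun u hu => ?_⟩
  by_cases hu0 : u = 0
  · subst hu0
    rw [kernelForm_eq_inner hk]
    have : tensorLp (0 : L2R) 0 = 0 := by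
      rw [← norm_eq_zero, norm_tensorLp]
      simp
    simp [this]
  · have hn : ‖u‖ ≠ 0 := by simpa using hu0
    have h1 := h (((‖u‖⁻¹ : ℝ) : ℂ) • u) (Wᗮ.smul_mem _ hu) (by rw [norm_smul]; simp [hn])
    have h2 : kernelForm k (((‖u‖⁻¹ : ℝ) : ℂ) • u) = ((‖u‖⁻¹ : ℝ) : ℂ) ^ 2 * kernelForm k u := by
      rw [kernelForm, kernelForm, ← integral_const_mul]
      refine integral_congr_ae ?_
      have hs := Lp.coeFn_smul ((‖u‖⁻¹ : ℝ) : ℂ) u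
      filter_upwards [ae_comp_fst hs, ae_comp_snd hs] with p hp1 hp2
      rw [hp1, hp2]
      simp only [Pi.smul_apply, smul_eq_mul, map_mul, Complex.conj_ofReal]
      ring
    simp only [h2, norm_mul, norm_pow, Complex.norm_real, norm_inv, norm_norm] at h1
    field_simp at h1
    linarith

end KernelForm

section IntervalForm

open scoped ComplexConjugate

/-- The Fourier mode `x ↦ exp (2πimx/ℓ)`. -/
def expMode (ℓ : ℝ) (m : ℤ) (x : ℝ) : ℂ := Complex.exp ((2 * Real.pi * m * x / ℓ : ℝ) * Complex.I)

lemma continuous_expMode (ℓ : ℝ) (m : ℤ) : Continuous (expMode ℓ m) := by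
  unfold expMode
  fun_prop

lemma norm_expMode (ℓ : ℝ) (m : ℤ) (x : ℝ) : ‖expMode ℓ m x‖ = 1 :=
  Complex.norm_exp_ofReal_mul_I _

lemma expMode_zero (ℓ : ℝ) (x : ℝ) : expMode ℓ 0 x = 1 := by simp [expMode]

lemma conj_expMode (ℓ : ℝ) (m : ℤ) (x : ℝ) : conj (expMode ℓ m x) = expMode ℓ (-m) x := by
  rw [expMode, expMode, ← Complex.exp_conj]
  congr 1
  simp only [map_mul, Complex.conj_ofReal, Complex.conj_I]
  push_cast
  ring

/-- The unnormalised Fourier coefficient of `f` on `(a, b]`. -/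
def modeCoef (a b : ℝ) (m : ℤ) (f : ℝ → ℂ) : ℂ :=
  ∫ x in Set.Ioc a b, expMode (b - a) (-m) x * f x

variable {a b : ℝ} {f g : ℝ → ℂ}

lemma modeCoef_eq (hab : a < b) (m : ℤ) (f : ℝ → ℂ) :
    modeCoef a b m f = (b - a : ℝ) * fourierCoeffOn hab f m := by
  have h : b - a ≠ 0 := by linarith
  rw [fourierCoeffOn_eq_integral, intervalIntegral.integral_of_le hab.le, modeCoef]
  rw [Complex.real_smul, ← mul_assoc, ← Complex.ofReal_mul, mul_one_div_cancel h,
    Complex.ofReal_one, one_mul]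
  refine integral_congr_ae (ae_of_all _ fun x => ?_)
  simp only [fourier_coe_apply, smul_eq_mul, expMode]
  congr 2
  push_cast
  ring

lemma hasSum_norm_sq_modeCoef (hab : a < b) (hf : MemLp f 2 (volume.restrict (Set.Ioc a b))) :
    HasSum (fun m => ‖modeCoef a b m f‖ ^ 2 / (b - a)) (∫ x in Set.Ioc a b, ‖f x‖ ^ 2) := by
  have h : 0 < b - a := by linarith
  have h1 := (hasSum_sq_fourierCoeffOn hab hf).mul_left (b - a)
  rw [smul_eq_mul, mul_inv_cancel_left₀ h.ne', intervalIntegral.integral_of_le hab.le] at h1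
  refine h1.congr_fun ?_ |> id
  intro m
  rw [modeCoef_eq hab, norm_mul, Complex.norm_real, Real.norm_of_nonneg h.le]
  field_simp

lemma integrable_expMode_mul {μ : Measure ℝ} (ℓ : ℝ) (m : ℤ) (hf : Integrable f μ) :
    Integrable (fun x => expMode ℓ m x * f x) μ :=
  hf.bdd_mul (c := 1) (continuous_expMode ℓ m).aestronglyMeasurable
    (ae_of_all _ fun x => (norm_expMode ℓ m x).le)

lemma modeCoef_add (m : ℤ) (hf : IntegrableOn f (Set.Ioc a b))
    (hg : IntegrableOn g (Set.Ioc a b)) :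
    modeCoef a b m (fun x => f x + g x) = modeCoef a b m f + modeCoef a b m g := by
  simp only [modeCoef, mul_add]
  exact integral_add (integrable_expMode_mul _ _ hf) (integrable_expMode_mul _ _ hg)

lemma modeCoef_sub (m : ℤ) (hf : IntegrableOn f (Set.Ioc a b))
    (hg : IntegrableOn g (Set.Ioc a b)) :
    modeCoef a b m (fun x => f x - g x) = modeCoef a b m f - modeCoef a b m g := by
  simp only [modeCoef, mul_sub]
  exact integral_sub (integrable_expMode_mul _ _ hf) (integrable_expMode_mul _ _ hg)

lemma norm_sq_add_sub_norm_sq_sub (z w : ℂ) :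
    ‖z + w‖ ^ 2 - ‖z - w‖ ^ 2 = 4 * (z * conj w).re := by
  simp only [← Complex.normSq_eq_norm_sq, Complex.normSq_apply, Complex.add_re, Complex.add_im,
    Complex.sub_re, Complex.sub_im, Complex.mul_re, Complex.conj_re, Complex.conj_im]
  ring

lemma integrable_norm_sq_of_memLp {μ : Measure ℝ} (hf : MemLp f 2 μ) :
    Integrable (fun x => ‖f x‖ ^ 2) μ :=
  (memLp_two_iff_integrable_sq_norm hf.1).1 hf

/-- Polarised Parseval identity on an interval. -/
lemma hasSum_re_modeCoef_mul_conj (hab : a < b)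
    (hf : MemLp f 2 (volume.restrict (Set.Ioc a b)))
    (hg : MemLp g 2 (volume.restrict (Set.Ioc a b))) :
    HasSum (fun m => (modeCoef a b m f * conj (modeCoef a b m g)).re / (b - a))
      (∫ x in Set.Ioc a b, (f x * conj (g x)).re) := by
  have hfi : IntegrableOn f (Set.Ioc a b) := hf.integrable (by norm_num)
  have hgi : IntegrableOn g (Set.Ioc a b) := hg.integrable (by norm_num)
  have h1 := hasSum_norm_sq_modeCoef hab (hf.add hg)
  have h2 := hasSum_norm_sq_modeCoef hab (hf.sub hg)
  have h3 := (h1.sub h2).mul_left (4⁻¹ : ℝ)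
  rw [← integral_sub (integrable_norm_sq_of_memLp (hf.add hg))
    (integrable_norm_sq_of_memLp (hf.sub hg)), ← integral_const_mul] at h3
  convert h3 using 1
  · rfl
  · ext m
    have e1 : modeCoef a b m (f + g) = _ := modeCoef_add m hfi hgi
    have e2 : modeCoef a b m (f - g) = _ := modeCoef_sub m hfi hgi
    rw [e1, e2, ← sub_div, norm_sq_add_sub_norm_sq_sub]
    ring
  · refine integral_congr_ae (ae_of_all _ fun x => ?_)
    simp only [Pi.add_apply, Pi.sub_apply]
    rw [norm_sq_add_sub_norm_sq_sub]
    ring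

/-- The kernel of the triangle `a < x < y ≤ b`. -/
def triangle (a b : ℝ) : Set (ℝ × ℝ) := {p | a < p.1 ∧ p.1 < p.2 ∧ p.2 ≤ b}

lemma measurableSet_triangle (a b : ℝ) : MeasurableSet (triangle a b) := by
  unfold triangle
  measurability

lemma triangle_indicator_eq (a b : ℝ) (f g : ℝ → ℂ) (p : ℝ × ℝ) :
    (triangle a b).indicator (fun p => g p.1 * f p.2) p =
      (triangle a b).indicator (fun p => (Set.Ioc a b).indicator g p.1 *
        (Set.Ioc a b).indicator f p.2) p := by
  by_cases hp : p ∈ triangle a b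
  · obtain ⟨h1, h2, h3⟩ := id hp
    rw [Set.indicator_of_mem hp, Set.indicator_of_mem hp,
      Set.indicator_of_mem (show p.1 ∈ Set.Ioc a b from ⟨h1, h2.le.trans h3⟩),
      Set.indicator_of_mem (show p.2 ∈ Set.Ioc a b from ⟨h1.trans h2, h3⟩)]
  · rw [Set.indicator_of_notMem hp, Set.indicator_of_notMem hp]

lemma integrable_triangle (hf : IntegrableOn f (Set.Ioc a b))
    (hg : IntegrableOn g (Set.Ioc a b)) :
    Integrable ((triangle a b).indicator fun p => g p.1 * f p.2) := by
  have h : (triangle a b).indicator (fun p : ℝ × ℝ => g p.1 * f p.2) = _ :=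
    funext (triangle_indicator_eq a b f g)
  rw [h]
  refine Integrable.indicator ?_ (measurableSet_triangle a b)
  exact (hg.integrable_indicator measurableSet_Ioc).mul_prod
    (hf.integrable_indicator measurableSet_Ioc)

lemma integral_triangle (hf : IntegrableOn f (Set.Ioc a b))
    (hg : IntegrableOn g (Set.Ioc a b)) :
    ∫ p, (triangle a b).indicator (fun p => g p.1 * f p.2) p =
      ∫ x in Set.Ioc a b, g x * ∫ y in Set.Ioc x b, f y := by
  rw [Measure.volume_eq_prod, integral_prod _ (integrable_triangle hf hg),
    ← integral_indicator measurableSet_Ioc]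
  refine integral_congr_ae (ae_of_all _ fun x => ?_)
  by_cases hx : x ∈ Set.Ioc a b
  · rw [Set.indicator_of_mem hx, ← integral_indicator measurableSet_Ioc, ← integral_const_mul]
    refine integral_congr_ae (ae_of_all _ fun y => ?_)
    by_cases hy : y ∈ Set.Ioc x b
    · have : (x, y) ∈ triangle a b := ⟨hx.1, hy.1, hy.2⟩
      simp [Set.indicator_of_mem, this, hy]
    · have : (x, y) ∉ triangle a b := fun h => hy ⟨h.2.1, h.2.2⟩
      simp only [Set.indicator_of_notMem, this, hy, not_false_eq_true, mul_zero]
  · rw [Set.indicator_of_notMem hx]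
    refine (integral_congr_ae (ae_of_all _ fun y => ?_)).trans (integral_zero _ _)
    have : (x, y) ∉ triangle a b := fun h => hx ⟨h.1, h.2.1.le.trans h.2.2⟩
    simp only [Set.indicator_of_notMem, this, not_false_eq_true]

lemma integral_triangle_symm (hf : IntegrableOn f (Set.Ioc a b))
    (hg : IntegrableOn g (Set.Ioc a b)) :
    ∫ p, (triangle a b).indicator (fun p => g p.1 * f p.2) p =
      ∫ y in Set.Ioc a b, f y * ∫ x in Set.Ioc a y, g x := by
  rw [Measure.volume_eq_prod, integral_prod_symm _ (integrable_triangle hf hg),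
    ← integral_indicator measurableSet_Ioc]
  refine integral_congr_ae (ae_of_all _ fun y => ?_)
  by_cases hy : y ∈ Set.Ioc a b
  · rw [Set.indicator_of_mem hy, integral_Ioc_eq_integral_Ioo,
      ← integral_indicator measurableSet_Ioo, ← integral_const_mul]
    refine integral_congr_ae (ae_of_all _ fun x => ?_)
    by_cases hx : x ∈ Set.Ioo a y
    · have : (x, y) ∈ triangle a b := ⟨hx.1, hx.2, hy.2⟩
      simp [Set.indicator_of_mem, this, hx, mul_comm]
    · have : (x, y) ∉ triangle a b := fun h => hx ⟨h.1, h.2.1⟩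
      simp only [Set.indicator_of_notMem, this, hx, not_false_eq_true, mul_zero]
  · rw [Set.indicator_of_notMem hy]
    refine (integral_congr_ae (ae_of_all _ fun x => ?_)).trans (integral_zero _ _)
    have : (x, y) ∉ triangle a b := fun h => hy ⟨h.1.trans h.2.1, h.2.2⟩
    simp only [Set.indicator_of_notMem, this, not_false_eq_true]

lemma integral_Ioc_expMode {a y ℓ : ℝ} (hy : a ≤ y) (hℓ : ℓ ≠ 0) {m : ℤ} (hm : m ≠ 0) :
    ∫ x in Set.Ioc a y, expMode ℓ m x =
      (expMode ℓ m y - expMode ℓ m a) * (ℓ / (2 * Real.pi * m * Complex.I)) := by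
  have hc : (2 * Real.pi * m / ℓ * Complex.I : ℂ) ≠ 0 := by
    have : (Real.pi : ℂ) ≠ 0 := by exact_mod_cast Real.pi_ne_zero
    have : (m : ℂ) ≠ 0 := by exact_mod_cast hm
    have : (ℓ : ℂ) ≠ 0 := by exact_mod_cast hℓ
    simp [*]
  have h := integral_exp_mul_complex (a := a) (b := y) hc
  have he : ∀ x : ℝ, expMode ℓ m x = Complex.exp (2 * Real.pi * m / ℓ * Complex.I * x) := by
    intro x
    rw [expMode]
    congr 1
    push_cast
    ring
  rw [← intervalIntegral.integral_of_le hy]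
  simp only [he, h]
  have : (ℓ : ℂ) ≠ 0 := by exact_mod_cast hℓ
  field_simp

/-- The Fourier coefficients of a primitive of a mean-zero function. -/
lemma modeCoef_primitive (hab : a < b) (hf : IntegrableOn f (Set.Ioc a b))
    (h0 : modeCoef a b 0 f = 0) {m : ℤ} (hm : m ≠ 0) :
    modeCoef a b m (fun x => ∫ y in Set.Ioc x b, f y) =
      modeCoef a b m f * (-(b - a : ℝ) / (2 * Real.pi * m * Complex.I)) := by
  have hmean : ∫ x in Set.Ioc a b, f x = 0 := by
    simpa [modeCoef, expMode_zero] using h0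
  have hE : IntegrableOn (expMode (b - a) (-m)) (Set.Ioc a b) :=
    ((continuous_expMode _ _).integrableOn_Icc).mono_set Set.Ioc_subset_Icc_self
  rw [modeCoef, ← integral_triangle hf hE, integral_triangle_symm hf hE]
  have hm' : -m ≠ 0 := by simpa using hm
  have h1 : ∀ y ∈ Set.Ioc a b, f y * ∫ x in Set.Ioc a y, expMode (b - a) (-m) x =
      (expMode (b - a) (-m) y * f y) * (-(b - a : ℝ) / (2 * Real.pi * m * Complex.I)) -
      f y * (expMode (b - a) (-m) a * (-(b - a : ℝ) / (2 * Real.pi * m * Complex.I))) := by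
    intro y hy
    rw [integral_Ioc_expMode hy.1.le (by linarith) hm']
    have : ((b - a : ℝ) : ℂ) / (2 * Real.pi * (-m : ℤ) * Complex.I) =
      -(b - a : ℝ) / (2 * Real.pi * m * Complex.I) := by
      push_cast
      rw [mul_neg, neg_mul, div_neg, neg_div]
    rw [this]
    ring
  rw [setIntegral_congr_fun measurableSet_Ioc h1, integral_sub, integral_mul_const,
    integral_mul_const, hmean, zero_mul, sub_zero, modeCoef]
  · exact (integrable_expMode_mul _ _ hf).mul_const _
  · exact hf.mul_const _

lemma memLp_primitive (hf : IntegrableOn f (Set.Ioc a b)) :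
    MemLp (fun x => ∫ y in Set.Ioc x b, f y) 2 (volume.restrict (Set.Ioc a b)) := by
  rcases le_or_gt b a with h | hab
  · simp [Set.Ioc_eq_empty (not_lt.2 h)]
  have hc : ContinuousOn (fun x => ∫ y in x..b, f y) (Set.Icc a b) := by
    have := intervalIntegral.continuousOn_primitive_interval_left (μ := volume) (f := f)
      (a := a) (b := b) (by rwa [Set.uIcc_of_le hab.le, integrableOn_Icc_iff_integrableOn_Ioc])
    rwa [Set.uIcc_of_le hab.le] at this
  obtain ⟨C, hC⟩ := isCompact_Icc.exists_bound_of_continuousOn hc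
  have h2 : MemLp (fun x => ∫ y in x..b, f y) 2 (volume.restrict (Set.Icc a b)) :=
    MemLp.of_bound (hc.aestronglyMeasurable measurableSet_Icc) C
      ((ae_restrict_mem measurableSet_Icc).mono fun x hx => hC x hx)
  refine (h2.mono_measure (Measure.restrict_mono Set.Ioc_subset_Icc_self le_rfl)).ae_eq ?_
  filter_upwards [ae_restrict_mem measurableSet_Ioc] with x hx
  rw [intervalIntegral.integral_of_le hx.2]

/-- Diagonalisation of the triangular form on an interval in Fourier modes. -/
lemma hasSum_triangleForm (hab : a < b)
    (hf : MemLp f 2 (volume.restrict (Set.Ioc a b)))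
    (hg : MemLp g 2 (volume.restrict (Set.Ioc a b)))
    (hf0 : modeCoef a b 0 f = 0) (hg0 : modeCoef a b 0 g = 0) (c : ℝ) :
    HasSum (fun m : ℤ => -(c / (Real.pi * m)) *
        (modeCoef a b m f * conj (modeCoef a b m g)).re)
      (2 * (Complex.I * c * ∫ p, (triangle a b).indicator
        (fun p => conj (g p.1) * f p.2) p).re) := by
  have hfi : IntegrableOn f (Set.Ioc a b) := hf.integrable (by norm_num)
  have hgc := memLp_conj hg
  have hgi : IntegrableOn (fun x => conj (g x)) (Set.Ioc a b) := hgc.integrable (by norm_num)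
  have hF := memLp_primitive hfi
  have h1 := hasSum_re_modeCoef_mul_conj hab (hF.const_mul (2 * Complex.I * c)) hg
  convert h1 using 1
  · ext m
    have : modeCoef a b m (fun x => 2 * Complex.I * c * ∫ y in Set.Ioc x b, f y) =
        2 * Complex.I * c * modeCoef a b m (fun x => ∫ y in Set.Ioc x b, f y) := by
      rw [modeCoef, modeCoef, ← integral_const_mul]
      congr 1
      ext x
      ring
    rw [this]
    by_cases hm : m = 0
    · simp [hm, hg0]
    rw [modeCoef_primitive hab hfi hf0 hm]
    have hl : b - a ≠ 0 := by linarith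
    have hm' : (m : ℂ) ≠ 0 := by exact_mod_cast hm
    have hp : (Real.pi : ℂ) ≠ 0 := by exact_mod_cast Real.pi_ne_zero
    have e : 2 * Complex.I * c * (modeCoef a b m f *
        (-(b - a : ℝ) / (2 * Real.pi * m * Complex.I))) * conj (modeCoef a b m g) =
        ((-(c * (b - a) / (Real.pi * m)) : ℝ) : ℂ) *
          (modeCoef a b m f * conj (modeCoef a b m g)) := by
      push_cast
      field_simp
    rw [e, Complex.re_ofReal_mul]
    field_simp
  · rw [integral_triangle hfi hgi, ← integral_const_mul]
    have hint : Integrable (fun x => Complex.I * c * (conj (g x) * ∫ y in Set.Ioc x b, f y))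
        (volume.restrict (Set.Ioc a b)) := (hgc.integrable_mul hF).const_mul _
    have := integral_re hint
    simp only [RCLike.re_to_complex] at this
    rw [← this, ← integral_const_mul]
    congr 1
    ext x
    rw [show 2 * Complex.I * c * (∫ y in Set.Ioc x b, f y) * conj (g x) =
      (2 : ℝ) * (Complex.I * c * (conj (g x) * ∫ y in Set.Ioc x b, f y)) by push_cast; ring,
      Complex.re_ofReal_mul]

/-- The sign pairing positive and negative modes. -/
def modeSign (c : ℝ) (m : ℤ) : ℝ := if 0 ≤ c * m then 1 else -1

lemma modeSign_mul (c : ℝ) (m : ℤ) : modeSign c m * (c * m) = |c| * |(m : ℝ)| := by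
  unfold modeSign
  split_ifs with h
  · rw [one_mul, ← abs_mul, abs_of_nonneg h]
  · rw [← abs_mul, abs_of_neg (not_le.1 h)]
    ring

lemma div_mul_modeSign (c : ℝ) (m : ℤ) : c / (Real.pi * m) * modeSign c m =
    |c| / (Real.pi * |(m : ℝ)|) := by
  by_cases hm : m = 0
  · simp [hm]
  have hm' : (m : ℝ) ≠ 0 := by exact_mod_cast hm
  have h := modeSign_mul c m
  have h2 : |(m : ℝ)| ^ 2 = (m : ℝ) ^ 2 := sq_abs _
  have h3 : |(m : ℝ)| ≠ 0 := by simpa using hm'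
  field_simp
  have : c * modeSign c m * |(m : ℝ)| * m = m * |c| * m := by
    calc c * modeSign c m * |(m : ℝ)| * m = (modeSign c m * (c * m)) * |(m : ℝ)| := by ring
      _ = |c| * |(m : ℝ)| ^ 2 := by rw [h]; ring
      _ = _ := by rw [h2]; ring
  exact mul_right_cancel₀ hm' this

lemma abs_re_mul_conj_le (z w : ℂ) : |(z * conj w).re| ≤ (‖z‖ ^ 2 + ‖w‖ ^ 2) / 2 := by
  have h := Complex.abs_re_le_norm (z * conj w)
  rw [norm_mul, RCLike.norm_conj] at h
  nlinarith [sq_nonneg (‖z‖ - ‖w‖)]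

lemma triangleForm_le (hab : a < b)
    (hf : MemLp f 2 (volume.restrict (Set.Ioc a b)))
    (hg : MemLp g 2 (volume.restrict (Set.Ioc a b)))
    (hf0 : modeCoef a b 0 f = 0) (hg0 : modeCoef a b 0 g = 0) (c : ℝ) {N : ℕ} (hN : 1 ≤ N)
    (h : ∀ m : ℤ, m ≠ 0 → |m| < N → modeCoef a b m f = modeSign c m * modeCoef a b m g) :
    2 * (Complex.I * c * ∫ p, (triangle a b).indicator
        (fun p => conj (g p.1) * f p.2) p).re ≤
      |c| * (b - a) / (2 * Real.pi * N) *
        ((∫ x in Set.Ioc a b, ‖f x‖ ^ 2) + ∫ x in Set.Ioc a b, ‖g x‖ ^ 2) := by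
  have hN' : (1 : ℝ) ≤ N := by exact_mod_cast hN
  have hl : 0 < b - a := by linarith
  have hpi := Real.pi_pos
  refine hasSum_le (fun m => ?_) (hasSum_triangleForm hab hf hg hf0 hg0 c)
    (((hasSum_norm_sq_modeCoef hab hf).add (hasSum_norm_sq_modeCoef hab hg)).mul_left _)
  have hrhs : |c| * (b - a) / (2 * Real.pi * N) * (‖modeCoef a b m f‖ ^ 2 / (b - a) +
      ‖modeCoef a b m g‖ ^ 2 / (b - a)) = |c| / (Real.pi * N) *
      ((‖modeCoef a b m f‖ ^ 2 + ‖modeCoef a b m g‖ ^ 2) / 2) := by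
    field_simp
  rw [hrhs]
  by_cases hm : m = 0
  · rw [hm, hf0, hg0]
    simp
  rcases lt_or_ge |m| (N : ℤ) with hmN | hmN
  · rw [h m hm hmN, mul_assoc, Complex.re_ofReal_mul, Complex.mul_conj, Complex.ofReal_re,
      ← mul_assoc, neg_mul, div_mul_modeSign]
    have h1 : 0 ≤ |c| / (Real.pi * |(m : ℝ)|) * Complex.normSq (modeCoef a b m g) := by
      have := Complex.normSq_nonneg (modeCoef a b m g)
      positivity
    have h2 : 0 ≤ |c| / (Real.pi * N) * ((‖modeSign c m * modeCoef a b m g‖ ^ 2 +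
      ‖modeCoef a b m g‖ ^ 2) / 2) := by positivity
    linarith
  · have hmN' : (N : ℝ) ≤ |(m : ℝ)| := by exact_mod_cast hmN
    refine (le_abs_self _).trans ?_
    rw [abs_mul, abs_neg, abs_div, abs_mul, abs_of_pos hpi]
    refine mul_le_mul ?_ (abs_re_mul_conj_le _ _) (abs_nonneg _) (by positivity)
    gcongr

lemma le_triangleForm (hab : a < b)
    (hf : MemLp f 2 (volume.restrict (Set.Ioc a b)))
    (hg : MemLp g 2 (volume.restrict (Set.Ioc a b)))
    (hf0 : modeCoef a b 0 f = 0) (hg0 : modeCoef a b 0 g = 0) (c : ℝ) {N : ℕ}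
    (hN : 1 ≤ N)
    (h : ∀ m : ℤ, m ≠ 0 → |m| ≤ N → modeCoef a b m f = -(modeSign c m * modeCoef a b m g))
    (h' : ∀ m : ℤ, N < |m| → modeCoef a b m f = 0 ∧ modeCoef a b m g = 0) :
    |c| * (b - a) / (2 * Real.pi * N) *
        ((∫ x in Set.Ioc a b, ‖f x‖ ^ 2) + ∫ x in Set.Ioc a b, ‖g x‖ ^ 2) ≤
      2 * (Complex.I * c * ∫ p, (triangle a b).indicator
        (fun p => conj (g p.1) * f p.2) p).re := by
  have hN' : (1 : ℝ) ≤ N := by exact_mod_cast hN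
  have hl : 0 < b - a := by linarith
  have hpi := Real.pi_pos
  refine hasSum_le (fun m => ?_)
    (((hasSum_norm_sq_modeCoef hab hf).add (hasSum_norm_sq_modeCoef hab hg)).mul_left _)
    (hasSum_triangleForm hab hf hg hf0 hg0 c)
  have hrhs : |c| * (b - a) / (2 * Real.pi * N) * (‖modeCoef a b m f‖ ^ 2 / (b - a) +
      ‖modeCoef a b m g‖ ^ 2 / (b - a)) = |c| / (Real.pi * N) *
      ((‖modeCoef a b m f‖ ^ 2 + ‖modeCoef a b m g‖ ^ 2) / 2) := by
    field_simp
  rw [hrhs]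
  by_cases hm : m = 0
  · rw [hm, hf0, hg0]
    simp
  rcases lt_or_ge (N : ℤ) |m| with hmN | hmN
  · rw [(h' m hmN).1, (h' m hmN).2]
    simp
  · have hmN' : |(m : ℝ)| ≤ (N : ℝ) := by exact_mod_cast hmN
    have hm0 : 0 < |(m : ℝ)| := by simpa using hm
    have hs : |modeSign c m| = 1 := by
      unfold modeSign
      split_ifs <;> simp
    rw [h m hm hmN, neg_mul, neg_mul, mul_assoc (modeSign c m : ℂ), Complex.neg_re,
      Complex.re_ofReal_mul, Complex.mul_conj, Complex.ofReal_re, mul_neg, neg_neg, ← mul_assoc,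
      div_mul_modeSign, norm_neg, norm_mul,
      Complex.norm_real, Real.norm_eq_abs, hs, one_mul, add_self_div_two,
      Complex.normSq_eq_norm_sq]
    gcongr

end IntervalForm

section Modes

open scoped ComplexConjugate

/-- Multiplication by a sign on the real line. -/
def signMul (σ : ℤˣ) : ℝ ≃ᵐ ℝ where
  toFun x := ((σ : ℤ) : ℝ) * x
  invFun x := ((σ : ℤ) : ℝ) * x
  left_inv x := by rcases Int.units_eq_one_or σ with h | h <;> simp [h]
  right_inv x := by rcases Int.units_eq_one_or σ with h | h <;> simp [h]
  measurable_toFun := by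
    change Measurable fun x : ℝ => ((σ : ℤ) : ℝ) * x
    fun_prop
  measurable_invFun := by
    change Measurable fun x : ℝ => ((σ : ℤ) : ℝ) * x
    fun_prop

lemma signMul_apply (σ : ℤˣ) (x : ℝ) : signMul σ x = ((σ : ℤ) : ℝ) * x := rfl

@[simp] lemma signMul_one (x : ℝ) : signMul 1 x = x := by simp [signMul_apply]

@[simp] lemma signMul_neg_one (x : ℝ) : signMul (-1) x = -x := by simp [signMul_apply]

@[simp] lemma signMul_signMul (σ : ℤˣ) (x : ℝ) : signMul σ (signMul σ x) = x :=
  (signMul σ).left_inv x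

lemma abs_signMul (σ : ℤˣ) (x : ℝ) : |signMul σ x| = |x| := by
  rcases Int.units_eq_one_or σ with h | h <;> simp [h]

lemma measurePreserving_signMul (σ : ℤˣ) : MeasurePreserving (signMul σ) volume volume := by
  rcases Int.units_eq_one_or σ with h | h
  · have : ⇑(signMul σ) = id := by ext x; simp [h]
    rw [this]
    exact MeasurePreserving.id _
  · have : ⇑(signMul σ) = Neg.neg := by ext x; simp [h]
    rw [this]
    exact Measure.measurePreserving_neg volume

lemma memLp_comp_signMul (σ : ℤˣ) {f : ℝ → ℂ} (hf : MemLp f 2 volume) :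
    MemLp (fun x => f (signMul σ x)) 2 volume :=
  hf.comp_measurePreserving (measurePreserving_signMul σ)

lemma memLp_indicator_expMode (a b : ℝ) (m : ℤ) :
    MemLp ((Set.Ioc a b).indicator (expMode (b - a) m)) 2 volume := by
  rw [memLp_indicator_iff_restrict measurableSet_Ioc]
  exact MemLp.of_bound (continuous_expMode _ _).aestronglyMeasurable 1
    (ae_of_all _ fun x => (norm_expMode _ _ _).le)

/-- The Fourier mode supported on the (reflected) interval. -/
def modeVec (σ : ℤˣ) (a b : ℝ) (m : ℤ) : L2R :=
  (memLp_comp_signMul σ (memLp_indicator_expMode a b m)).toLp _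

lemma coeFn_modeVec (σ : ℤˣ) (a b : ℝ) (m : ℤ) : modeVec σ a b m =ᵐ[volume]
    fun x => (Set.Ioc a b).indicator (expMode (b - a) m) (signMul σ x) :=
  MemLp.coeFn_toLp _

lemma inner_modeVec (σ : ℤˣ) (a b : ℝ) (m : ℤ) (f : L2R) :
    ⟪modeVec σ a b m, f⟫_ℂ = modeCoef a b m (fun x => f (signMul σ x)) := by
  rw [L2.inner_def, modeCoef, ← integral_indicator measurableSet_Ioc,
    ← (measurePreserving_signMul σ).integral_comp (signMul σ).measurableEmbedding]
  refine integral_congr_ae ?_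
  filter_upwards [(measurePreserving_signMul σ).quasiMeasurePreserving.ae
    (coeFn_modeVec σ a b m)] with x hx
  rw [hx, RCLike.inner_apply, signMul_signMul]
  by_cases h : x ∈ Set.Ioc a b
  · rw [Set.indicator_of_mem h, Set.indicator_of_mem h, conj_expMode, mul_comm]
  · rw [Set.indicator_of_notMem h, Set.indicator_of_notMem h, map_zero, mul_zero]

/-- The reflected half-open cells of a partition of the half line. -/
def signCell (t : ℕ → ℝ) (σ : ℤˣ) (j : ℕ) : Set ℝ := signMul σ ⁻¹' Set.Ioc (t j) (t (j + 1))

lemma measurableSet_signCell (t : ℕ → ℝ) (σ : ℤˣ) (j : ℕ) : MeasurableSet (signCell t σ j) :=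
  (signMul σ).measurable measurableSet_Ioc

variable {t : ℕ → ℝ}

lemma signCell_unique (ht : StrictMono t) (h0 : t 0 = 0) {σ σ' : ℤˣ} {j j' : ℕ} {x : ℝ}
    (h : x ∈ signCell t σ j) (h' : x ∈ signCell t σ' j') : σ = σ' ∧ j = j' := by
  have hnn : ∀ j, 0 ≤ t j := fun j => h0 ▸ ht.monotone (Nat.zero_le j)
  have hpos : ∀ {σ : ℤˣ} {j : ℕ}, x ∈ signCell t σ j → 0 < signMul σ x :=
    fun {σ j} h => (hnn j).trans_lt h.1
  have habs : ∀ {σ : ℤˣ} {j : ℕ}, x ∈ signCell t σ j → |x| ∈ Set.Ioc (t j) (t (j + 1)) := by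
    intro σ j h
    rw [← abs_signMul σ, abs_of_pos (hpos h)]
    exact h
  constructor
  · have h1 := hpos h
    have h2 := hpos h'
    rcases Int.units_eq_one_or σ with e | e <;> rcases Int.units_eq_one_or σ' with e' | e' <;>
      subst e <;> subst e' <;> simp at h1 h2 ⊢ <;> linarith
  · have h1 := habs h
    have h2 := habs h'
    have a1 : t j < t (j' + 1) := h1.1.trans_le h2.2
    have a2 : t j' < t (j + 1) := h2.1.trans_le h1.2
    have := ht.lt_iff_lt.1 a1
    have := ht.lt_iff_lt.1 a2
    omega

/-- The union of the first `J` cells and their reflections. -/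
def cellUnion (t : ℕ → ℝ) (J : ℕ) : Set ℝ :=
  ⋃ q ∈ (Finset.univ : Finset ℤˣ) ×ˢ Finset.range J, signCell t q.1 q.2

lemma setIntegral_signCell (σ : ℤˣ) (j : ℕ) (f : ℝ → ℝ) :
    ∫ x in signCell t σ j, f x = ∫ x in Set.Ioc (t j) (t (j + 1)), f (signMul σ x) := by
  have h := (measurePreserving_signMul σ).setIntegral_preimage_emb (signMul σ).measurableEmbedding
    (fun x => f (signMul σ x)) (Set.Ioc (t j) (t (j + 1)))
  simp only [signMul_signMul] at h
  exact h

lemma norm_sq_eq_integral (f : L2R) : ‖f‖ ^ 2 = ∫ x, ‖f x‖ ^ 2 := by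
  have h := L2.inner_def (𝕜 := ℂ) f f
  rw [inner_self_eq_norm_sq_to_K] at h
  simp only [inner_self_eq_norm_sq_to_K] at h
  have h2 : ∫ x, ((‖f x‖ : ℂ)) ^ 2 = ((∫ x, ‖f x‖ ^ 2 : ℝ) : ℂ) := by
    rw [← integral_complex_ofReal]
    simp
  exact Complex.ofReal_injective (by simpa [h2] using h)

lemma integrable_norm_sq_L2R (f : L2R) : Integrable (fun x => ‖f x‖ ^ 2) :=
  integrable_norm_sq_of_memLp (Lp.memLp f)

lemma sum_cell_integral (ht : StrictMono t) (h0 : t 0 = 0) (J : ℕ) (f : L2R) :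
    ∑ j ∈ Finset.range J, ((∫ x in Set.Ioc (t j) (t (j + 1)), ‖f (signMul 1 x)‖ ^ 2) +
      ∫ x in Set.Ioc (t j) (t (j + 1)), ‖f (signMul (-1) x)‖ ^ 2) =
    ∫ x in cellUnion t J, ‖f x‖ ^ 2 := by
  rw [cellUnion, integral_biUnion_finset]
  · rw [Finset.sum_product_right]
    refine Finset.sum_congr rfl fun j _ => ?_
    have : (Finset.univ : Finset ℤˣ) = {1, -1} := by decide
    rw [this, Finset.sum_pair (by decide), setIntegral_signCell, setIntegral_signCell]
  · exact fun q _ => measurableSet_signCell _ _ _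
  · intro q _ q' _ hne
    rw [Function.onFun, Set.disjoint_left]
    intro x hx hx'
    exact hne (Prod.ext (signCell_unique ht h0 hx hx').1 (signCell_unique ht h0 hx hx').2)
  · exact fun q _ => (integrable_norm_sq_L2R f).integrableOn

lemma sum_cell_integral_le (ht : StrictMono t) (h0 : t 0 = 0) (J : ℕ) (f : L2R) :
    ∑ j ∈ Finset.range J, ((∫ x in Set.Ioc (t j) (t (j + 1)), ‖f (signMul 1 x)‖ ^ 2) +
      ∫ x in Set.Ioc (t j) (t (j + 1)), ‖f (signMul (-1) x)‖ ^ 2) ≤ ‖f‖ ^ 2 := by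
  rw [sum_cell_integral ht h0, norm_sq_eq_integral]
  exact setIntegral_le_integral (integrable_norm_sq_L2R f) (ae_of_all _ fun x => by positivity)

lemma sum_cell_integral_eq (ht : StrictMono t) (h0 : t 0 = 0) (J : ℕ) (f : L2R)
    (hf : ∀ᵐ x, x ∉ cellUnion t J → f x = 0) :
    ∑ j ∈ Finset.range J, ((∫ x in Set.Ioc (t j) (t (j + 1)), ‖f (signMul 1 x)‖ ^ 2) +
      ∫ x in Set.Ioc (t j) (t (j + 1)), ‖f (signMul (-1) x)‖ ^ 2) = ‖f‖ ^ 2 := by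
  rw [sum_cell_integral ht h0, norm_sq_eq_integral, setIntegral_eq_integral_of_ae_compl_eq_zero]
  filter_upwards [hf] with x hx hxc
  rw [hx hxc]
  simp

/-- The model kernel concentrated near the antidiagonal. -/
def mainKernel (t c : ℕ → ℝ) (J : ℕ) (p : ℝ × ℝ) : ℂ :=
  ∑ j ∈ Finset.range J, Complex.I * c j *
    ((triangle (t j) (t (j + 1))).indicator (1 : ℝ × ℝ → ℂ) (-p.1, p.2) -
      (triangle (t j) (t (j + 1))).indicator (1 : ℝ × ℝ → ℂ) (-p.2, p.1))

/-- The map `(w, v) ↦ (-w, v)`. -/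
def negFst : ℝ × ℝ ≃ᵐ ℝ × ℝ := (MeasurableEquiv.neg ℝ).prodCongr (MeasurableEquiv.refl ℝ)

lemma measurePreserving_negFst : MeasurePreserving negFst volume volume :=
  (Measure.measurePreserving_neg (volume : Measure ℝ)).prod (MeasurePreserving.id volume)

/-- The map `(w, v) ↦ (-v, w)`. -/
def negSwap : ℝ × ℝ ≃ᵐ ℝ × ℝ := MeasurableEquiv.prodComm.trans negFst

lemma measurePreserving_negSwap : MeasurePreserving negSwap volume volume :=
  measurePreserving_negFst.comp (Measure.measurePreserving_swap (μ := volume) (ν := volume))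

lemma memLp_indicator_triangle (a b : ℝ) :
    MemLp ((triangle a b).indicator (1 : ℝ × ℝ → ℂ)) 2 volume := by
  refine memLp_indicator_const 2 (measurableSet_triangle a b) (1 : ℂ) (Or.inr ?_)
  have hsub : triangle a b ⊆ Set.Ioc a b ×ˢ Set.Ioc a b := fun p hp =>
    ⟨⟨hp.1, hp.2.1.le.trans hp.2.2⟩, ⟨hp.1.trans hp.2.1, hp.2.2⟩⟩
  refine ne_of_lt ((measure_mono hsub).trans_lt ?_)
  rw [Measure.volume_eq_prod, Measure.prod_prod]
  exact ENNReal.mul_lt_top measure_Ioc_lt_top measure_Ioc_lt_top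

lemma memLp_triangle_negFst (a b : ℝ) :
    MemLp (fun p : ℝ × ℝ => (triangle a b).indicator (1 : ℝ × ℝ → ℂ) (-p.1, p.2)) 2 volume :=
  (memLp_indicator_triangle a b).comp_measurePreserving measurePreserving_negFst

lemma memLp_triangle_negSwap (a b : ℝ) :
    MemLp (fun p : ℝ × ℝ => (triangle a b).indicator (1 : ℝ × ℝ → ℂ) (-p.2, p.1)) 2 volume :=
  (memLp_indicator_triangle a b).comp_measurePreserving measurePreserving_negSwap

lemma memLp_mainKernel (t c : ℕ → ℝ) (J : ℕ) : MemLp (mainKernel t c J) 2 volume :=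
  memLp_finsetSum _ fun _ _ =>
    ((memLp_triangle_negFst _ _).sub (memLp_triangle_negSwap _ _)).const_mul _

lemma kernelForm_triangle_negFst (a b : ℝ) (f : L2R) :
    kernelForm (fun p => (triangle a b).indicator (1 : ℝ × ℝ → ℂ) (-p.1, p.2)) f =
      ∫ p, (triangle a b).indicator (fun p => conj (f (-p.1)) * f p.2) p := by
  rw [kernelForm, ← measurePreserving_negFst.integral_comp negFst.measurableEmbedding
    ((triangle a b).indicator (fun p : ℝ × ℝ => conj (f (-p.1)) * f p.2))]
  refine integral_congr_ae (ae_of_all _ fun p => ?_)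
  change _ = (triangle a b).indicator
    (fun p : ℝ × ℝ => conj (f (-p.1)) * f p.2) (-p.1, p.2)
  beta_reduce
  by_cases h : (-p.1, p.2) ∈ triangle a b
  · rw [Set.indicator_of_mem h, Set.indicator_of_mem h]
    simp [mul_comm]
  · rw [Set.indicator_of_notMem h, Set.indicator_of_notMem h, zero_mul]

lemma kernelForm_triangle_negSwap (a b : ℝ) (f : L2R) :
    kernelForm (fun p => (triangle a b).indicator (1 : ℝ × ℝ → ℂ) (-p.2, p.1)) f =
      conj (∫ p, (triangle a b).indicator (fun p => conj (f (-p.1)) * f p.2) p) := by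
  rw [← integral_conj, kernelForm,
    ← measurePreserving_negSwap.integral_comp negSwap.measurableEmbedding
    (fun q => conj ((triangle a b).indicator (fun p : ℝ × ℝ => conj (f (-p.1)) * f p.2) q))]
  refine integral_congr_ae (ae_of_all _ fun p => ?_)
  change _ = conj ((triangle a b).indicator
    (fun p : ℝ × ℝ => conj (f (-p.1)) * f p.2) (-p.2, p.1))
  beta_reduce
  by_cases h : (-p.2, p.1) ∈ triangle a b
  · rw [Set.indicator_of_mem h, Set.indicator_of_mem h]
    simp
  · rw [Set.indicator_of_notMem h, Set.indicator_of_notMem h, zero_mul, map_zero]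

lemma re_kernelForm_mainKernel (t c : ℕ → ℝ) (J : ℕ) (f : L2R) :
    (kernelForm (mainKernel t c J) f).re = ∑ j ∈ Finset.range J,
      2 * (Complex.I * c j * ∫ p, (triangle (t j) (t (j + 1))).indicator
        (fun p => conj (f (-p.1)) * f p.2) p).re := by
  have h : kernelForm (mainKernel t c J) f = ∑ j ∈ Finset.range J, Complex.I * c j *
      (kernelForm (fun p => (triangle (t j) (t (j + 1))).indicator (1 : ℝ × ℝ → ℂ) (-p.1, p.2)) f -
      kernelForm (fun p => (triangle (t j) (t (j + 1))).indicator (1 : ℝ × ℝ → ℂ) (-p.2, p.1))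
        f) := by
    simp only [kernelForm, mainKernel, Finset.sum_mul]
    rw [integral_finsetSum]
    · refine Finset.sum_congr rfl fun j _ => ?_
      rw [← integral_sub (integrable_kernelForm (memLp_triangle_negFst _ _) f)
        (integrable_kernelForm (memLp_triangle_negSwap _ _) f), ← integral_const_mul]
      congr 1
      ext p
      ring
    · intro j _
      exact integrable_kernelForm (((memLp_triangle_negFst _ _).sub
        (memLp_triangle_negSwap _ _)).const_mul _) f
  rw [h, Complex.re_sum]
  refine Finset.sum_congr rfl fun j _ => ?_
  rw [kernelForm_triangle_negFst, kernelForm_triangle_negSwap]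
  generalize ∫ p, (triangle (t j) (t (j + 1))).indicator
    (fun p => conj (f (-p.1)) * f p.2) p = z
  simp
  ring

lemma memLp_signMul_restrict (σ : ℤˣ) (f : L2R) (s : Set ℝ) :
    MemLp (fun x => f (signMul σ x)) 2 (volume.restrict s) :=
  (memLp_comp_signMul σ (Lp.memLp f)).restrict s

/-- The combination of opposite modes on which the model form is sign-definite. -/
def pairVec (t c : ℕ → ℝ) (j : ℕ) (m : ℤ) : L2R :=
  modeVec 1 (t j) (t (j + 1)) m - (modeSign (c j) m : ℂ) • modeVec (-1) (t j) (t (j + 1)) m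

/-- Square integrable functions with zero mean on each of the first `J` cells. -/
def ZeroMean (t : ℕ → ℝ) (J : ℕ) (f : L2R) : Prop :=
  ∀ σ : ℤˣ, ∀ j < J, ⟪modeVec σ (t j) (t (j + 1)) 0, f⟫_ℂ = 0

lemma re_mainKernel_le (ht : StrictMono t) (h0 : t 0 = 0) (c : ℕ → ℝ) {q : ℝ} (hq0 : 0 ≤ q) (J : ℕ)
    (hq : ∀ j < J, |c j| * (t (j + 1) - t j) = q) {N : ℕ} (hN : 1 ≤ N) (f : L2R)
    (hf : ZeroMean t J f)
    (hf' : ∀ j < J, ∀ m : ℤ, m ≠ 0 → |m| < N → ⟪pairVec t c j m, f⟫_ℂ = 0) :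
    (kernelForm (mainKernel t c J) f).re ≤ q / (2 * Real.pi * N) * ‖f‖ ^ 2 := by
  refine le_trans ?_ (mul_le_mul_of_nonneg_left (sum_cell_integral_le ht h0 J f) (by positivity))
  rw [re_kernelForm_mainKernel, Finset.mul_sum]
  refine Finset.sum_le_sum fun j hj => ?_
  rw [Finset.mem_range] at hj
  have hz : ∀ σ : ℤˣ, modeCoef (t j) (t (j + 1)) 0 (fun x => f (signMul σ x)) = 0 := by
    intro σ
    rw [← inner_modeVec]
    exact hf σ j hj
  have := triangleForm_le (ht (Nat.lt_succ_self j)) (memLp_signMul_restrict 1 f _)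
    (memLp_signMul_restrict (-1) f _) (hz 1) (hz (-1)) (c j) hN (by
      intro m hm hmN
      have h := hf' j hj m hm hmN
      rw [pairVec, inner_sub_left, inner_smul_left, inner_modeVec, inner_modeVec,
        Complex.conj_ofReal, sub_eq_zero] at h
      exact h)
  rw [hq j hj] at this
  simpa only [signMul_one, signMul_neg_one] using this

lemma le_re_mainKernel (ht : StrictMono t) (h0 : t 0 = 0) (c : ℕ → ℝ) {q : ℝ} (J : ℕ)
    (hq : ∀ j < J, |c j| * (t (j + 1) - t j) = q) {N : ℕ} (hN : 1 ≤ N) (f : L2R)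
    (hf : ZeroMean t J f)
    (hf' : ∀ j < J, ∀ m : ℤ, m ≠ 0 → |m| ≤ N → ⟪modeVec 1 (t j) (t (j + 1)) m, f⟫_ℂ =
      -(modeSign (c j) m * ⟪modeVec (-1) (t j) (t (j + 1)) m, f⟫_ℂ))
    (hf'' : ∀ σ : ℤˣ, ∀ j < J, ∀ m : ℤ, N < |m| → ⟪modeVec σ (t j) (t (j + 1)) m, f⟫_ℂ = 0)
    (hs : ∀ᵐ x, x ∉ cellUnion t J → f x = 0) :
    q / (2 * Real.pi * N) * ‖f‖ ^ 2 ≤ (kernelForm (mainKernel t c J) f).re := by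
  rw [← sum_cell_integral_eq ht h0 J f hs, re_kernelForm_mainKernel, Finset.mul_sum]
  refine Finset.sum_le_sum fun j hj => ?_
  rw [Finset.mem_range] at hj
  have hz : ∀ σ : ℤˣ, modeCoef (t j) (t (j + 1)) 0 (fun x => f (signMul σ x)) = 0 := by
    intro σ
    rw [← inner_modeVec]
    exact hf σ j hj
  have := le_triangleForm (ht (Nat.lt_succ_self j)) (memLp_signMul_restrict 1 f _)
    (memLp_signMul_restrict (-1) f _) (hz 1) (hz (-1)) (c j) hN (by
      intro m hm hmN
      have h := hf' j hj m hm hmN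
      rwa [inner_modeVec, inner_modeVec] at h) (by
      intro m hm
      have h1 := hf'' 1 j hj m hm
      have h2 := hf'' (-1) j hj m hm
      rw [inner_modeVec] at h1 h2
      exact ⟨h1, h2⟩)
  rw [hq j hj] at this
  simpa only [signMul_one, signMul_neg_one] using this

end Modes

section ModeSpans

open scoped ComplexConjugate

variable {t : ℕ → ℝ}

lemma expMode_mul (ℓ : ℝ) (m m' : ℤ) (x : ℝ) :
    expMode ℓ m x * expMode ℓ m' x = expMode ℓ (m + m') x := by
  rw [expMode, expMode, expMode, ← Complex.exp_add]
  congr 1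
  push_cast
  ring

lemma modeCoef_expMode {a b : ℝ} (hab : a < b) (m m' : ℤ) :
    modeCoef a b m (expMode (b - a) m') = if m = m' then ((b - a : ℝ) : ℂ) else 0 := by
  have hl : b - a ≠ 0 := by linarith
  simp only [modeCoef, expMode_mul]
  split_ifs with h
  · subst h
    simp [expMode_zero, hab.le]
  · rw [integral_Ioc_expMode hab.le hl (by omega)]
    have : expMode (b - a) (-m + m') b = expMode (b - a) (-m + m') a := by
      rw [expMode, expMode, Complex.exp_eq_exp_iff_exists_int]
      refine ⟨-m + m', ?_⟩
      have hl' : (b - a : ℂ) ≠ 0 := by exact_mod_cast hl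
      push_cast
      field_simp
      ring
    rw [this, sub_self, zero_mul]

lemma inner_modeVec_self (σ : ℤˣ) {a b : ℝ} (hab : a < b) (m m' : ℤ) :
    ⟪modeVec σ a b m, modeVec σ a b m'⟫_ℂ = if m = m' then ((b - a : ℝ) : ℂ) else 0 := by
  rw [inner_modeVec, ← modeCoef_expMode hab, modeCoef, modeCoef]
  refine integral_congr_ae ?_
  filter_upwards [ae_restrict_mem measurableSet_Ioc, ae_restrict_of_ae
    ((measurePreserving_signMul σ).quasiMeasurePreserving.ae (coeFn_modeVec σ a b m'))]
    with x hx h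
  rw [h, signMul_signMul, Set.indicator_of_mem hx]

lemma inner_modeVec_of_ne (ht : StrictMono t) (h0 : t 0 = 0) {σ σ' : ℤˣ} {j j' : ℕ}
    (hne : ¬ (σ = σ' ∧ j = j')) (m m' : ℤ) :
    ⟪modeVec σ (t j) (t (j + 1)) m, modeVec σ' (t j') (t (j' + 1)) m'⟫_ℂ = 0 := by
  rw [L2.inner_def]
  refine (integral_congr_ae ?_).trans (integral_zero _ _)
  filter_upwards [coeFn_modeVec σ (t j) (t (j + 1)) m, coeFn_modeVec σ' (t j') (t (j' + 1)) m']
    with x h1 h2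
  rw [h1, h2]
  by_cases hx : x ∈ signCell t σ j
  · have hx' : signMul σ' x ∉ Set.Ioc (t j') (t (j' + 1)) :=
      fun h => hne (signCell_unique ht h0 hx h)
    rw [Set.indicator_of_notMem hx', inner_zero_right]
  · have hx' : signMul σ x ∉ Set.Ioc (t j) (t (j + 1)) := hx
    rw [Set.indicator_of_notMem hx', inner_zero_left]

/-- The span of the zero modes on the first `J` cells and their reflections. -/
def zeroModeSpan (t : ℕ → ℝ) (J : ℕ) : Submodule ℂ L2R :=
  Submodule.span ℂ (Set.range fun q : ℤˣ × Fin J => modeVec q.1 (t q.2) (t (q.2 + 1)) 0)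

lemma rank_zeroModeSpan_le (t : ℕ → ℝ) (J : ℕ) :
    Module.rank ℂ (zeroModeSpan t J) ≤ ((2 * J : ℕ) : Cardinal) := by
  refine (rank_span_le _).trans (Cardinal.mk_range_le.trans ?_)
  rw [Cardinal.mk_fintype, Fintype.card_prod, Fintype.card_fin]
  rfl

lemma zeroMean_of_mem_orthogonal {J : ℕ} {f : L2R} (hf : f ∈ (zeroModeSpan t J)ᗮ) :
    ZeroMean t J f := fun σ j hj =>
  Submodule.inner_right_of_mem_orthogonal (K := zeroModeSpan t J)
    (Submodule.subset_span (Set.mem_range_self ((σ, ⟨j, hj⟩) : ℤˣ × Fin J))) hf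

/-- The nonzero integers of modulus at most `M`. -/
def nonzeroModes (M : ℕ) : Finset ℤ := (Finset.Icc (-M : ℤ) M).erase 0

lemma mem_nonzeroModes {M : ℕ} {m : ℤ} : m ∈ nonzeroModes M ↔ m ≠ 0 ∧ |m| ≤ M := by
  rw [nonzeroModes, Finset.mem_erase, Finset.mem_Icc, abs_le]

lemma card_nonzeroModes (M : ℕ) : (nonzeroModes M).card = 2 * M := by
  rw [nonzeroModes, Finset.card_erase_of_mem (by simp), Int.card_Icc]
  omega

/-- The span of the paired modes of frequency at most `M` on the first `J` cells. -/
def pairSpan (t c : ℕ → ℝ) (J M : ℕ) : Submodule ℂ L2R :=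
  Submodule.span ℂ (Set.range fun q : Fin J × nonzeroModes M => pairVec t c q.1 q.2)

lemma rank_pairSpan_le (t c : ℕ → ℝ) (J M : ℕ) :
    Module.rank ℂ (pairSpan t c J M) ≤ ((J * (2 * M) : ℕ) : Cardinal) := by
  refine (rank_span_le _).trans (Cardinal.mk_range_le.trans ?_)
  rw [Cardinal.mk_fintype, Fintype.card_prod, Fintype.card_fin, Fintype.card_coe,
    card_nonzeroModes]

instance (t c : ℕ → ℝ) (J M : ℕ) : FiniteDimensional ℂ (pairSpan t c J M) :=
  FiniteDimensional.span_of_finite ℂ (Set.finite_range _)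

lemma inner_pairVec_of_mem_orthogonal {c : ℕ → ℝ} {J M : ℕ} {f : L2R}
    (hf : f ∈ (pairSpan t c J M)ᗮ) {j : ℕ} (hj : j < J) {m : ℤ} (hm : m ≠ 0) (hmM : |m| ≤ M) :
    ⟪pairVec t c j m, f⟫_ℂ = 0 :=
  Submodule.inner_right_of_mem_orthogonal
    (K := pairSpan t c J M) (Submodule.subset_span
    (Set.mem_range_self ((⟨j, hj⟩, ⟨m, mem_nonzeroModes.2 ⟨hm, hmM⟩⟩) : Fin J × nonzeroModes M))) hf

lemma modeSign_mul_self (c : ℝ) (m : ℤ) : (modeSign c m : ℂ) * modeSign c m = 1 := by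
  unfold modeSign
  split_ifs <;> simp

lemma inner_modeVec_one_pairVec (ht : StrictMono t) (h0 : t 0 = 0) (c : ℕ → ℝ) (j j' : ℕ)
    (m m' : ℤ) : ⟪modeVec 1 (t j) (t (j + 1)) m, pairVec t c j' m'⟫_ℂ =
      if j = j' ∧ m = m' then ((t (j + 1) - t j : ℝ) : ℂ) else 0 := by
  rw [pairVec, inner_sub_right, inner_smul_right,
    inner_modeVec_of_ne ht h0 (σ := 1) (σ' := -1) (by rintro ⟨h, -⟩; exact absurd h (by decide)),
    mul_zero, sub_zero]
  by_cases hj : j = j'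
  · subst hj
    simp [inner_modeVec_self 1 (ht (Nat.lt_succ_self j))]
  · rw [inner_modeVec_of_ne ht h0 (fun h => hj h.2), if_neg (fun h => hj h.1)]

lemma inner_modeVec_neg_one_pairVec (ht : StrictMono t) (h0 : t 0 = 0) (c : ℕ → ℝ) (j j' : ℕ)
    (m m' : ℤ) : ⟪modeVec (-1) (t j) (t (j + 1)) m, pairVec t c j' m'⟫_ℂ =
      -(modeSign (c j) m * if j = j' ∧ m = m' then ((t (j + 1) - t j : ℝ) : ℂ) else 0) := by
  rw [pairVec, inner_sub_right, inner_smul_right,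
    inner_modeVec_of_ne ht h0 (σ := -1) (σ' := 1) (by rintro ⟨h, -⟩; exact absurd h (by decide)),
    zero_sub]
  by_cases hj : j = j'
  · subst hj
    rw [inner_modeVec_self (-1) (ht (Nat.lt_succ_self j))]
    by_cases hm : m = m'
    · simp [hm]
    · simp [hm]
  · rw [inner_modeVec_of_ne ht h0 (fun h => hj h.2), if_neg (fun h => hj h.1), mul_zero, mul_zero]

lemma finrank_pairSpan (ht : StrictMono t) (h0 : t 0 = 0) (c : ℕ → ℝ) (J M : ℕ) :
    Module.finrank ℂ (pairSpan t c J M) = J * (2 * M) := by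
  have hlin : LinearIndependent ℂ
      (fun q : Fin J × nonzeroModes M => pairVec t c q.1 q.2) := by
    rw [Fintype.linearIndependent_iff]
    intro g hg q
    have h := congrArg (fun u => ⟪modeVec 1 (t q.1) (t (q.1 + 1)) q.2, u⟫_ℂ) hg
    simp only [inner_sum, inner_smul_right, inner_modeVec_one_pairVec ht h0, inner_zero_right]
      at h
    rw [Finset.sum_eq_single q] at h
    · have hl : ((t (q.1 + 1) - t q.1 : ℝ) : ℂ) ≠ 0 := by
        exact_mod_cast (sub_pos.2 (ht (Nat.lt_succ_self _))).ne'
      rw [if_pos ⟨rfl, rfl⟩] at h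
      exact (mul_eq_zero.1 h).resolve_right hl
    · intro q' _ hne
      rw [if_neg, mul_zero]
      rintro ⟨h1, h2⟩
      exact hne (Prod.ext (Fin.ext h1.symm) (Subtype.ext h2.symm))
    · simp
  rw [pairSpan, finrank_span_eq_card hlin, Fintype.card_prod, Fintype.card_fin,
    Fintype.card_coe, card_nonzeroModes]

lemma ae_pairVec_eq_zero (t c : ℕ → ℝ) {j J : ℕ} (hj : j < J) (m : ℤ) :
    ∀ᵐ x, x ∉ cellUnion t J → pairVec t c j m x = 0 := by
  have key : ∀ σ : ℤˣ, ∀ x ∉ cellUnion t J, (Set.Ioc (t j) (t (j + 1))).indicator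
      (expMode (t (j + 1) - t j) m) (signMul σ x) = 0 := by
    intro σ x hx
    refine Set.indicator_of_notMem (fun h => hx ?_) _
    exact Set.mem_biUnion (x := (σ, j)) (by simp [hj, Int.units_eq_one_or]) h
  filter_upwards [coeFn_modeVec 1 (t j) (t (j + 1)) m, coeFn_modeVec (-1) (t j) (t (j + 1)) m,
    Lp.coeFn_sub (modeVec 1 (t j) (t (j + 1)) m)
      ((modeSign (c j) m : ℂ) • modeVec (-1) (t j) (t (j + 1)) m),
    Lp.coeFn_smul (modeSign (c j) m : ℂ) (modeVec (-1) (t j) (t (j + 1)) m)]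
    with x h1 h2 h3 h4 hx
  rw [pairVec, h3, Pi.sub_apply, h4, Pi.smul_apply, h1, h2, key _ x hx, key _ x hx]
  simp

lemma le_re_mainKernel_of_mem_pairSpan (ht : StrictMono t) (h0 : t 0 = 0) (c : ℕ → ℝ) {q : ℝ}
    (J : ℕ) (hq : ∀ j < J, |c j| * (t (j + 1) - t j) = q) {N : ℕ} (hN : 1 ≤ N) {u : L2R}
    (hu : u ∈ pairSpan t c J N) :
    ZeroMean t J u ∧
      q / (2 * Real.pi * N) * ‖u‖ ^ 2 ≤ (kernelForm (mainKernel t c J) u).re := by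
  have hz : ZeroMean t J u := by
    intro σ j hj
    induction hu using Submodule.span_induction with
    | mem x hx =>
      obtain ⟨⟨j', m, hm⟩, rfl⟩ := hx
      have hm0 : 0 ≠ m := (mem_nonzeroModes.1 hm).1.symm
      rcases Int.units_eq_one_or σ with rfl | rfl
      · simp [inner_modeVec_one_pairVec ht h0, hm0]
      · simp [inner_modeVec_neg_one_pairVec ht h0, hm0]
    | zero => simp
    | add x y _ _ hx hy => rw [inner_add_right, hx, hy, add_zero]
    | smul a x _ hx => rw [inner_smul_right, hx, mul_zero]
  refine ⟨hz, le_re_mainKernel ht h0 c J hq hN u hz ?_ ?_ ?_⟩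
  · intro j hj m hm hmN
    clear hz
    induction hu using Submodule.span_induction with
    | mem x hx =>
      obtain ⟨⟨j', m', hm'⟩, rfl⟩ := hx
      simp only
      rw [inner_modeVec_one_pairVec ht h0, inner_modeVec_neg_one_pairVec ht h0, mul_neg, neg_neg,
        ← mul_assoc, modeSign_mul_self, one_mul]
    | zero => simp
    | add x y _ _ hx hy => rw [inner_add_right, inner_add_right, hx, hy]; ring
    | smul a x _ hx => rw [inner_smul_right, inner_smul_right, hx]; ring
  · intro σ j hj m hm
    clear hz
    induction hu using Submodule.span_induction with
    | mem x hx =>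
      obtain ⟨⟨j', m', hm'⟩, rfl⟩ := hx
      have hne : m ≠ m' := by
        rintro rfl
        exact absurd (mem_nonzeroModes.1 hm').2 (not_le.2 hm)
      rcases Int.units_eq_one_or σ with rfl | rfl
      · simp [inner_modeVec_one_pairVec ht h0, hne]
      · simp [inner_modeVec_neg_one_pairVec ht h0, hne]
    | zero => simp
    | add x y _ _ hx hy => rw [inner_add_right, hx, hy, add_zero]
    | smul a x _ hx => rw [inner_smul_right, hx, mul_zero]
  · clear hz
    induction hu using Submodule.span_induction with
    | mem x hx =>
      obtain ⟨⟨j, m⟩, rfl⟩ := hx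
      exact ae_pairVec_eq_zero t c j.2 m
    | zero =>
      filter_upwards [Lp.coeFn_zero ℂ 2 (volume : Measure ℝ)] with x h _
      rw [h]
      rfl
    | add x y _ _ hx hy =>
      filter_upwards [hx, hy, Lp.coeFn_add x y] with z h1 h2 h3 hz
      rw [h3, Pi.add_apply, h1 hz, h2 hz, add_zero]
    | smul a x _ hx =>
      filter_upwards [hx, Lp.coeFn_smul a x] with z h1 h2 hz
      rw [h2, Pi.smul_apply, h1 hz, smul_zero]

end ModeSpans

section Grid

/-- The exponential grid. -/
def grid (n j : ℕ) : ℝ := Real.exp (j / n) - 1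

/-- The relative mesh size of the exponential grid. -/
def mesh (n : ℕ) : ℝ := Real.exp (1 / n) - 1

lemma grid_zero (n : ℕ) : grid n 0 = 0 := by simp [grid]

lemma strictMono_grid {n : ℕ} (hn : 1 ≤ n) : StrictMono (grid n) := by
  intro i j hij
  have hn' : (0 : ℝ) < n := by exact_mod_cast hn
  have : (i : ℝ) < j := by exact_mod_cast hij
  unfold grid
  have : Real.exp (i / n) < Real.exp (j / n) := Real.exp_lt_exp.2 (by gcongr)
  linarith

lemma grid_nonneg (n j : ℕ) : 0 ≤ grid n j := by
  have : 1 ≤ Real.exp ((j : ℝ) / n) := Real.one_le_exp (by positivity)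
  unfold grid
  linarith

lemma mesh_nonneg (n : ℕ) : 0 ≤ mesh n := by
  have : 1 ≤ Real.exp ((1 : ℝ) / n) := Real.one_le_exp (by positivity)
  unfold mesh
  linarith

lemma grid_succ_sub (n j : ℕ) : grid n (j + 1) - grid n j = mesh n * (1 + grid n j) := by
  unfold grid mesh
  push_cast
  rw [add_div, Real.exp_add]
  ring

lemma mesh_le {n : ℕ} (hn : 1 ≤ n) : mesh n ≤ 2 / n := by
  have hn' : (1 : ℝ) ≤ n := by exact_mod_cast hn
  have h := Real.abs_exp_sub_one_le (x := 1 / (n : ℝ)) (by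
    rw [abs_of_nonneg (by positivity)]
    exact (div_le_one (by linarith)).2 hn')
  have h2 := (abs_le.1 h).2
  rw [abs_of_nonneg (by positivity)] at h2
  unfold mesh
  calc _ ≤ 2 * (1 / (n : ℝ)) := h2
    _ = _ := by ring

lemma le_one_add_grid_cellCount {n : ℕ} (hn : 1 ≤ n) : (n : ℝ) ≤ 1 + grid n (cellCount n) := by
  have hn' : (0 : ℝ) < n := by exact_mod_cast hn
  have h : (n : ℝ) * Real.log n ≤ cellCount n := Nat.le_ceil _
  have h2 : Real.log n ≤ cellCount n / n := by
    rw [le_div_iff₀ hn']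
    linarith
  have h3 := Real.exp_le_exp.2 h2
  rw [Real.exp_log hn'] at h3
  unfold grid
  linarith

lemma grid_le_of_lt {n : ℕ} (hn : 1 ≤ n) {j : ℕ} (hj : j < cellCount n) : 1 + grid n j ≤ n := by
  have hn' : (0 : ℝ) < n := by exact_mod_cast hn
  have h : (j : ℝ) < n * Real.log n := Nat.lt_ceil.1 hj
  have h2 : (j : ℝ) / n ≤ Real.log n := by
    rw [div_le_iff₀ hn']
    linarith
  have h3 := Real.exp_le_exp.2 h2
  rw [Real.exp_log hn'] at h3
  unfold grid
  linarith

lemma grid_cellCount_le {n : ℕ} (hn : 1 ≤ n) : grid n (cellCount n) ≤ 2 * n := by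
  have hn' : (1 : ℝ) ≤ n := by exact_mod_cast hn
  rcases Nat.eq_zero_or_pos (cellCount n) with h | h
  · rw [h, grid_zero]
    positivity
  obtain ⟨j, hj⟩ := Nat.exists_eq_succ_of_ne_zero h.ne'
  have h1 := grid_le_of_lt hn (show j < cellCount n by omega)
  have h2 := grid_succ_sub n j
  have h3 := mesh_le hn
  have h4 : mesh n * (1 + grid n j) ≤ 2 / n * n :=
    mul_le_mul h3 h1 (by linarith [grid_nonneg n j]) (by positivity)
  rw [div_mul_cancel₀ _ (by positivity)] at h4
  rw [hj, Nat.succ_eq_add_one]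
  have hn2 : 2 ≤ n := by
    by_contra hlt
    have : n = 1 := by omega
    subst this
    simp [cellCount] at h
  have : (2 : ℝ) ≤ n := by exact_mod_cast hn2
  linarith

lemma grid_cell_le_two {n : ℕ} (hn : 1 ≤ n) {j : ℕ} (hj : j < cellCount n) :
    grid n (j + 1) - grid n j ≤ 2 := by
  have hn' : (1 : ℝ) ≤ n := by exact_mod_cast hn
  rw [grid_succ_sub]
  have h4 : mesh n * (1 + grid n j) ≤ 2 / n * n :=
    mul_le_mul (mesh_le hn) (grid_le_of_lt hn hj) (by linarith [grid_nonneg n j]) (by positivity)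
  rwa [div_mul_cancel₀ _ (by positivity)] at h4

lemma mesh_le_two {n : ℕ} (hn : 1 ≤ n) : mesh n ≤ 2 := by
  have hn' : (1 : ℝ) ≤ n := by exact_mod_cast hn
  refine (mesh_le hn).trans ?_
  rw [div_le_iff₀ (by linarith)]
  linarith

lemma exists_mem_cell {n : ℕ} (J : ℕ) {x : ℝ} (h0 : 0 < x)
    (hx : x ≤ grid n J) : ∃ j < J, x ∈ Set.Ioc (grid n j) (grid n (j + 1)) := by
  induction J with
  | zero => rw [grid_zero] at hx; linarith
  | succ J ih =>
    by_cases h : x ≤ grid n J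
    · obtain ⟨j, hj, hjx⟩ := ih h
      exact ⟨j, by omega, hjx⟩
    · exact ⟨J, by omega, not_le.1 h, hx⟩

end Grid

section Band

lemma integrableOn_inv_sq (t : ℝ) (ht : 0 ≤ t) :
    IntegrableOn (fun x : ℝ => ((1 + x) ^ 2)⁻¹) (Set.Ioi t) ∧
      ∫ x in Set.Ioi t, ((1 + x) ^ 2)⁻¹ = (1 + t)⁻¹ := by
  have hd : ∀ x ∈ Set.Ici t, HasDerivAt (fun x : ℝ => -(1 + x)⁻¹) ((1 + x) ^ 2)⁻¹ x := by
    intro x hx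
    have hx0 : (1 + x) ≠ 0 := by
      have : t ≤ x := hx
      linarith
    have h := (((hasDerivAt_id x).const_add 1).inv hx0).neg
    simp only [id] at h
    rw [neg_div, neg_neg, one_div] at h
    exact h
  have hlim : Tendsto (fun x : ℝ => -(1 + x)⁻¹) atTop (nhds 0) := by
    have : Tendsto (fun x : ℝ => (1 + x)⁻¹) atTop (nhds 0) :=
      tendsto_inv_atTop_zero.comp (tendsto_atTop_add_const_left _ _ tendsto_id)
    simpa using this.neg
  have hi := integrableOn_Ioi_deriv_of_nonneg' hd (fun x _ => by positivity) hlim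
  refine ⟨hi, ?_⟩
  rw [integral_Ioi_of_hasDerivAt_of_tendsto' hd hi hlim]
  ring

lemma integral_tail_inv_sq (t : ℝ) (ht : 0 ≤ t) :
    Integrable ({x : ℝ | t < |x|}.indicator fun x => ((1 + |x|) ^ 2)⁻¹) ∧
      ∫ x, {x : ℝ | t < |x|}.indicator (fun x => ((1 + |x|) ^ 2)⁻¹) x = 2 * (1 + t)⁻¹ := by
  have he : ∀ x : ℝ, {x : ℝ | t < |x|}.indicator (fun x => ((1 + |x|) ^ 2)⁻¹) x =
      (Set.Ioi t).indicator (fun x => ((1 + x) ^ 2)⁻¹) |x| := fun x => by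
    by_cases h : t < |x|
    · rw [Set.indicator_of_mem (by exact h), Set.indicator_of_mem (by exact h)]
    · rw [Set.indicator_of_notMem (by exact h), Set.indicator_of_notMem (by exact h)]
  have hv : ∫ x, {x : ℝ | t < |x|}.indicator (fun x => ((1 + |x|) ^ 2)⁻¹) x = 2 * (1 + t)⁻¹ := by
    simp only [he]
    rw [integral_comp_abs (f := (Set.Ioi t).indicator (fun x : ℝ => ((1 + x) ^ 2)⁻¹)),
      setIntegral_indicator measurableSet_Ioi,
      Set.inter_eq_right.2 (Set.Ioi_subset_Ioi ht), (integrableOn_inv_sq t ht).2]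
  refine ⟨not_imp_comm.1 integral_undef ?_, hv⟩
  rw [hv]
  positivity

/-- The band of half-width `r v` around the antidiagonal. -/
def band (r : ℝ → ℝ) : Set (ℝ × ℝ) := {p | |p.1 + p.2| ≤ r p.2}

lemma measurableSet_band {r : ℝ → ℝ} (hr : Measurable r) : MeasurableSet (band r) :=
  measurableSet_le (by fun_prop) (hr.comp measurable_snd)

lemma integral_band {m r : ℝ → ℝ} (hm : Measurable m) (hr : Measurable r) (hm0 : ∀ v, 0 ≤ m v)
    (hr0 : ∀ v, 0 ≤ r v) (hi : Integrable fun v => m v * (2 * r v)) :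
    Integrable ((band r).indicator fun p => m p.2) ∧
      ∫ p, (band r).indicator (fun p => m p.2) p = ∫ v, m v * (2 * r v) := by
  have hslice : ∀ v, (fun w => (band r).indicator (fun p => m p.2) (w, v)) =
      (Set.Icc (-v - r v) (-v + r v)).indicator (fun _ => m v) := by
    intro v
    ext w
    have : (w, v) ∈ band r ↔ w ∈ Set.Icc (-v - r v) (-v + r v) := by
      simp only [band, Set.mem_ofPred_eq, abs_le, Set.mem_Icc]
      constructor <;> rintro ⟨h1, h2⟩ <;> constructor <;> linarith
    by_cases h : (w, v) ∈ band r
    · rw [Set.indicator_of_mem h, Set.indicator_of_mem (this.1 h)]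
    · rw [Set.indicator_of_notMem h, Set.indicator_of_notMem (fun h' => h (this.2 h'))]
  have hval : ∀ v, ∫ w, (band r).indicator (fun p => m p.2) (w, v) = m v * (2 * r v) := by
    intro v
    rw [hslice, integral_indicator measurableSet_Icc, setIntegral_const, Real.volume_real_Icc_of_le
      (by linarith [hr0 v]), smul_eq_mul]
    ring
  have hmeas : AEStronglyMeasurable ((band r).indicator fun p => m p.2) :=
    ((hm.comp measurable_snd).indicator (measurableSet_band hr)).aestronglyMeasurable
  have hint : Integrable ((band r).indicator fun p : ℝ × ℝ => m p.2) := by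
    rw [Measure.volume_eq_prod, integrable_prod_iff' hmeas]
    refine ⟨ae_of_all _ fun v => ?_, ?_⟩
    · rw [hslice]
      exact (integrable_indicator_iff measurableSet_Icc).2 (by simp)
    · refine hi.congr (ae_of_all _ fun v => ?_)
      beta_reduce
      rw [← hval]
      refine integral_congr_ae (ae_of_all _ fun w => ?_)
      beta_reduce
      rw [Real.norm_of_nonneg (Set.indicator_nonneg (fun p _ => hm0 _) _)]
  refine ⟨hint, ?_⟩
  rw [Measure.volume_eq_prod, integral_prod_symm _ hint]
  exact integral_congr_ae (ae_of_all _ hval)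

end Band

section JumpKernel

open ComplexConjugate

/-- Kernel profiles `G`, `J` concentrated near the antidiagonal, with decay, Lipschitz regularity,
and a jump of size `κ / |v|` across the antidiagonal. -/
structure JumpKernel (κ C R : ℝ) (G J : ℝ × ℝ → ℂ) : Prop where
  hC : 0 ≤ C
  hR : 0 ≤ R
  measurable_G : Measurable G
  measurable_J : Measurable J
  bound_G : ∀ p, ‖G p‖ ≤ C / (1 + |p.2|)
  bound_J : ∀ p, ‖J p‖ ≤ C / (1 + |p.2|)
  supp_G : ∀ p : ℝ × ℝ, R < |p.1 + p.2| → G p = 0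
  supp_J : ∀ p : ℝ × ℝ, R < |p.1 + p.2| → J p = 0
  lip_G : ∀ w v v', |v - v'| ≤ 2 → ‖G (w, v) - G (w, v')‖ ≤ C * |v - v'| / (1 + |v|)
  lip_J : ∀ w v v', |v - v'| ≤ 2 → ‖J (w, v) - J (w, v')‖ ≤ C * |v - v'| / (1 + |v|)
  jump : ∀ (σ : ℤˣ) (x : ℝ), 0 < x →
    ‖J (-signMul σ x, signMul σ x) - Complex.I * ((((σ : ℤ) : ℝ) * (κ / (1 + x)) : ℝ) : ℂ)‖ ≤
      C / (1 + x) ^ 2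

/-- The open half plane above the antidiagonal. -/
def upperHalf : Set (ℝ × ℝ) := {p | 0 < p.1 + p.2}

lemma measurableSet_upperHalf : MeasurableSet upperHalf :=
  measurableSet_lt measurable_const (measurable_fst.add measurable_snd)

lemma mem_upperHalf {w v : ℝ} : (w, v) ∈ upperHalf ↔ 0 < w + v := Iff.rfl

/-- The kernel `G + 1_{w + v > 0} J`. -/
def jumpKernel (G J : ℝ × ℝ → ℂ) (p : ℝ × ℝ) : ℂ := G p + upperHalf.indicator J p

/-- The coefficient of the cellwise constant (in the second variable) part of the kernel. -/
def cellCoef (t : ℕ → ℝ) (G J : ℝ × ℝ → ℂ) (σ : ℤˣ) (j : ℕ) (w : ℝ) : ℂ :=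
  G (w, signMul σ (t (j + 1))) +
    {w | -w ∉ signCell t σ j}.indicator
      (fun w => upperHalf.indicator J (w, signMul σ (t (j + 1)))) w

/-- The part of the kernel which is constant in the second variable on each cell. -/
def cellKernel (t : ℕ → ℝ) (G J : ℝ × ℝ → ℂ) (M : ℕ) (p : ℝ × ℝ) : ℂ :=
  ∑ q ∈ (Finset.univ : Finset ℤˣ) ×ˢ Finset.range M,
    cellCoef t G J q.1 q.2 p.1 * (signCell t q.1 q.2).indicator (1 : ℝ → ℂ) p.2

variable {t : ℕ → ℝ} {κ C R : ℝ} {G J : ℝ × ℝ → ℂ}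

lemma cellKernel_of_mem (ht : StrictMono t) (h0 : t 0 = 0) {M : ℕ} {σ : ℤˣ} {j : ℕ} (hj : j < M)
    {w v : ℝ} (hv : v ∈ signCell t σ j) : cellKernel t G J M (w, v) = cellCoef t G J σ j w := by
  unfold cellKernel
  rw [Finset.sum_eq_single (σ, j)]
  · simp [Set.indicator_of_mem hv]
  · rintro ⟨σ', j'⟩ - hne
    rw [Set.indicator_of_notMem, mul_zero]
    intro hv'
    obtain ⟨h1, h2⟩ := signCell_unique ht h0 hv hv'
    exact hne (by rw [h1, h2])
  · exact fun h => absurd (Finset.mem_product.2 ⟨Finset.mem_univ _, Finset.mem_range.2 hj⟩) h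

lemma cellKernel_of_notMem {M : ℕ} {w v : ℝ} (hv : ∀ σ, ∀ j < M, v ∉ signCell t σ j) :
    cellKernel t G J M (w, v) = 0 := by
  refine Finset.sum_eq_zero fun q hq => ?_
  rw [Set.indicator_of_notMem (hv q.1 q.2 (Finset.mem_range.1 (Finset.mem_product.1 hq).2)),
      mul_zero]

lemma mem_triangle_negFst {a b w v : ℝ} :
    (-w, v) ∈ triangle a b ↔ v ∈ Set.Ioc a b ∧ -w ∈ Set.Ioc a b ∧ 0 < w + v := by
  simp only [triangle, Set.mem_ofPred_eq, Set.mem_Ioc]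
  constructor
  · rintro ⟨h1, h2, h3⟩
    exact ⟨⟨by linarith, h3⟩, ⟨h1, by linarith⟩, by linarith⟩
  · rintro ⟨⟨h1, h2⟩, ⟨h3, h4⟩, h5⟩
    exact ⟨h3, by linarith, h2⟩

lemma mem_triangle_negSwap {a b w v : ℝ} :
    (-v, w) ∈ triangle a b ↔ -v ∈ Set.Ioc a b ∧ w ∈ Set.Ioc a b ∧ 0 < w + v := by
  simp only [triangle, Set.mem_ofPred_eq, Set.mem_Ioc]
  constructor
  · rintro ⟨h1, h2, h3⟩
    exact ⟨⟨h1, by linarith⟩, ⟨by linarith, h3⟩, by linarith⟩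
  · rintro ⟨⟨h1, h2⟩, ⟨h3, h4⟩, h5⟩
    exact ⟨h1, by linarith, h4⟩

lemma mem_signCell {σ : ℤˣ} {j : ℕ} {x : ℝ} :
    x ∈ signCell t σ j ↔ signMul σ x ∈ Set.Ioc (t j) (t (j + 1)) := Iff.rfl

lemma mem_signCell_one {j : ℕ} {x : ℝ} :
    x ∈ signCell t 1 j ↔ x ∈ Set.Ioc (t j) (t (j + 1)) := by rw [mem_signCell, signMul_one]

lemma mem_signCell_neg_one {j : ℕ} {x : ℝ} :
    x ∈ signCell t (-1) j ↔ -x ∈ Set.Ioc (t j) (t (j + 1)) := by rw [mem_signCell, signMul_neg_one]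

open Classical in
lemma mainKernel_eq_sum (c : ℕ → ℝ) (M : ℕ) (w v : ℝ) :
    mainKernel t c M (w, v) = ∑ j ∈ Finset.range M, Complex.I * c j *
      ((if v ∈ signCell t 1 j ∧ -w ∈ signCell t 1 j ∧ 0 < w + v then 1 else 0) -
      (if v ∈ signCell t (-1) j ∧ -w ∈ signCell t (-1) j ∧ 0 < w + v then 1 else 0)) := by
  unfold mainKernel
  refine Finset.sum_congr rfl fun j _ => ?_
  rw [Set.indicator_apply, Set.indicator_apply]
  simp only [mem_triangle_negFst (w := w), mem_triangle_negSwap (v := v), mem_signCell_one,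
    mem_signCell_neg_one, neg_neg, Pi.one_apply]

lemma mainKernel_of_notMem (c : ℕ → ℝ) {M : ℕ} {w v : ℝ}
    (hv : ∀ σ, ∀ j < M, v ∉ signCell t σ j) : mainKernel t c M (w, v) = 0 := by
  rw [mainKernel_eq_sum]
  refine Finset.sum_eq_zero fun j hj => ?_
  rw [Finset.mem_range] at hj
  simp [hv 1 j hj, hv (-1) j hj]

open Classical in
lemma mainKernel_of_mem (ht : StrictMono t) (h0 : t 0 = 0) (c : ℕ → ℝ) {M : ℕ} {σ : ℤˣ} {j : ℕ}
    (hj : j < M) {w v : ℝ} (hv : v ∈ signCell t σ j) :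
    mainKernel t c M (w, v) = if -w ∈ signCell t σ j ∧ 0 < w + v
      then Complex.I * ((((σ : ℤ) : ℝ) * c j : ℝ) : ℂ) else 0 := by
  rw [mainKernel_eq_sum, Finset.sum_eq_single j]
  · rcases Int.units_eq_one_or σ with e | e <;> subst e
    · have h' : v ∉ signCell t (-1) j := fun h' => by
        have := (signCell_unique ht h0 hv h').1
        exact absurd this (by decide)
      simp only [hv, h', true_and, false_and, if_false, sub_zero]
      split_ifs <;> simp
    · have h' : v ∉ signCell t 1 j := fun h' => by
        have := (signCell_unique ht h0 hv h').1
        exact absurd this (by decide)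
      simp only [hv, h', true_and, false_and, if_false, zero_sub]
      split_ifs <;> simp
  · intro j' _ hne
    have h' : ∀ σ', v ∉ signCell t σ' j' := fun σ' h' => hne (signCell_unique ht h0 hv h').2.symm
    simp [h']
  · intro h
    simp [hj] at h

lemma upperHalf_iff_of_notMem_cell {σ : ℤˣ} {j : ℕ} {w v : ℝ}
    (hv : v ∈ signCell t σ j) (hw : -w ∉ signCell t σ j) :
    (w, v) ∈ upperHalf ↔ (w, signMul σ (t (j + 1))) ∈ upperHalf := by
  rw [mem_upperHalf, mem_upperHalf]
  rcases Int.units_eq_one_or σ with e | e <;> subst e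
  · rw [mem_signCell_one] at hv hw
    rw [signMul_one]
    simp only [Set.mem_Ioc, not_and_or, not_lt, not_le] at hv hw
    constructor <;> intro h <;> rcases hw with hw | hw <;> linarith [hv.1, hv.2]
  · rw [mem_signCell_neg_one] at hv hw
    rw [signMul_neg_one]
    simp only [Set.mem_Ioc, not_and_or, not_lt, not_le, neg_neg] at hv hw
    constructor <;> intro h <;> rcases hw with hw | hw <;> linarith [hv.1, hv.2]

lemma abs_of_mem_signCell (hn : ∀ j, 0 ≤ t j) {σ : ℤˣ} {j : ℕ} {x : ℝ} (hx : x ∈ signCell t σ j) :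
    |x| ∈ Set.Ioc (t j) (t (j + 1)) := by
  have hx' : signMul σ x ∈ Set.Ioc (t j) (t (j + 1)) := hx
  rw [← abs_signMul σ, abs_of_pos ((hn j).trans_lt hx'.1)]
  exact hx'

lemma abs_sub_signMul_of_mem_signCell {σ : ℤˣ} {j : ℕ} {x y : ℝ} (hx : x ∈ signCell t σ j)
    (hy : signMul σ y ∈ Set.Icc (t j) (t (j + 1))) : |x - y| ≤ t (j + 1) - t j := by
  have hx' : signMul σ x ∈ Set.Ioc (t j) (t (j + 1)) := hx
  have h : |x - y| = |signMul σ x - signMul σ y| := by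
    rw [signMul_apply, signMul_apply, ← mul_sub, ← signMul_apply, abs_signMul]
  rw [h, abs_le]
  constructor <;> linarith [hx'.1, hx'.2, hy.1, hy.2]

lemma norm_sub_le_of_mem_cell {f : ℝ × ℝ → ℂ} (hC : 0 ≤ C)
    (hf : ∀ p : ℝ × ℝ, R < |p.1 + p.2| → f p = 0)
    (hl : ∀ w v v', |v - v'| ≤ 2 → ‖f (w, v) - f (w, v')‖ ≤ C * |v - v'| / (1 + |v|))
    {w v y μ : ℝ} (hvy : |v - y| ≤ μ * (1 + |v|)) (hvy2 : |v - y| ≤ 2) :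
    ‖f (w, v) - f (w, y)‖ ≤ C * μ * (band fun _ => R + 2).indicator 1 (w, v) := by
  by_cases h : (w, v) ∈ band fun _ => R + 2
  · rw [Set.indicator_of_mem h, Pi.one_apply, mul_one]
    refine (hl w v y hvy2).trans ?_
    rw [div_le_iff₀ (by positivity)]
    calc C * |v - y| ≤ C * (μ * (1 + |v|)) := by gcongr
      _ = _ := by ring
  · rw [Set.indicator_of_notMem h, mul_zero]
    have h1 : R + 2 < |w + v| := not_le.1 h
    have h2 : |w + v| ≤ |w + y| + |v - y| := by
      have := abs_add_le (w + y) (v - y)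
      rwa [show w + y + (v - y) = w + v by ring] at this
    rw [hf (w, v) (by simp only; linarith), hf (w, y) (by simp only; linarith)]
    simp

/-- The remainder after subtracting the model kernel and the cellwise constant part. -/
def remKernel (t c : ℕ → ℝ) (G J : ℝ × ℝ → ℂ) (M : ℕ) (p : ℝ × ℝ) : ℂ :=
  jumpKernel G J p - mainKernel t c M p - cellKernel t G J M p

lemma norm_remKernel_le_of_notMem (hJ : JumpKernel κ C R G J) (c : ℕ → ℝ) {M : ℕ} {w v : ℝ}
    (hv : ∀ σ, ∀ j < M, v ∉ signCell t σ j) :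
    ‖remKernel t c G J M (w, v)‖ ≤
      2 * C / (1 + |v|) * (band fun _ => R + 2).indicator 1 (w, v) := by
  rw [remKernel, mainKernel_of_notMem c hv, cellKernel_of_notMem hv, sub_zero, sub_zero, jumpKernel]
  have hi : ‖upperHalf.indicator J (w, v)‖ ≤ ‖J (w, v)‖ := norm_indicator_le_norm_self _ _
  by_cases h : (w, v) ∈ band fun _ => R + 2
  · rw [Set.indicator_of_mem h, Pi.one_apply, mul_one]
    refine (norm_add_le _ _).trans ?_
    have h1 := hJ.bound_G (w, v)
    have h2 := hJ.bound_J (w, v)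
    simp only at h1 h2
    calc _ ≤ C / (1 + |v|) + C / (1 + |v|) := add_le_add h1 (hi.trans h2)
      _ = _ := by ring
  · have h1 : R + 2 < |w + v| := not_le.1 h
    rw [hJ.supp_J (w, v) (by simp only; linarith), norm_zero] at hi
    rw [hJ.supp_G (w, v) (by simp only; linarith), norm_le_zero_iff.1 hi,
      Set.indicator_of_notMem h]
    simp

lemma norm_remKernel_le_of_mem (hJ : JumpKernel κ C R G J) {n : ℕ} (hn : 1 ≤ n) {σ : ℤˣ} {j : ℕ}
    (hj : j < cellCount n) {w v : ℝ} (hv : v ∈ signCell (grid n) σ j) :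
    ‖remKernel (grid n) (fun j => κ / (1 + grid n j)) G J (cellCount n) (w, v)‖ ≤
      (2 * C + |κ|) * mesh n * (band fun _ => R + 2).indicator 1 (w, v) +
        (band fun v => mesh n * (1 + |v|)).indicator (fun p => 9 * C / (1 + |p.2|) ^ 2) (w, v) := by
  have hC := hJ.hC
  have hR := hJ.hR
  have ht := strictMono_grid hn
  have hg0 := grid_nonneg n j
  have hm0 := mesh_nonneg n
  have hl2 := grid_cell_le_two hn hj
  have hls := grid_succ_sub n j
  have hva := abs_of_mem_signCell (grid_nonneg n) hv
  have hmv : mesh n * (1 + grid n j) ≤ mesh n * (1 + |v|) := by gcongr; exact hva.1.le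
  set b := signMul σ (grid n (j + 1)) with hb
  have hvb : |v - b| ≤ grid n (j + 1) - grid n j :=
    abs_sub_signMul_of_mem_signCell hv (by
      rw [hb, signMul_signMul]; exact ⟨(ht (Nat.lt_succ_self j)).le, le_rfl⟩)
  have hG := norm_sub_le_of_mem_cell (w := w) hC hJ.supp_G hJ.lip_G
    (hvb.trans (hls.le.trans hmv)) (hvb.trans hl2)
  have hJb := norm_sub_le_of_mem_cell (w := w) hC hJ.supp_J hJ.lip_J
    (hvb.trans (hls.le.trans hmv)) (hvb.trans hl2)
  have hB1 : (0 : ℝ) ≤ (band fun _ => R + 2).indicator 1 (w, v) :=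
    Set.indicator_nonneg (fun _ _ => zero_le_one) _
  have hB2 : 0 ≤ (band fun v => mesh n * (1 + |v|)).indicator
      (fun p => 9 * C / (1 + |p.2|) ^ 2) (w, v) :=
    Set.indicator_nonneg (fun p _ => by positivity) _
  rw [remKernel, mainKernel_of_mem ht (grid_zero n) _ hj hv,
      cellKernel_of_mem ht (grid_zero n) hj hv,
    jumpKernel, cellCoef, ← hb]
  by_cases hw : -w ∈ signCell (grid n) σ j
  · rw [Set.indicator_of_notMem (s := {w | -w ∉ signCell (grid n) σ j}) (by simpa using hw),
      add_zero]
    by_cases hu : (w, v) ∈ upperHalf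
    · rw [if_pos ⟨hw, hu⟩, Set.indicator_of_mem hu]
      have hwa := abs_of_mem_signCell (grid_nonneg n) hw
      have hvw : |v - -w| ≤ grid n (j + 1) - grid n j :=
        abs_sub_signMul_of_mem_signCell hv ⟨hw.1.le, hw.2⟩
      have hJw := norm_sub_le_of_mem_cell (w := w) hC hJ.supp_J hJ.lip_J
        (hvw.trans (hls.le.trans hmv)) (hvw.trans hl2)
      have hwpos : 0 < signMul σ (-w) := hg0.trans_lt hw.1
      have hjump := hJ.jump σ (signMul σ (-w)) hwpos
      rw [signMul_signMul, neg_neg] at hjump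
      have hwabs : signMul σ (-w) = |(-w)| := by rw [← abs_signMul σ, abs_of_pos hwpos]
      rw [hwabs] at hjump
      set x := |(-w)| with hx
      have hx0 : 0 ≤ x := abs_nonneg _
      have hb2 : (w, v) ∈ band fun v => mesh n * (1 + |v|) := by
        show |w + v| ≤ mesh n * (1 + |v|)
        rw [show w + v = v - -w by ring]
        exact hvw.trans (hls.le.trans hmv)
      have hb1 : (w, v) ∈ band fun _ => R + 2 := by
        show |w + v| ≤ R + 2
        rw [show w + v = v - -w by ring]
        linarith
      rw [Set.indicator_of_mem hb1, Pi.one_apply, mul_one] at hJw hG ⊢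
      rw [Set.indicator_of_mem hb2]
      have h3 : 1 + |v| ≤ 3 * (1 + x) := by
        have := mesh_le_two hn
        have h4 : mesh n * (1 + grid n j) ≤ 2 * (1 + grid n j) := by gcongr
        linarith [hva.2, hwa.1]
      have hq : C / (1 + x) ^ 2 ≤ 9 * C / (1 + |v|) ^ 2 := by
        rw [div_le_div_iff₀ (by positivity) (by positivity)]
        have : (1 + |v|) ^ 2 ≤ (3 * (1 + x)) ^ 2 := by gcongr
        nlinarith
      have hcoef : ‖Complex.I * ((((σ : ℤ) : ℝ) * (κ / (1 + x)) : ℝ) : ℂ) -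
          Complex.I * ((((σ : ℤ) : ℝ) * (κ / (1 + grid n j)) : ℝ) : ℂ)‖ ≤ |κ| * mesh n := by
        rw [← mul_sub, ← Complex.ofReal_sub, ← mul_sub, norm_mul, Complex.norm_I, one_mul,
          Complex.norm_real, Real.norm_eq_abs, ← signMul_apply, abs_signMul,
          show κ / (1 + x) - κ / (1 + grid n j) =
            κ * ((grid n j - x) / ((1 + x) * (1 + grid n j))) by field_simp; ring, abs_mul]
        gcongr
        rw [abs_div, abs_of_pos (by positivity : 0 < (1 + x) * (1 + grid n j)),
          div_le_iff₀ (by positivity), abs_sub_comm, abs_of_nonneg (by linarith [hwa.1])]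
        calc x - grid n j ≤ mesh n * (1 + grid n j) := by linarith [hwa.2]
          _ = mesh n * (1 * (1 + grid n j)) := by ring
          _ ≤ _ := by gcongr; linarith
      have e : G (w, v) + J (w, v) - Complex.I * ((((σ : ℤ) : ℝ) * (κ / (1 + grid n j)) : ℝ) : ℂ) -
          G (w, b) = (G (w, v) - G (w, b)) + (J (w, v) - J (w, -w)) +
          (J (w, -w) - Complex.I * ((((σ : ℤ) : ℝ) * (κ / (1 + x)) : ℝ) : ℂ)) +
          (Complex.I * ((((σ : ℤ) : ℝ) * (κ / (1 + x)) : ℝ) : ℂ) -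
          Complex.I * ((((σ : ℤ) : ℝ) * (κ / (1 + grid n j)) : ℝ) : ℂ)) := by ring
      rw [e]
      refine (norm_add₄_le).trans ?_
      calc _ ≤ C * mesh n + C * mesh n + 9 * C / (1 + |v|) ^ 2 + |κ| * mesh n := by
            gcongr
            exact hjump.trans hq
        _ = _ := by ring
    · rw [if_neg (fun h => hu h.2), Set.indicator_of_notMem hu, add_zero, sub_zero]
      have : 0 ≤ (C + |κ|) * mesh n * (band fun _ => R + 2).indicator 1 (w, v) := by positivity
      linarith
  · rw [Set.indicator_of_mem (s := {w | -w ∉ signCell (grid n) σ j}) (by simpa using hw),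
      if_neg (fun h => hw h.1), sub_zero]
    have hiff := upperHalf_iff_of_notMem_cell hv hw
    have hκ : 0 ≤ |κ| * mesh n * (band fun _ => R + 2).indicator 1 (w, v) := by positivity
    by_cases hu : (w, v) ∈ upperHalf
    · rw [Set.indicator_of_mem hu, Set.indicator_of_mem (hiff.1 hu),
        show G (w, v) + J (w, v) - (G (w, b) + J (w, b)) =
          (G (w, v) - G (w, b)) + (J (w, v) - J (w, b)) by ring]
      refine (norm_add_le _ _).trans ?_
      linarith
    · rw [Set.indicator_of_notMem hu, Set.indicator_of_notMem (fun h => hu (hiff.2 h)), add_zero,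
        add_zero]
      have : 0 ≤ C * mesh n * (band fun _ => R + 2).indicator 1 (w, v) := by positivity
      linarith

end JumpKernel

section Remainder

lemma integral_band_const {ρ A T : ℝ} (hρ : 0 ≤ ρ) (hA : 0 ≤ A) (hT : 0 ≤ T) :
    Integrable ((band fun _ => ρ).indicator fun p => {v : ℝ | |v| ≤ T}.indicator (fun _ => A) p.2) ∧
    ∫ p, (band fun _ => ρ).indicator (fun p => {v : ℝ | |v| ≤ T}.indicator (fun _ => A) p.2) p =
      A * (2 * ρ) * (2 * T) := by
  have hs : {v : ℝ | |v| ≤ T} = Set.Icc (-T) T := by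
    ext v
    rw [Set.mem_ofPred_eq, Set.mem_Icc, abs_le]
  have hm : MeasurableSet {v : ℝ | |v| ≤ T} := by rw [hs]; exact measurableSet_Icc
  have hi : (fun v => {v : ℝ | |v| ≤ T}.indicator (fun _ => A) v * (2 * ρ)) =
      (Set.Icc (-T) T).indicator fun _ => A * (2 * ρ) := by
    rw [hs]
    ext v
    by_cases h : v ∈ Set.Icc (-T) T
    · rw [Set.indicator_of_mem h, Set.indicator_of_mem h]
    · rw [Set.indicator_of_notMem h, Set.indicator_of_notMem h, zero_mul]
  have h := integral_band (m := {v : ℝ | |v| ≤ T}.indicator fun _ => A) (r := fun _ => ρ)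
    (measurable_const.indicator hm) measurable_const
    (fun v => Set.indicator_nonneg (fun _ _ => hA) _) (fun _ => hρ) (by
      rw [hi]
      exact (integrable_indicator_iff measurableSet_Icc).2 (integrableOn_const (by simp)))
  refine ⟨h.1, h.2.trans ?_⟩
  rw [hi, integral_indicator measurableSet_Icc, setIntegral_const,
    Real.volume_real_Icc_of_le (by linarith), smul_eq_mul]
  ring

lemma integral_band_tail {ρ A T : ℝ} (hρ : 0 ≤ ρ) (hA : 0 ≤ A) (hT : 0 ≤ T) :
    Integrable ((band fun _ => ρ).indicator fun p =>
      {v : ℝ | T < |v|}.indicator (fun v => A * ((1 + |v|) ^ 2)⁻¹) p.2) ∧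
    ∫ p, (band fun _ => ρ).indicator (fun p =>
      {v : ℝ | T < |v|}.indicator (fun v => A * ((1 + |v|) ^ 2)⁻¹) p.2) p =
      A * (2 * ρ) * (2 * (1 + T)⁻¹) := by
  have hm : MeasurableSet {v : ℝ | T < |v|} := measurableSet_lt measurable_const (by fun_prop)
  have hi : (fun v => {v : ℝ | T < |v|}.indicator (fun v => A * ((1 + |v|) ^ 2)⁻¹) v * (2 * ρ)) =
      fun v => A * (2 * ρ) * {v : ℝ | T < |v|}.indicator (fun v => ((1 + |v|) ^ 2)⁻¹) v := by
    ext v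
    by_cases h : v ∈ {v : ℝ | T < |v|}
    · rw [Set.indicator_of_mem h, Set.indicator_of_mem h]
      ring
    · rw [Set.indicator_of_notMem h, Set.indicator_of_notMem h]
      ring
  have ht := integral_tail_inv_sq T hT
  have h := integral_band (m := {v : ℝ | T < |v|}.indicator fun v => A * ((1 + |v|) ^ 2)⁻¹)
    (r := fun _ => ρ) (Measurable.indicator (by fun_prop) hm) measurable_const
    (fun v => Set.indicator_nonneg (fun _ _ => by positivity) _) (fun _ => hρ) (by
      rw [hi]
      exact ht.1.const_mul _)
  refine ⟨h.1, h.2.trans ?_⟩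
  rw [hi, integral_const_mul, ht.2]

lemma integral_band_cone {μ A : ℝ} (hμ : 0 ≤ μ) (hA : 0 ≤ A) :
    Integrable ((band fun v => μ * (1 + |v|)).indicator fun p =>
      {v : ℝ | 0 < |v|}.indicator (fun v => A * ((1 + |v|) ^ 3)⁻¹) p.2) ∧
    ∫ p, (band fun v => μ * (1 + |v|)).indicator (fun p =>
      {v : ℝ | 0 < |v|}.indicator (fun v => A * ((1 + |v|) ^ 3)⁻¹) p.2) p = 4 * A * μ := by
  have hm : MeasurableSet {v : ℝ | 0 < |v|} := measurableSet_lt measurable_const (by fun_prop)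
  have hi : (fun v => {v : ℝ | 0 < |v|}.indicator (fun v => A * ((1 + |v|) ^ 3)⁻¹) v *
      (2 * (μ * (1 + |v|)))) =
      fun v => A * (2 * μ) * {v : ℝ | 0 < |v|}.indicator (fun v => ((1 + |v|) ^ 2)⁻¹) v := by
    ext v
    by_cases h : v ∈ {v : ℝ | 0 < |v|}
    · rw [Set.indicator_of_mem h, Set.indicator_of_mem h]
      have : 1 + |v| ≠ 0 := by positivity
      field_simp
    · rw [Set.indicator_of_notMem h, Set.indicator_of_notMem h]
      ring
  have ht := integral_tail_inv_sq 0 le_rfl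
  have h := integral_band (m := {v : ℝ | 0 < |v|}.indicator fun v => A * ((1 + |v|) ^ 3)⁻¹)
    (r := fun v => μ * (1 + |v|)) (Measurable.indicator (by fun_prop) hm) (by fun_prop)
    (fun v => Set.indicator_nonneg (fun _ _ => by positivity) _) (fun _ => by positivity) (by
      rw [hi]
      exact ht.1.const_mul _)
  refine ⟨h.1, h.2.trans ?_⟩
  rw [hi, integral_const_mul, ht.2]
  ring

variable {κ C R : ℝ} {G J : ℝ × ℝ → ℂ}

/-- The cell coefficients `κ / (1 + t_j)` of the model kernel. -/
def gridCoef (κ : ℝ) (n j : ℕ) : ℝ := κ / (1 + grid n j)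

/-- A majorant of the squared remainder kernel. -/
def remBound (κ C R : ℝ) (n : ℕ) (p : ℝ × ℝ) : ℝ :=
  (band fun _ => R + 2).indicator (fun p => {v : ℝ | |v| ≤ grid n (cellCount n)}.indicator
      (fun _ => 2 * ((2 * C + |κ|) * mesh n) ^ 2) p.2) p +
    (band fun _ => R + 2).indicator (fun p => {v : ℝ | grid n (cellCount n) < |v|}.indicator
      (fun v => (2 * C) ^ 2 * ((1 + |v|) ^ 2)⁻¹) p.2) p +
    (band fun v => mesh n * (1 + |v|)).indicator (fun p => {v : ℝ | 0 < |v|}.indicator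
      (fun v => 2 * (9 * C) ^ 2 * ((1 + |v|) ^ 3)⁻¹) p.2) p

lemma norm_remKernel_sq_le (hJ : JumpKernel κ C R G J) {n : ℕ} (hn : 1 ≤ n) {w v : ℝ}
    (hv0 : v ≠ 0) :
    ‖remKernel (grid n) (gridCoef κ n) G J (cellCount n) (w, v)‖ ^ 2 ≤ remBound κ C R n (w, v) := by
  have hC := hJ.hC
  have hm0 := mesh_nonneg n
  have hp : 0 < |v| := abs_pos.2 hv0
  have n1 : 0 ≤ (band fun _ => R + 2).indicator (fun p =>
      {v : ℝ | |v| ≤ grid n (cellCount n)}.indicator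
      (fun _ => 2 * ((2 * C + |κ|) * mesh n) ^ 2) p.2) (w, v) :=
    Set.indicator_nonneg (fun _ _ => Set.indicator_nonneg (fun _ _ => by positivity) _) _
  have n2 : 0 ≤ (band fun _ => R + 2).indicator (fun p =>
      {v : ℝ | grid n (cellCount n) < |v|}.indicator
      (fun v => (2 * C) ^ 2 * ((1 + |v|) ^ 2)⁻¹) p.2) (w, v) :=
    Set.indicator_nonneg (fun _ _ => Set.indicator_nonneg (fun _ _ => by positivity) _) _
  have n3 : 0 ≤ (band fun v => mesh n * (1 + |v|)).indicator (fun p => {v : ℝ | 0 < |v|}.indicator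
      (fun v => 2 * (9 * C) ^ 2 * ((1 + |v|) ^ 3)⁻¹) p.2) (w, v) :=
    Set.indicator_nonneg (fun _ _ => Set.indicator_nonneg (fun _ _ => by positivity) _) _
  unfold remBound
  by_cases hv : |v| ≤ grid n (cellCount n)
  · obtain ⟨j, hj, hvj⟩ := exists_mem_cell _ hp hv
    obtain ⟨σ, hσ⟩ : ∃ σ : ℤˣ, v ∈ signCell (grid n) σ j := by
      rcases le_total 0 v with h | h
      · exact ⟨1, by rw [mem_signCell_one, ← abs_of_nonneg h]; exact hvj⟩
      · exact ⟨-1, by rw [mem_signCell_neg_one, ← abs_of_nonpos h]; exact hvj⟩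
    have hb := norm_remKernel_le_of_mem (w := w) hJ hn hj hσ
    have e1 : ((2 * C + |κ|) * mesh n * (band fun _ => R + 2).indicator 1 (w, v)) ^ 2 * 2 =
        (band fun _ => R + 2).indicator (fun p => {v : ℝ | |v| ≤ grid n (cellCount n)}.indicator
      (fun _ => 2 * ((2 * C + |κ|) * mesh n) ^ 2) p.2) (w, v) := by
      by_cases h : (w, v) ∈ band fun _ => R + 2
      · rw [Set.indicator_of_mem h, Set.indicator_of_mem h, Set.indicator_of_mem (by exact hv)]
        simp only [Pi.one_apply]
        ring
      · rw [Set.indicator_of_notMem h, Set.indicator_of_notMem h]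
        ring
    have e2 : ((band fun v => mesh n * (1 + |v|)).indicator
        (fun p => 9 * C / (1 + |p.2|) ^ 2) (w, v)) ^ 2 * 2 ≤
        (band fun v => mesh n * (1 + |v|)).indicator (fun p => {v : ℝ | 0 < |v|}.indicator
        (fun v => 2 * (9 * C) ^ 2 * ((1 + |v|) ^ 3)⁻¹) p.2) (w, v) := by
      by_cases h : (w, v) ∈ band fun v => mesh n * (1 + |v|)
      · rw [Set.indicator_of_mem h, Set.indicator_of_mem h, Set.indicator_of_mem (by exact hp)]
        simp only
        rw [div_pow, div_mul_eq_mul_div, mul_comm, div_eq_mul_inv]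
        have : ((((1 + |v|) ^ 2) ^ 2)⁻¹) ≤ (((1 + |v|) ^ 3)⁻¹) := by
          rw [← pow_mul]
          exact inv_anti₀ (by positivity) (pow_le_pow_right₀ (by linarith) (by norm_num))
        gcongr
      · rw [Set.indicator_of_notMem h, Set.indicator_of_notMem h]
        norm_num
    calc _ ≤ ((2 * C + |κ|) * mesh n * (band fun _ => R + 2).indicator 1 (w, v) +
        (band fun v => mesh n * (1 + |v|)).indicator
          (fun p => 9 * C / (1 + |p.2|) ^ 2) (w, v)) ^ 2 := by
          gcongr
          exact hb
      _ ≤ 2 * (((2 * C + |κ|) * mesh n * (band fun _ => R + 2).indicator 1 (w, v)) ^ 2 +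
        ((band fun v => mesh n * (1 + |v|)).indicator
          (fun p => 9 * C / (1 + |p.2|) ^ 2) (w, v)) ^ 2) := add_sq_le
      _ ≤ _ := by linarith
  · have hv' : grid n (cellCount n) < |v| := not_le.1 hv
    have hnot : ∀ σ, ∀ j < cellCount n, v ∉ signCell (grid n) σ j := by
      intro σ j hj h
      have h1 := (abs_of_mem_signCell (grid_nonneg n) h).2
      have h2 := (strictMono_grid hn).monotone (show j + 1 ≤ cellCount n by omega)
      linarith
    have hb := norm_remKernel_le_of_notMem (w := w) hJ (gridCoef κ n) hnot
    have e1 : (2 * C / (1 + |v|) * (band fun _ => R + 2).indicator 1 (w, v)) ^ 2 =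
        (band fun _ => R + 2).indicator (fun p => {v : ℝ | grid n (cellCount n) < |v|}.indicator
      (fun v => (2 * C) ^ 2 * ((1 + |v|) ^ 2)⁻¹) p.2) (w, v) := by
      by_cases h : (w, v) ∈ band fun _ => R + 2
      · rw [Set.indicator_of_mem h, Set.indicator_of_mem h, Set.indicator_of_mem (by exact hv')]
        simp only [Pi.one_apply]
        rw [mul_one, div_pow, div_eq_mul_inv]
      · rw [Set.indicator_of_notMem h, Set.indicator_of_notMem h]
        ring
    calc _ ≤ (2 * C / (1 + |v|) * (band fun _ => R + 2).indicator 1 (w, v)) ^ 2 := by gcongr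
      _ ≤ _ := by linarith

/-- The constant in the Hilbert–Schmidt bound of the remainder. -/
def remConst (κ C R : ℝ) : ℝ :=
  64 * (2 * C + |κ|) ^ 2 * (R + 2) + 4 * (2 * C) ^ 2 * (R + 2) + 16 * (9 * C) ^ 2

lemma integral_remBound (hC : 0 ≤ C) (hR : 0 ≤ R) {n : ℕ} (hn : 1 ≤ n) :
    Integrable (remBound κ C R n) ∧ ∫ p, remBound κ C R n p ≤ remConst κ C R / n := by
  have hn' : (0 : ℝ) < n := by exact_mod_cast hn
  have hT := grid_nonneg n (cellCount n)
  have hm0 := mesh_nonneg n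
  have b1 := integral_band_const (ρ := R + 2) (A := 2 * ((2 * C + |κ|) * mesh n) ^ 2)
    (by linarith) (by positivity) hT
  have b2 := integral_band_tail (ρ := R + 2) (A := (2 * C) ^ 2) (by linarith) (by positivity) hT
  have b3 := integral_band_cone (μ := mesh n) (A := 2 * (9 * C) ^ 2) hm0 (by positivity)
  refine ⟨(b1.1.add b2.1).add b3.1, ?_⟩
  unfold remBound
  rw [integral_add (by exact b1.1.add b2.1) b3.1, integral_add b1.1 b2.1, b1.2, b2.2, b3.2]
  have hmesh := mesh_le hn
  have h1 : 2 * ((2 * C + |κ|) * mesh n) ^ 2 * (2 * (R + 2)) * (2 * grid n (cellCount n)) ≤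
      2 * ((2 * C + |κ|) * (2 / n)) ^ 2 * (2 * (R + 2)) * (2 * (2 * n)) := by
    have := grid_cellCount_le hn
    gcongr
  have h2 : (2 * C) ^ 2 * (2 * (R + 2)) * (2 * (1 + grid n (cellCount n))⁻¹) ≤
      (2 * C) ^ 2 * (2 * (R + 2)) * (2 * (n : ℝ)⁻¹) := by
    have := le_one_add_grid_cellCount hn
    gcongr
  have h3 : 4 * (2 * (9 * C) ^ 2) * mesh n ≤ 4 * (2 * (9 * C) ^ 2) * (2 / n) := by gcongr
  refine (add_le_add (add_le_add h1 h2) h3).trans (le_of_eq ?_)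
  unfold remConst
  field_simp
  ring

end Remainder

section Decomposition

open ComplexConjugate

lemma memLp_of_bound_of_support {f : ℝ → ℂ} (hf : Measurable f) {A ρ : ℝ}
    (hb : ∀ x, ‖f x‖ ≤ A) (hs : ∀ x, ρ < |x| → f x = 0) : MemLp f 2 volume := by
  have he : f = (Set.Icc (-ρ) ρ).indicator f := by
    ext x
    by_cases h : x ∈ Set.Icc (-ρ) ρ
    · rw [Set.indicator_of_mem h]
    · rw [Set.indicator_of_notMem h]
      refine hs x ?_
      rw [Set.mem_Icc, ← abs_le] at h
      exact not_le.1 h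
  rw [he, memLp_indicator_iff_restrict measurableSet_Icc]
  exact MemLp.of_bound hf.aestronglyMeasurable A (ae_of_all _ hb)

lemma integral_signCell_eq_zero {t : ℕ → ℝ} {M : ℕ} {f : L2R} (hf : ZeroMean t M f) (σ : ℤˣ)
    {j : ℕ} (hj : j < M) : ∫ v, (signCell t σ j).indicator (1 : ℝ → ℂ) v * f v = 0 := by
  have h := hf σ j hj
  rw [inner_modeVec, modeCoef, ← integral_indicator measurableSet_Ioc] at h
  rw [← (measurePreserving_signMul σ).integral_comp (signMul σ).measurableEmbedding
    (fun v => (signCell t σ j).indicator (1 : ℝ → ℂ) v * f v), ← h]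
  refine integral_congr_ae (ae_of_all _ fun x => ?_)
  beta_reduce
  have hx : signMul σ x ∈ signCell t σ j ↔ x ∈ Set.Ioc (t j) (t (j + 1)) := by
    rw [mem_signCell, signMul_signMul]
  by_cases hxm : x ∈ Set.Ioc (t j) (t (j + 1))
  · rw [Set.indicator_of_mem hxm, Set.indicator_of_mem (hx.2 hxm), neg_zero, expMode_zero,
      Pi.one_apply]
  · rw [Set.indicator_of_notMem hxm, Set.indicator_of_notMem (fun h => hxm (hx.1 h)), zero_mul]

lemma memLp_indicator_signCell {t : ℕ → ℝ} (σ : ℤˣ) (j : ℕ) :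
    MemLp ((signCell t σ j).indicator (1 : ℝ → ℂ)) 2 volume := by
  refine (memLp_comp_signMul σ (memLp_indicator_expMode (t j) (t (j + 1)) 0)).ae_eq
    (ae_of_all _ fun x => ?_)
  by_cases hx : x ∈ signCell t σ j
  · rw [Set.indicator_of_mem hx, Set.indicator_of_mem (mem_signCell.1 hx), expMode_zero,
      Pi.one_apply]
  · rw [Set.indicator_of_notMem hx, Set.indicator_of_notMem (fun h => hx (mem_signCell.2 h))]

variable {κ C R : ℝ} {G J : ℝ × ℝ → ℂ} {t : ℕ → ℝ}

lemma JumpKernel.norm_G_le (hJ : JumpKernel κ C R G J) (p : ℝ × ℝ) : ‖G p‖ ≤ C :=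
  (hJ.bound_G p).trans (div_le_self hJ.hC (by linarith [abs_nonneg p.2]))

lemma JumpKernel.norm_J_le (hJ : JumpKernel κ C R G J) (p : ℝ × ℝ) : ‖J p‖ ≤ C :=
  (hJ.bound_J p).trans (div_le_self hJ.hC (by linarith [abs_nonneg p.2]))

lemma measurable_cellCoef (hJ : JumpKernel κ C R G J) (σ : ℤˣ) (j : ℕ) :
    Measurable (cellCoef t G J σ j) := by
  refine (hJ.measurable_G.comp (measurable_id.prodMk measurable_const)).add
    (((hJ.measurable_J.indicator measurableSet_upperHalf).comp
      (measurable_id.prodMk measurable_const)).indicator ?_)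
  exact (measurable_neg (measurableSet_signCell t σ j)).compl

lemma memLp_cellCoef (hJ : JumpKernel κ C R G J) (σ : ℤˣ) (j : ℕ) :
    MemLp (cellCoef t G J σ j) 2 volume := by
  refine memLp_of_bound_of_support (measurable_cellCoef hJ σ j) (A := C + C)
    (ρ := R + |signMul σ (t (j + 1))|) (fun w => ?_) (fun w hw => ?_)
  · refine (norm_add_le _ _).trans (add_le_add (hJ.norm_G_le _) ?_)
    refine (norm_indicator_le_norm_self _ _).trans ?_
    exact (norm_indicator_le_norm_self _ _).trans (hJ.norm_J_le _)
  · have h : R < |w + signMul σ (t (j + 1))| := by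
      have := abs_sub_abs_le_abs_sub w (-signMul σ (t (j + 1)))
      rw [abs_neg, sub_neg_eq_add] at this
      linarith
    rw [cellCoef, hJ.supp_G _ h, zero_add]
    refine Set.indicator_apply_eq_zero.2 fun _ => Set.indicator_apply_eq_zero.2 fun _ => ?_
    exact hJ.supp_J _ h

lemma memLp_cellKernel_term (hJ : JumpKernel κ C R G J) (σ : ℤˣ) (j : ℕ) :
    MemLp (fun p : ℝ × ℝ => cellCoef t G J σ j p.1 *
      (signCell t σ j).indicator (1 : ℝ → ℂ) p.2) 2 volume := by
  refine (memLp_two_tensor (memLp_indicator_signCell (t := t) σ j)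
    (memLp_conj (memLp_cellCoef (t := t) hJ σ j))).ae_eq (ae_of_all _ fun p => ?_)
  beta_reduce
  rw [Complex.conj_conj, mul_comm]

lemma memLp_cellKernel (hJ : JumpKernel κ C R G J) (M : ℕ) :
    MemLp (cellKernel t G J M) 2 volume :=
  memLp_finsetSum _ fun q _ => memLp_cellKernel_term hJ q.1 q.2

lemma kernelForm_cellKernel (hJ : JumpKernel κ C R G J) {M : ℕ} {f : L2R} (hf : ZeroMean t M f) :
    kernelForm (cellKernel t G J M) f = 0 := by
  unfold kernelForm cellKernel
  simp only [Finset.sum_mul]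
  rw [integral_finsetSum _ fun q _ => integrable_kernelForm (memLp_cellKernel_term hJ q.1 q.2) f]
  refine Finset.sum_eq_zero fun q hq => ?_
  have e : ∀ p : ℝ × ℝ, cellCoef t G J q.1 q.2 p.1 *
      (signCell t q.1 q.2).indicator (1 : ℝ → ℂ) p.2 * (f p.2 * conj (f p.1)) =
      (fun w => cellCoef t G J q.1 q.2 w * conj (f w)) p.1 *
      (fun v => (signCell t q.1 q.2).indicator (1 : ℝ → ℂ) v * f v) p.2 := fun p => by ring
  rw [integral_congr_ae (ae_of_all _ e), Measure.volume_eq_prod,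
    integral_prod_mul (fun w => cellCoef t G J q.1 q.2 w * conj (f w))
      (fun v => (signCell t q.1 q.2).indicator (1 : ℝ → ℂ) v * f v),
    integral_signCell_eq_zero hf q.1 (Finset.mem_range.1 (Finset.mem_product.1 hq).2), mul_zero]

lemma measurable_jumpKernel (hJ : JumpKernel κ C R G J) : Measurable (jumpKernel G J) :=
  hJ.measurable_G.add (hJ.measurable_J.indicator measurableSet_upperHalf)

lemma memLp_remKernel (hJ : JumpKernel κ C R G J) {n : ℕ} (hn : 1 ≤ n) :
    MemLp (remKernel (grid n) (gridCoef κ n) G J (cellCount n)) 2 volume ∧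
      ∫ p, ‖remKernel (grid n) (gridCoef κ n) G J (cellCount n) p‖ ^ 2 ≤ remConst κ C R / n := by
  have hm : AEStronglyMeasurable (remKernel (grid n) (gridCoef κ n) G J (cellCount n)) volume :=
    ((measurable_jumpKernel hJ).aestronglyMeasurable.sub (memLp_mainKernel _ _ _).1).sub
      (memLp_cellKernel hJ _).1
  have hb : ∀ᵐ p : ℝ × ℝ, ‖remKernel (grid n) (gridCoef κ n) G J (cellCount n) p‖ ^ 2 ≤
      remBound κ C R n p := by
    have h0 : ∀ᵐ v : ℝ, v ≠ 0 := by simp [ae_iff]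
    filter_upwards [ae_comp_snd h0] with p hp
    exact norm_remKernel_sq_le hJ hn hp
  have hi := integral_remBound (κ := κ) hJ.hC hJ.hR hn
  have hint : Integrable fun p =>
      ‖remKernel (grid n) (gridCoef κ n) G J (cellCount n) p‖ ^ 2 :=
    hi.1.mono' (hm.norm.pow 2) (by
      filter_upwards [hb] with p hp
      rwa [Real.norm_of_nonneg (by positivity)])
  exact ⟨(memLp_two_iff_integrable_sq_norm hm).2 hint, (integral_mono_ae hint hi.1 hb).trans hi.2⟩

lemma jumpKernel_eq_add (c : ℕ → ℝ) (M : ℕ) : jumpKernel G J = fun p =>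
    mainKernel t c M p + remKernel t c G J M p + cellKernel t G J M p := by
  ext p
  rw [remKernel]
  ring

lemma memLp_jumpKernel (hJ : JumpKernel κ C R G J) : MemLp (jumpKernel G J) 2 volume := by
  rw [jumpKernel_eq_add (t := grid 1) (gridCoef κ 1) (cellCount 1)]
  exact ((memLp_mainKernel _ _ _).add (memLp_remKernel hJ le_rfl).1).add (memLp_cellKernel hJ _)

lemma kernelForm_jumpKernel (hJ : JumpKernel κ C R G J) {n : ℕ} (hn : 1 ≤ n) {f : L2R}
    (hf : ZeroMean (grid n) (cellCount n) f) :
    kernelForm (jumpKernel G J) f =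
      kernelForm (mainKernel (grid n) (gridCoef κ n) (cellCount n)) f +
      kernelForm (remKernel (grid n) (gridCoef κ n) G J (cellCount n)) f := by
  rw [jumpKernel_eq_add (t := grid n) (gridCoef κ n) (cellCount n),
    kernelForm_add (k := fun p => mainKernel (grid n) (gridCoef κ n) (cellCount n) p +
      remKernel (grid n) (gridCoef κ n) G J (cellCount n) p)
      ((memLp_mainKernel _ _ _).add (memLp_remKernel hJ hn).1) (memLp_cellKernel hJ _),
    kernelForm_cellKernel hJ hf, add_zero,
    kernelForm_add (memLp_mainKernel _ _ _) (memLp_remKernel hJ hn).1]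

end Decomposition

section EigenvalueAsymptotics

variable {κ C R : ℝ} {G J : ℝ × ℝ → ℂ}

lemma exists_submodule_jumpKernel_near (hJ : JumpKernel κ C R G J) {δ : ℝ} (hδ : 0 < δ) :
    ∃ B : ℕ, ∀ n : ℕ, 1 ≤ n → ∃ W : Submodule ℂ L2R,
      Module.rank ℂ W ≤ ((2 * cellCount n + B * n : ℕ) : Cardinal) ∧
      ∀ u ∈ Wᗮ, ZeroMean (grid n) (cellCount n) u ∧
        |(kernelForm (jumpKernel G J) u).re -
          (kernelForm (mainKernel (grid n) (gridCoef κ n) (cellCount n)) u).re| ≤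
            δ / n * ‖u‖ ^ 2 := by
  refine ⟨⌈remConst κ C R / δ ^ 2⌉₊, fun n hn => ?_⟩
  have hn' : (0 : ℝ) < n := by exact_mod_cast hn
  obtain ⟨hE, hE2⟩ := memLp_remKernel hJ hn
  have hc : remConst κ C R / δ ^ 2 ≤ ⌈remConst κ C R / δ ^ 2⌉₊ := Nat.le_ceil _
  rw [div_le_iff₀ (by positivity)] at hc
  obtain ⟨W, hVW, hW, h⟩ := exists_submodule_kernelForm_le hE (zeroModeSpan (grid n) (cellCount n))
    (B := ⌈remConst κ C R / δ ^ 2⌉₊ * n) (rank_zeroModeSpan_le _ _) (c := δ / n) (by positivity) (by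
      refine hE2.trans ?_
      rw [div_le_iff₀ hn']
      refine hc.trans (le_of_eq ?_)
      push_cast
      field_simp)
  refine ⟨W, hW, fun u hu => ?_⟩
  have hz := zeroMean_of_mem_orthogonal (Submodule.orthogonal_le hVW hu)
  refine ⟨hz, ?_⟩
  rw [kernelForm_jumpKernel hJ hn hz, Complex.add_re, add_sub_cancel_left]
  exact (Complex.abs_re_le_norm _).trans (h u hu)

lemma abs_gridCoef_mul (κ : ℝ) (n j : ℕ) :
    |gridCoef κ n j| * (grid n (j + 1) - grid n j) = |κ| * mesh n := by
  have := grid_nonneg n j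
  rw [gridCoef, grid_succ_sub, abs_div, abs_of_pos (by linarith : 0 < 1 + grid n j)]
  field_simp

lemma mem_orthogonal_of_map_symm (S : L2R ≃ₗᵢ[ℂ] L2R) {V : Submodule ℂ L2R} {u : L2R}
    (hu : u ∈ (V.map S.symm.toLinearEquiv.toLinearMap)ᗮ) : S u ∈ Vᗮ := by
  rw [Submodule.mem_orthogonal] at hu ⊢
  intro v hv
  have h := hu (S.symm v) (Submodule.mem_map_of_mem hv)
  rwa [← S.inner_map_map, S.apply_symm_apply] at h

lemma rank_map_le_natCast (S : L2R ≃ₗᵢ[ℂ] L2R) {V : Submodule ℂ L2R} {r : ℕ}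
    (hV : Module.rank ℂ V ≤ (r : Cardinal)) :
    Module.rank ℂ (V.map S.symm.toLinearEquiv.toLinearMap) ≤ (r : Cardinal) :=
  (rank_map_le _ _).trans hV

lemma tendsto_eigPlus_of_jumpKernel (hJ : JumpKernel κ C R G J) (T : L2R →L[ℂ] L2R)
    (S : L2R ≃ₗᵢ[ℂ] L2R)
    (hT : ∀ u, (⟪T u, u⟫_ℂ).re = (kernelForm (jumpKernel G J) (S u)).re) :
    Tendsto (fun k : ℕ => eigPlus T k * k / Real.log k) atTop (nhds (|κ| / Real.pi)) := by
  refine tendsto_eig_of_mode_bounds _ _ (fun N hN δ hδ => ?_) (fun N hN δ hδ => ?_)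
  · obtain ⟨B, hB⟩ := exists_submodule_jumpKernel_near hJ hδ
    refine ⟨B, fun n hn k hk => ?_⟩
    have hm0 : 0 ≤ Real.exp (1 / n) - 1 := mesh_nonneg n
    obtain ⟨W, hW, h⟩ := hB n hn
    set P := pairSpan (grid n) (gridCoef κ n) (cellCount n) (N - 1) with hP
    refine eigPlus_le T (by positivity) ((W ⊔ P).map S.symm.toLinearEquiv.toLinearMap)
      (rank_map_le_natCast S ?_) fun u hu => ?_
    · refine (Submodule.rank_add_le_rank_add_rank _ _).trans
        ((add_le_add hW (rank_pairSpan_le _ _ _ _)).trans ?_)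
      norm_cast
      refine le_trans (le_of_eq ?_) hk
      obtain ⟨M, rfl⟩ := Nat.exists_eq_add_of_le' hN
      rw [Nat.add_sub_cancel]
      ring
    · have hSu := mem_orthogonal_of_map_symm S hu
      have hSW := Submodule.orthogonal_le le_sup_left hSu
      have hSP := Submodule.orthogonal_le le_sup_right hSu
      obtain ⟨hz, hnear⟩ := h _ hSW
      have hmain := re_mainKernel_le (strictMono_grid hn) (grid_zero n) (gridCoef κ n)
        (q := |κ| * mesh n) (mul_nonneg (abs_nonneg _) (mesh_nonneg n)) (cellCount n)
        (fun j _ => abs_gridCoef_mul κ n j) hN (S u) hz (fun j hj m hm hmN =>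
          inner_pairVec_of_mem_orthogonal hSP hj hm (by omega))
      rw [hT, ← S.norm_map u]
      have := (abs_le.1 hnear).2
      rw [add_mul]
      unfold mesh at hmain
      linarith
  · obtain ⟨B, hB⟩ := exists_submodule_jumpKernel_near hJ hδ
    refine ⟨B, fun n hn k hk => ?_⟩
    obtain ⟨W, hW, h⟩ := hB n hn
    set P := pairSpan (grid n) (gridCoef κ n) (cellCount n) N with hP
    refine le_eigPlus T (P.map S.symm.toLinearEquiv.toLinearMap)
      (W.map S.symm.toLinearEquiv.toLinearMap) (r := 2 * cellCount n + B * n) ?_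
      (rank_map_le_natCast S hW) fun u hu huW => ?_
    · have e := LinearEquiv.finrank_map_eq S.symm.toLinearEquiv P
      have e2 := finrank_pairSpan (strictMono_grid hn) (grid_zero n) (gridCoef κ n) (cellCount n) N
      rw [← hP] at e2
      refine hk.trans_le (le_of_eq ?_)
      refine Eq.trans ?_ e.symm
      rw [e2]
      ring
    · obtain ⟨v, hv, rfl⟩ := hu
      have hSW := mem_orthogonal_of_map_symm S huW
      obtain ⟨hz, hnear⟩ := h _ hSW
      have hmain := (le_re_mainKernel_of_mem_pairSpan (strictMono_grid hn) (grid_zero n)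
        (gridCoef κ n) (q := |κ| * mesh n) (cellCount n)
        (fun j _ => abs_gridCoef_mul κ n j) hN hv).2
      have hSv : S (S.symm.toLinearEquiv.toLinearMap v) = v := S.apply_symm_apply v
      rw [hT, ← S.norm_map (S.symm.toLinearEquiv.toLinearMap v)]
      rw [hSv] at hnear ⊢
      have := (abs_le.1 hnear).1
      rw [sub_mul]
      unfold mesh at hmain
      linarith

end EigenvalueAsymptotics

section Oscillatory

/-- The half-line oscillatory integral truncated to `[0, R]`. -/
def osc (R lam : ℝ) (ψ : ℝ → ℂ) : ℂ :=
  ∫ y in (0 : ℝ)..R, Complex.exp ((lam * y : ℝ) * Complex.I) * ψ y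

lemma continuous_phase (lam : ℝ) :
    Continuous fun y : ℝ => Complex.exp ((lam * y : ℝ) * Complex.I) := by
  fun_prop

lemma hasDerivAt_phase (lam y : ℝ) :
    HasDerivAt (fun y : ℝ => Complex.exp ((lam * y : ℝ) * Complex.I))
    (Complex.exp ((lam * y : ℝ) * Complex.I) * (lam * Complex.I)) y := by
  have h : HasDerivAt (fun y : ℝ => ((lam * y : ℝ) : ℂ) * Complex.I) (lam * Complex.I) y := by
    have := ((hasDerivAt_id y).const_mul lam).ofReal_comp.mul_const Complex.I
    simpa using this
  exact h.cexp

variable {R A lam : ℝ} {ψ ψ' ψ'' : ℝ → ℂ}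

lemma osc_sub (hψ : Continuous ψ) (hψ' : Continuous ψ') :
    osc R lam (fun y => ψ y - ψ' y) = osc R lam ψ - osc R lam ψ' := by
  unfold osc
  rw [← intervalIntegral.integral_sub
    (f := fun y => Complex.exp ((lam * y : ℝ) * Complex.I) * ψ y)
    (g := fun y => Complex.exp ((lam * y : ℝ) * Complex.I) * ψ' y)
    (((continuous_phase lam).mul hψ).intervalIntegrable _ _)
    (((continuous_phase lam).mul hψ').intervalIntegrable _ _)]
  simp only [mul_sub]

lemma norm_osc_le (hR : 0 ≤ R) (hA : ∀ y ∈ Set.Icc 0 R, ‖ψ y‖ ≤ A) : ‖osc R lam ψ‖ ≤ A * R := by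
  have h := intervalIntegral.norm_integral_le_of_norm_le_const (a := (0 : ℝ)) (b := R) (C := A)
    (f := fun y => Complex.exp ((lam * y : ℝ) * Complex.I) * ψ y) (fun y hy => by
      rw [Set.uIoc_of_le hR] at hy
      rw [norm_mul, Complex.norm_exp_ofReal_mul_I, one_mul]
      exact hA y ⟨hy.1.le, hy.2⟩)
  rwa [sub_zero, abs_of_nonneg hR] at h

lemma mul_osc (hd : ∀ y, HasDerivAt ψ (ψ' y) y) (hc : Continuous ψ') (hR : ψ R = 0) :
    lam * Complex.I * osc R lam ψ = -ψ 0 - osc R lam ψ' := by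
  have h := intervalIntegral.integral_mul_deriv_eq_deriv_mul (a := (0 : ℝ)) (b := R)
    (u := ψ) (u' := ψ') (v := fun y : ℝ => Complex.exp ((lam * y : ℝ) * Complex.I))
    (v' := fun y : ℝ => Complex.exp ((lam * y : ℝ) * Complex.I) * (lam * Complex.I))
    (fun y _ => hd y) (fun y _ => hasDerivAt_phase lam y) (hc.intervalIntegrable _ _)
    (((continuous_phase lam).mul continuous_const).intervalIntegrable _ _)
  rw [hR] at h
  simp only [zero_mul, mul_zero, Complex.ofReal_zero, Complex.exp_zero, mul_one, zero_sub] at h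
  unfold osc
  rw [← intervalIntegral.integral_const_mul]
  simp only [mul_comm (Complex.exp _) (ψ' _)]
  rw [← h]
  refine intervalIntegral.integral_congr fun y _ => ?_
  ring

lemma norm_osc_mul_le (hR0 : 0 ≤ R) (hd : ∀ y, HasDerivAt ψ (ψ' y) y) (hc : Continuous ψ')
    (hR : ψ R = 0) (hA : ∀ y ∈ Set.Icc 0 R, ‖ψ y‖ ≤ A) (hA' : ∀ y ∈ Set.Icc 0 R, ‖ψ' y‖ ≤ A) :
    ‖osc R lam ψ‖ * (1 + |lam|) ≤ (1 + 2 * R) * A := by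
  have h1 := norm_osc_le (lam := lam) hR0 hA
  have h2 := norm_osc_le (lam := lam) hR0 hA'
  have h3 : |lam| * ‖osc R lam ψ‖ ≤ A + A * R := by
    have e : ‖lam * Complex.I * osc R lam ψ‖ = |lam| * ‖osc R lam ψ‖ := by
      rw [norm_mul, norm_mul, Complex.norm_I, mul_one, Complex.norm_real, Real.norm_eq_abs]
    rw [← e, mul_osc hd hc hR]
    refine (norm_sub_le _ _).trans ?_
    rw [norm_neg]
    exact add_le_add (hA 0 ⟨le_rfl, hR0⟩) h2
  linarith

/-- A function of two variables, compactly supported in `|y|, |s| < R`, with two bounded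
derivatives in the first variable and Lipschitz dependence on the second one. -/
structure OscData (A R : ℝ) (Φ Φ₁ Φ₂ : ℝ × ℝ → ℂ) : Prop where
  hA : 0 ≤ A
  hR : 0 ≤ R
  cont : Continuous Φ
  cont₁ : Continuous Φ₁
  cont₂ : Continuous Φ₂
  deriv : ∀ y s, HasDerivAt (fun y => Φ (y, s)) (Φ₁ (y, s)) y
  deriv₁ : ∀ y s, HasDerivAt (fun y => Φ₁ (y, s)) (Φ₂ (y, s)) y
  bound : ∀ p, ‖Φ p‖ ≤ A
  bound₁ : ∀ p, ‖Φ₁ p‖ ≤ A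
  bound₂ : ∀ p, ‖Φ₂ p‖ ≤ A
  supp : ∀ p : ℝ × ℝ, R ≤ |p.1| ∨ R ≤ |p.2| → Φ p = 0
  supp₁ : ∀ p : ℝ × ℝ, R ≤ |p.1| ∨ R ≤ |p.2| → Φ₁ p = 0
  lip : ∀ y s s', ‖Φ (y, s) - Φ (y, s')‖ ≤ A * |s - s'|
  lip₁ : ∀ y s s', ‖Φ₁ (y, s) - Φ₁ (y, s')‖ ≤ A * |s - s'|

/-- The oscillatory kernel `∫₀^∞ e^{-2πiτy(w-v)} Φ(y, w+v) dy`. -/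
def oscKernel (R τ : ℝ) (Φ : ℝ × ℝ → ℂ) (p : ℝ × ℝ) : ℂ :=
  osc R (-(2 * Real.pi * τ * (p.1 - p.2))) fun y => Φ (y, p.1 + p.2)

variable {τ : ℝ} {Φ Φ₁ Φ₂ : ℝ × ℝ → ℂ}

lemma continuous_slice (hΦ : Continuous Φ) (s : ℝ) : Continuous fun y => Φ (y, s) :=
  hΦ.comp (by fun_prop)

lemma oscKernel_eq_zero (h : OscData A R Φ Φ₁ Φ₂) {p : ℝ × ℝ} (hp : R < |p.1 + p.2|) :
    oscKernel R τ Φ p = 0 := by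
  unfold oscKernel osc
  rw [← intervalIntegral.integral_zero (E := ℂ) (μ := volume) (a := (0 : ℝ)) (b := R)]
  refine intervalIntegral.integral_congr fun y _ => ?_
  beta_reduce
  rw [h.supp (y, p.1 + p.2) (Or.inr hp.le), mul_zero]

lemma measurable_oscKernel (h : OscData A R Φ Φ₁ Φ₂) : Measurable (oscKernel R τ Φ) := by
  have hc : Continuous (oscKernel R τ Φ) := by
    unfold oscKernel osc
    refine intervalIntegral.continuous_parametric_intervalIntegral_of_continuous' ?_ 0 R
    have := h.cont
    have : Continuous fun q : (ℝ × ℝ) × ℝ => Φ (q.2, q.1.1 + q.1.2) := h.cont.comp (by fun_prop)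
    simp only [Function.uncurry_def]
    exact Continuous.mul (by fun_prop) this
  exact hc.measurable

lemma one_add_abs_le (hR : 0 ≤ R) {w v : ℝ} (hs : |w + v| ≤ R + 2) (hτ : |τ| = 1) :
    1 + |v| ≤ (R + 3) * (1 + |-(2 * Real.pi * τ * (w - v))|) := by
  have h1 : |w - v| ≤ |-(2 * Real.pi * τ * (w - v))| := by
    rw [abs_neg, abs_mul, abs_mul, hτ, mul_one, abs_of_pos (by positivity : 0 < 2 * Real.pi)]
    exact le_mul_of_one_le_left (abs_nonneg _) (by linarith [Real.pi_gt_three])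
  have h2 : 2 * |v| ≤ |w + v| + |w - v| := by
    have := abs_sub (w + v) (w - v)
    rw [show w + v - (w - v) = 2 * v by ring, abs_mul, abs_two] at this
    exact this
  have h3 : 0 ≤ |w - v| := abs_nonneg _
  nlinarith [abs_nonneg v]

lemma norm_oscKernel_le_aux {g g' : ℝ → ℂ} (hR0 : 0 ≤ R) (hτ : |τ| = 1)
    (hd : ∀ y, HasDerivAt g (g' y) y) (hc : Continuous g') (hR : g R = 0)
    (hA : ∀ y ∈ Set.Icc 0 R, ‖g y‖ ≤ A) (hA' : ∀ y ∈ Set.Icc 0 R, ‖g' y‖ ≤ A) {w v : ℝ}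
    (hs : |w + v| ≤ R + 2) :
    ‖osc R (-(2 * Real.pi * τ * (w - v))) g‖ ≤ (R + 3) * ((1 + 2 * R) * A) / (1 + |v|) := by
  rw [le_div_iff₀ (by positivity)]
  calc _ ≤ ‖osc R (-(2 * Real.pi * τ * (w - v))) g‖ *
        ((R + 3) * (1 + |-(2 * Real.pi * τ * (w - v))|)) := by
        gcongr
        exact one_add_abs_le hR0 hs hτ
    _ = (R + 3) * (‖osc R (-(2 * Real.pi * τ * (w - v))) g‖ *
        (1 + |-(2 * Real.pi * τ * (w - v))|)) := by ring
    _ ≤ _ := mul_le_mul_of_nonneg_left (norm_osc_mul_le hR0 hd hc hR hA hA') (by linarith)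

lemma norm_oscKernel_le (h : OscData A R Φ Φ₁ Φ₂) (hτ : |τ| = 1) (p : ℝ × ℝ) :
    ‖oscKernel R τ Φ p‖ ≤ (R + 3) * ((1 + 2 * R) * A) / (1 + |p.2|) := by
  have hA := h.hA
  have hR := h.hR
  by_cases hp : R < |p.1 + p.2|
  · rw [oscKernel_eq_zero h hp, norm_zero]
    positivity
  · exact norm_oscKernel_le_aux h.hR hτ (fun y => h.deriv y _) (continuous_slice h.cont₁ _)
      (h.supp _ (Or.inl (by rw [abs_of_nonneg hR]))) (fun y _ => h.bound _) (fun y _ => h.bound₁ _)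
      (by linarith [not_lt.1 hp])

lemma norm_one_sub_phase_le (μ y : ℝ) (hy : 0 ≤ y) :
    ‖1 - Complex.exp ((μ * y : ℝ) * Complex.I)‖ ≤ |μ| * y := by
  rw [norm_sub_rev, mul_comm _ Complex.I]
  refine (Real.norm_exp_I_mul_ofReal_sub_one_le).trans ?_
  rw [Real.norm_eq_abs, abs_mul, abs_of_nonneg hy]

lemma oscKernel_lip (h : OscData A R Φ Φ₁ Φ₂) (hτ : |τ| = 1) (w v v' : ℝ) (hv : |v - v'| ≤ 2) :
    ‖oscKernel R τ Φ (w, v) - oscKernel R τ Φ (w, v')‖ ≤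
      (R + 3) * ((1 + 2 * R) * (A + 2 * Real.pi * (1 + R) * A)) * |v - v'| / (1 + |v|) := by
  have hA := h.hA
  have hR := h.hR
  by_cases hs : |w + v| ≤ R + 2
  swap
  · have h1 : |w + v| ≤ |w + v'| + |v - v'| := by
      have := abs_add_le (w + v') (v - v')
      rwa [show w + v' + (v - v') = w + v by ring] at this
    rw [oscKernel_eq_zero h (by simp only; linarith), oscKernel_eq_zero h (by simp only; linarith),
      sub_zero, norm_zero]
    positivity
  set μ := 2 * Real.pi * τ * (v' - v) with hμ
  have hμa : |μ| = 2 * Real.pi * |v - v'| := by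
    rw [hμ, abs_mul, abs_mul, hτ, mul_one, abs_of_pos (by positivity), abs_sub_comm]
  have hRR : |R| = R := abs_of_nonneg hR
  have e : oscKernel R τ Φ (w, v) - oscKernel R τ Φ (w, v') =
      osc R (-(2 * Real.pi * τ * (w - v))) (fun y => Φ (y, w + v) - Φ (y, w + v')) +
      osc R (-(2 * Real.pi * τ * (w - v)))
        (fun y => (1 - Complex.exp ((μ * y : ℝ) * Complex.I)) * Φ (y, w + v')) := by
    have c1 := continuous_slice h.cont (w + v)
    have c2 := continuous_slice h.cont (w + v')
    have e2 : osc R (-(2 * Real.pi * τ * (w - v)))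
        (fun y => (1 - Complex.exp ((μ * y : ℝ) * Complex.I)) * Φ (y, w + v')) =
        osc R (-(2 * Real.pi * τ * (w - v))) (fun y => Φ (y, w + v') -
          Complex.exp ((μ * y : ℝ) * Complex.I) * Φ (y, w + v')) := by
      congr 1
      ext y
      ring
    rw [osc_sub c1 c2, e2,
      osc_sub (ψ' := fun y => Complex.exp ((μ * y : ℝ) * Complex.I) * Φ (y, w + v')) c2
      ((continuous_phase μ).mul c2)]
    have e3 : osc R (-(2 * Real.pi * τ * (w - v)))
        (fun y => Complex.exp ((μ * y : ℝ) * Complex.I) * Φ (y, w + v')) =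
        oscKernel R τ Φ (w, v') := by
      unfold oscKernel osc
      refine intervalIntegral.integral_congr fun y _ => ?_
      beta_reduce
      rw [← mul_assoc, ← Complex.exp_add]
      congr 2
      rw [hμ]
      push_cast
      ring
    rw [e3]
    unfold oscKernel
    ring
  have b1 : ‖osc R (-(2 * Real.pi * τ * (w - v))) (fun y => Φ (y, w + v) - Φ (y, w + v'))‖ ≤
      (R + 3) * ((1 + 2 * R) * (A * |v - v'|)) / (1 + |v|) := by
    have hvv : |w + v - (w + v')| = |v - v'| := by rw [add_sub_add_left_eq_sub]
    refine norm_oscKernel_le_aux hR hτ (fun y => (h.deriv y _).sub (h.deriv y _))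
      ((continuous_slice h.cont₁ _).sub (continuous_slice h.cont₁ _)) ?_ (fun y _ => ?_)
      (fun y _ => ?_) hs
    · rw [Pi.sub_apply, h.supp _ (Or.inl hRR.ge), h.supp _ (Or.inl hRR.ge), sub_zero]
    · exact hvv ▸ h.lip y (w + v) (w + v')
    · exact hvv ▸ h.lip₁ y (w + v) (w + v')
  have b2 : ‖osc R (-(2 * Real.pi * τ * (w - v)))
      (fun y => (1 - Complex.exp ((μ * y : ℝ) * Complex.I)) * Φ (y, w + v'))‖ ≤
      (R + 3) * ((1 + 2 * R) * (2 * Real.pi * |v - v'| * (1 + R) * A)) / (1 + |v|) := by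
    have c0 := continuous_phase μ
    refine norm_oscKernel_le_aux hR hτ
      (fun y => ((hasDerivAt_phase μ y).const_sub 1).mul (h.deriv y _))
      (((c0.mul continuous_const).neg.mul (continuous_slice h.cont (w + v'))).add
        ((continuous_const.sub c0).mul (continuous_slice h.cont₁ (w + v'))))
      ?_ (fun y hy => ?_) (fun y hy => ?_) hs
    · rw [Pi.mul_apply, h.supp _ (Or.inl hRR.ge), mul_zero]
    · rw [Pi.mul_apply, norm_mul]
      calc _ ≤ (|μ| * y) * A := mul_le_mul (norm_one_sub_phase_le μ y hy.1) (h.bound _)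
            (norm_nonneg _) (mul_nonneg (abs_nonneg _) hy.1)
        _ ≤ (|μ| * (1 + R)) * A := by
            gcongr
            linarith [hy.2]
        _ = _ := by rw [hμa]
    · refine (norm_add_le _ _).trans ?_
      rw [norm_mul, norm_mul, norm_neg, norm_mul, norm_mul, Complex.norm_exp_ofReal_mul_I,
        Complex.norm_I, Complex.norm_real, Real.norm_eq_abs, one_mul, mul_one]
      calc _ ≤ |μ| * A + (|μ| * R) * A := by
            gcongr
            · exact h.bound _
            · exact (norm_one_sub_phase_le μ y hy.1).trans (by gcongr; exact hy.2)
            · exact h.bound₁ _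
        _ = _ := by rw [hμa]; ring
  rw [e]
  refine (norm_add_le _ _).trans ((add_le_add b1 b2).trans (le_of_eq ?_))
  rw [← add_div]
  ring

lemma oscKernel_jump (h : OscData A R Φ Φ₁ Φ₂) {κ : ℝ} (hκ : Φ (0, 0) = ((4 * Real.pi * κ : ℝ) : ℂ))
    (hκA : |κ| ≤ A) (σ : ℤˣ) {x : ℝ} (hx : 0 < x) :
    ‖oscKernel R 1 Φ (-signMul σ x, signMul σ x) -
      Complex.I * ((((σ : ℤ) : ℝ) * (κ / (1 + x)) : ℝ) : ℂ)‖ ≤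
        4 * (2 + 2 * R) * A / (1 + x) ^ 2 := by
  have hA := h.hA
  have hR := h.hR
  have hπ := Real.pi_pos
  have hRR : |R| = R := abs_of_nonneg hR
  have hσ : |((σ : ℤ) : ℝ)| = 1 := by
    rcases Int.units_eq_one_or σ with e | e <;> subst e <;> simp
  have hσ2 : ((σ : ℤ) : ℂ) * ((σ : ℤ) : ℂ) = 1 := by
    rcases Int.units_eq_one_or σ with e | e <;> subst e <;> simp
  rcases le_or_gt 1 x with h1 | h1
  · set v := signMul σ x with hv
    have hva : |v| = x := by rw [hv, abs_signMul, abs_of_pos hx]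
    have e0 : oscKernel R 1 Φ (-v, v) = osc R (4 * Real.pi * v) fun y => Φ (y, 0) := by
      unfold oscKernel
      congr 1
      · ring
      · simp
    have hm := mul_osc (R := R) (lam := 4 * Real.pi * v) (fun y => h.deriv y 0)
      (continuous_slice h.cont₁ 0) (h.supp (R, 0) (Or.inl hRR.ge))
    have hm2 := norm_osc_mul_le (R := R) (lam := 4 * Real.pi * v) hR (fun y => h.deriv₁ y 0)
      (continuous_slice h.cont₂ 0) (h.supp₁ (R, 0) (Or.inl hRR.ge)) (fun y _ => h.bound₁ _)
      (fun y _ => h.bound₂ _)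
    rw [hκ] at hm
    set r := osc R (4 * Real.pi * v) fun y => Φ₁ (y, 0) with hr
    have hv0 : v ≠ 0 := by
      rw [← abs_pos, hva]
      exact hx
    have hlam : |4 * Real.pi * v| = 4 * Real.pi * x := by
      rw [abs_mul, hva, abs_of_pos (by positivity)]
    have hrx : ‖r‖ * (1 + x) ≤ (1 + 2 * R) * A := by
      refine le_trans ?_ hm2
      gcongr
      rw [hlam]
      nlinarith [Real.pi_gt_three]
    have hvσ : (v : ℂ) = ((σ : ℤ) : ℂ) * x := by rw [hv, signMul_apply]; push_cast; ring
    have hxc : (x : ℂ) ≠ 0 := by exact_mod_cast hx.ne'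
    have hxc1 : (1 + x : ℂ) ≠ 0 := by exact_mod_cast (by linarith : (1 + x : ℝ) ≠ 0)
    have hπc : (Real.pi : ℂ) ≠ 0 := by exact_mod_cast hπ.ne'
    have hosc : oscKernel R 1 Φ (-v, v) =
        Complex.I * ((((σ : ℤ) : ℝ) * (κ / x) : ℝ) : ℂ) +
          Complex.I * ((((σ : ℤ) : ℝ) / (4 * Real.pi * x) : ℝ) : ℂ) * r := by
      rw [e0]
      have hne : (((4 * Real.pi * v : ℝ) : ℂ) * Complex.I) ≠ 0 :=
        mul_ne_zero (by exact_mod_cast (by positivity)) Complex.I_ne_zero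
      apply mul_left_cancel₀ hne
      rw [hm]
      push_cast
      rw [hvσ]
      have hI := Complex.I_mul_I
      field_simp
      linear_combination (-(4 * Real.pi * κ) - r) * (((σ : ℤ) : ℂ) * ((σ : ℤ) : ℂ)) * hI +
        (-1) * (-(4 * Real.pi * κ) - r) * hσ2
    have hsplit : oscKernel R 1 Φ (-v, v) - Complex.I * ((((σ : ℤ) : ℝ) * (κ / (1 + x)) : ℝ) : ℂ) =
        Complex.I * ((((σ : ℤ) : ℝ) * (κ / (x * (1 + x))) : ℝ) : ℂ) +
          Complex.I * ((((σ : ℤ) : ℝ) / (4 * Real.pi * x) : ℝ) : ℂ) * r := by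
      rw [hosc]
      push_cast
      field_simp
      ring
    rw [hsplit]
    refine (norm_add_le _ _).trans ?_
    rw [norm_mul, norm_mul, norm_mul, Complex.norm_I, Complex.norm_real, Complex.norm_real,
      Real.norm_eq_abs, Real.norm_eq_abs, abs_mul, abs_div, abs_div, hσ,
      abs_of_pos (by positivity : 0 < x * (1 + x)),
      abs_of_pos (by positivity : 0 < 4 * Real.pi * x)]
    have hx2 : 1 / (x * (1 + x)) ≤ 2 / (1 + x) ^ 2 := by
      rw [div_le_div_iff₀ (by positivity) (by positivity)]
      nlinarith
    have t1 : |κ| / (x * (1 + x)) ≤ A * (2 / (1 + x) ^ 2) := by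
      calc _ = |κ| * (1 / (x * (1 + x))) := by ring
        _ ≤ _ := by gcongr
    have t2 : 1 / (4 * Real.pi * x) * ‖r‖ ≤ (1 + 2 * R) * A * (2 / (1 + x) ^ 2) := by
      have hr2 : ‖r‖ ≤ (1 + 2 * R) * A / (1 + x) := by
        rwa [le_div_iff₀ (by positivity)]
      calc _ ≤ 1 / x * ((1 + 2 * R) * A / (1 + x)) := by
            gcongr
            nlinarith [Real.pi_gt_three]
        _ = (1 + 2 * R) * A * (1 / (x * (1 + x))) := by field_simp
        _ ≤ _ := by gcongr
    calc _ ≤ A * (2 / (1 + x) ^ 2) + (1 + 2 * R) * A * (2 / (1 + x) ^ 2) := by linarith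
      _ = (2 + 2 * R) * A * 2 / (1 + x) ^ 2 := by ring
      _ ≤ _ := by
        have h0 : 0 ≤ (2 + 2 * R) * A := by positivity
        exact div_le_div_of_nonneg_right (by linarith) (by positivity)
  · have b1 : ‖oscKernel R 1 Φ (-signMul σ x, signMul σ x)‖ ≤ A * R :=
      norm_osc_le hR fun y _ => h.bound _
    have b2 : ‖Complex.I * ((((σ : ℤ) : ℝ) * (κ / (1 + x)) : ℝ) : ℂ)‖ ≤ A := by
      rw [norm_mul, Complex.norm_I, one_mul, Complex.norm_real, Real.norm_eq_abs, abs_mul, hσ,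
        one_mul, abs_div, abs_of_pos (by linarith : 0 < 1 + x)]
      exact (div_le_self (abs_nonneg _) (by linarith)).trans hκA
    refine (norm_sub_le _ _).trans ((add_le_add b1 b2).trans ?_)
    rw [le_div_iff₀ (by positivity)]
    have : (1 + x) ^ 2 ≤ 4 := by nlinarith
    calc _ ≤ (A * R + A) * 4 := by gcongr
      _ ≤ _ := by nlinarith [mul_nonneg hR hA]

end Oscillatory

section OscDataExists

lemma OscData.mono {A A' R R' : ℝ} {Φ Φ₁ Φ₂ : ℝ × ℝ → ℂ} (h : OscData A R Φ Φ₁ Φ₂) (hA : A ≤ A')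
    (hR : R ≤ R') : OscData A' R' Φ Φ₁ Φ₂ where
  hA := h.hA.trans hA
  hR := h.hR.trans hR
  cont := h.cont
  cont₁ := h.cont₁
  cont₂ := h.cont₂
  deriv := h.deriv
  deriv₁ := h.deriv₁
  bound p := (h.bound p).trans hA
  bound₁ p := (h.bound₁ p).trans hA
  bound₂ p := (h.bound₂ p).trans hA
  supp p hp := h.supp p (hp.imp hR.trans hR.trans)
  supp₁ p hp := h.supp₁ p (hp.imp hR.trans hR.trans)
  lip y s s' := (h.lip y s s').trans (by gcongr)
  lip₁ y s s' := (h.lip₁ y s s').trans (by gcongr)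

lemma exists_bounds_of_contDiff {Ψ : ℝ × ℝ → ℂ} (hΨ : ContDiff ℝ (⊤ : ℕ∞) Ψ)
    (hs : HasCompactSupport Ψ) : ∃ A : ℝ, (∀ p, ‖Ψ p‖ ≤ A) ∧
      ∀ y s s', ‖Ψ (y, s) - Ψ (y, s')‖ ≤ A * |s - s'| := by
  obtain ⟨M, hM⟩ := hs.exists_bound_of_continuous hΨ.continuous
  obtain ⟨L, hL⟩ := hΨ.lipschitzWith_of_hasCompactSupport hs (by simp)
  refine ⟨max M L, fun p => (hM p).trans (le_max_left _ _), fun y s s' => ?_⟩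
  refine (hL.norm_sub_le (y, s) (y, s')).trans ?_
  have : ‖((y, s) : ℝ × ℝ) - (y, s')‖ = |s - s'| := by
    rw [Prod.mk_sub_mk, sub_self, Prod.norm_mk, norm_zero, max_eq_right (norm_nonneg _),
      Real.norm_eq_abs]
  rw [this]
  gcongr
  exact le_max_right _ _

lemma exists_support_bound {Ψ : ℝ × ℝ → ℂ} (hs : HasCompactSupport Ψ) :
    ∃ R : ℝ, ∀ p : ℝ × ℝ, R ≤ |p.1| ∨ R ≤ |p.2| → Ψ p = 0 := by
  obtain ⟨R, hR⟩ := hs.isCompact.isBounded.exists_norm_le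
  refine ⟨R + 1, fun p hp => ?_⟩
  by_contra hne
  have h := hR p (subset_tsupport _ hne)
  have h1 := (norm_fst_le p).trans h
  have h2 := (norm_snd_le p).trans h
  rw [Real.norm_eq_abs] at h1 h2
  rcases hp with hp | hp <;> linarith

lemma hasDerivAt_slice {Ψ : ℝ × ℝ → ℂ} (hΨ : ContDiff ℝ (⊤ : ℕ∞) Ψ) (y s : ℝ) :
    HasDerivAt (fun y => Ψ (y, s)) (fderiv ℝ Ψ (y, s) (1, 0)) y :=
  ((hΨ.differentiable (by simp)) (y, s)).hasFDerivAt.comp_hasDerivAt y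
    ((hasDerivAt_id y).prodMk (hasDerivAt_const y s))

lemma contDiff_fderiv_apply {Ψ : ℝ × ℝ → ℂ} (hΨ : ContDiff ℝ (⊤ : ℕ∞) Ψ) :
    ContDiff ℝ (⊤ : ℕ∞) fun p => fderiv ℝ Ψ p (1, 0) :=
  (hΨ.fderiv_right (m := (⊤ : ℕ∞)) (by simp)).clm_apply contDiff_const

lemma exists_oscData {Φ : ℝ × ℝ → ℂ} (hΦ : ContDiff ℝ (⊤ : ℕ∞) Φ) (hs : HasCompactSupport Φ) :
    ∃ A R Φ₁ Φ₂, OscData A R Φ Φ₁ Φ₂ := by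
  set Φ₁ : ℝ × ℝ → ℂ := fun p => fderiv ℝ Φ p (1, 0) with hΦ₁
  set Φ₂ : ℝ × ℝ → ℂ := fun p => fderiv ℝ Φ₁ p (1, 0) with hΦ₂
  have c1 : ContDiff ℝ (⊤ : ℕ∞) Φ₁ := contDiff_fderiv_apply hΦ
  have c2 : ContDiff ℝ (⊤ : ℕ∞) Φ₂ := contDiff_fderiv_apply c1
  have s1 : HasCompactSupport Φ₁ := hs.fderiv_apply ℝ _
  have s2 : HasCompactSupport Φ₂ := s1.fderiv_apply ℝ _
  obtain ⟨A0, b0, l0⟩ := exists_bounds_of_contDiff hΦ hs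
  obtain ⟨A1, b1, l1⟩ := exists_bounds_of_contDiff c1 s1
  obtain ⟨A2, b2, -⟩ := exists_bounds_of_contDiff c2 s2
  obtain ⟨R0, r0⟩ := exists_support_bound hs
  obtain ⟨R1, r1⟩ := exists_support_bound s1
  have p0 : 0 ≤ |A0| := abs_nonneg _
  have p1 : 0 ≤ |A1| := abs_nonneg _
  have p2 : 0 ≤ |A2| := abs_nonneg _
  have q0 : 0 ≤ |R0| := abs_nonneg _
  have q1 : 0 ≤ |R1| := abs_nonneg _
  have a0 : A0 ≤ |A0| + |A1| + |A2| := by linarith [le_abs_self A0]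
  have a1 : A1 ≤ |A0| + |A1| + |A2| := by linarith [le_abs_self A1]
  have a2 : A2 ≤ |A0| + |A1| + |A2| := by linarith [le_abs_self A2]
  have d0 : R0 ≤ |R0| + |R1| := by linarith [le_abs_self R0]
  have d1 : R1 ≤ |R0| + |R1| := by linarith [le_abs_self R1]
  exact ⟨|A0| + |A1| + |A2|, |R0| + |R1|, Φ₁, Φ₂,
    { hA := by positivity
      hR := by positivity
      cont := hΦ.continuous
      cont₁ := c1.continuous
      cont₂ := c2.continuous
      deriv := hasDerivAt_slice hΦ
      deriv₁ := hasDerivAt_slice c1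
      bound := fun p => (b0 p).trans a0
      bound₁ := fun p => (b1 p).trans a1
      bound₂ := fun p => (b2 p).trans a2
      supp := fun p hp => r0 p (hp.imp d0.trans d0.trans)
      supp₁ := fun p hp => r1 p (hp.imp d1.trans d1.trans)
      lip := fun y s s' => (l0 y s s').trans (by gcongr)
      lip₁ := fun y s s' => (l1 y s s').trans (by gcongr) }⟩

/-- Assembling a jump kernel out of a smooth kernel and an oscillatory one. -/
lemma jumpKernel_of_oscData {A R κ : ℝ} {Φ Φ₁ Φ₂ Ψ Ψ₁ Ψ₂ : ℝ × ℝ → ℂ}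
    (hΦ : OscData A R Φ Φ₁ Φ₂) (hΨ : OscData A R Ψ Ψ₁ Ψ₂)
    (hκ : Φ (0, 0) = ((4 * Real.pi * κ : ℝ) : ℂ)) :
    ∃ C, JumpKernel κ C R (oscKernel R (-1) Ψ) (oscKernel R 1 Φ) := by
  have hA := hΦ.hA
  have hR := hΦ.hR
  have hπ := Real.pi_pos
  have hκA : |κ| ≤ A := by
    have h := hΦ.bound (0, 0)
    rw [hκ, Complex.norm_real, Real.norm_eq_abs, abs_mul,
      abs_of_pos (by positivity : 0 < 4 * Real.pi)] at h
    nlinarith [abs_nonneg κ, Real.pi_gt_three]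
  set C₁ := (R + 3) * ((1 + 2 * R) * A)
  set C₂ := (R + 3) * ((1 + 2 * R) * (A + 2 * Real.pi * (1 + R) * A))
  set C₃ := 4 * (2 + 2 * R) * A
  have h1 : 0 ≤ C₁ := by positivity
  have h2 : 0 ≤ C₂ := by positivity
  have h3 : 0 ≤ C₃ := by positivity
  have e1 : C₁ ≤ C₁ + C₂ + C₃ := by linarith
  have e2 : C₂ ≤ C₁ + C₂ + C₃ := by linarith
  have e3 : C₃ ≤ C₁ + C₂ + C₃ := by linarith
  exact ⟨C₁ + C₂ + C₃,
    { hC := by positivity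
      hR := hR
      measurable_G := measurable_oscKernel hΨ
      measurable_J := measurable_oscKernel hΦ
      bound_G := fun p => (norm_oscKernel_le hΨ (by simp) p).trans (by gcongr)
      bound_J := fun p => (norm_oscKernel_le hΦ (by simp) p).trans (by gcongr)
      supp_G := fun p hp => oscKernel_eq_zero hΨ hp
      supp_J := fun p hp => oscKernel_eq_zero hΦ hp
      lip_G := fun w v v' hv => (oscKernel_lip hΨ (by simp) w v v' hv).trans (by gcongr)
      lip_J := fun w v v' hv => (oscKernel_lip hΦ (by simp) w v v' hv).trans (by gcongr)
      jump := fun σ x hx => (oscKernel_jump hΦ hκ hκA σ hx).trans (by gcongr) }⟩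

/-- On both sides of the jump the kernel is oscillatory, for any pair of smooth profiles. -/
lemma exists_jumpKernel {κ : ℝ} {Φ Ψ : ℝ × ℝ → ℂ} (hΦ : ContDiff ℝ (⊤ : ℕ∞) Φ)
    (hsΦ : HasCompactSupport Φ) (hΨ : ContDiff ℝ (⊤ : ℕ∞) Ψ) (hsΨ : HasCompactSupport Ψ)
    (hκ : Φ (0, 0) = ((4 * Real.pi * κ : ℝ) : ℂ)) :
    ∃ C R, JumpKernel κ C R (oscKernel R (-1) Ψ) (oscKernel R 1 Φ) ∧
      ∀ p : ℝ × ℝ, R ≤ |p.1| → Φ p = 0 ∧ Ψ p = 0 := by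
  obtain ⟨A, R, Φ₁, Φ₂, h⟩ := exists_oscData hΦ hsΦ
  obtain ⟨A', R', Ψ₁, Ψ₂, h'⟩ := exists_oscData hΨ hsΨ
  have g := h.mono (le_max_left A A') (le_max_left R R')
  have g' := h'.mono (le_max_right A A') (le_max_right R R')
  obtain ⟨C, hC⟩ := jumpKernel_of_oscData g g' hκ
  exact ⟨C, _, hC, fun p hp => ⟨g.supp p (Or.inl hp), g'.supp p (Or.inl hp)⟩⟩

end OscDataExists

section Wigner

open scoped FourierTransform SchwartzMap ComplexConjugate

/-- The function `e^{irI}` for real `r`. -/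
def unitExp (r : ℝ) : ℂ := Complex.exp ((r : ℂ) * Complex.I)

@[simp] lemma norm_unitExp (r : ℝ) : ‖unitExp r‖ = 1 := Complex.norm_exp_ofReal_mul_I r

lemma unitExp_add (r s : ℝ) : unitExp (r + s) = unitExp r * unitExp s := by
  rw [unitExp, unitExp, unitExp, ← Complex.exp_add]
  congr 1
  push_cast
  ring

lemma conj_unitExp (r : ℝ) : conj (unitExp r) = unitExp (-r) := by
  rw [unitExp, unitExp, ← Complex.exp_conj]
  congr 1
  simp

lemma unitExp_mul_conj (r : ℝ) : unitExp r * conj (unitExp r) = 1 := by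
  rw [conj_unitExp, ← unitExp_add, add_neg_cancel, unitExp]
  simp

@[fun_prop] lemma continuous_unitExp : Continuous unitExp := by
  unfold unitExp
  fun_prop

lemma fourier_eq_unitExp (f : ℝ → ℂ) (w : ℝ) :
    𝓕 f w = ∫ x, unitExp (-2 * Real.pi * (x * w)) * f x := by
  rw [Real.fourier_real_eq_integral_exp_smul]
  refine integral_congr_ae (ae_of_all _ fun x => ?_)
  beta_reduce
  rw [smul_eq_mul, unitExp]
  congr 3
  push_cast
  ring

lemma fourier_conj_fourier (u : 𝓢(ℝ, ℂ)) (x : ℝ) :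
    𝓕 (fun η => conj (𝓕 u η)) x = conj (u x) := by
  have h : 𝓕⁻ (𝓕 (u : ℝ → ℂ)) x = u x := by
    have := congrArg (fun f : 𝓢(ℝ, ℂ) => f x)
      (FourierTransform.fourierInv_fourier_eq (F := 𝓢(ℝ, ℂ)) u)
    rwa [SchwartzMap.fourierInv_coe, SchwartzMap.fourier_coe] at this
  rw [← h, Real.fourierInv_eq_fourier_neg, fourier_eq_unitExp, fourier_eq_unitExp, ← integral_conj]
  refine integral_congr_ae (ae_of_all _ fun y => ?_)
  beta_reduce
  rw [map_mul, conj_unitExp, SchwartzMap.fourier_coe]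
  congr 2
  ring

lemma integral_mul_conj_eq_fourier {g : ℝ → ℂ} (hg : Integrable g) (u : 𝓢(ℝ, ℂ)) :
    ∫ x, g x * conj (u x) = ∫ ζ, 𝓕 g ζ * conj (𝓕 u ζ) := by
  have hi : Integrable fun η => conj (𝓕 u η) :=
    (LinearIsometryEquiv.integrable_comp_iff Complex.conjLIE).2 (𝓕 u).integrable
  have := VectorFourier.integral_fourierIntegral_smul_eq_flip (L := innerₗ ℝ)
    (μ := volume) (ν := volume) Real.continuous_fourierChar continuous_inner hg hi
  rw [flip_innerₗ] at this
  simp only [← fourier_conj_fourier u]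
  exact this.symm

lemma fourier_reflect (u : 𝓢(ℝ, ℂ)) (s w ζ : ℝ) :
    𝓕 (fun x => unitExp (4 * Real.pi * ((x - s) * w)) * u (2 * s - x)) ζ =
      unitExp (4 * Real.pi * (s * (w - ζ))) * 𝓕 u (2 * w - ζ) := by
  rw [fourier_eq_unitExp, SchwartzMap.fourier_coe, fourier_eq_unitExp, ← integral_const_mul,
    ← integral_sub_left_eq_self _ volume (2 * s)]
  refine integral_congr_ae (ae_of_all _ fun y => ?_)
  beta_reduce
  rw [← mul_assoc (unitExp _), ← mul_assoc (unitExp _), ← unitExp_add, ← unitExp_add,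
    sub_sub_cancel]
  congr 2
  ring

lemma wigner_fourier (u : 𝓢(ℝ, ℂ)) (s w : ℝ) :
    ∫ x, unitExp (4 * Real.pi * ((x - s) * w)) * u (2 * s - x) * conj (u x) =
      ∫ ζ, unitExp (4 * Real.pi * (s * (w - ζ))) * 𝓕 u (2 * w - ζ) * conj (𝓕 u ζ) := by
  have hg : Integrable fun x => unitExp (4 * Real.pi * ((x - s) * w)) * u (2 * s - x) := by
    refine (u.integrable.comp_sub_left (2 * s)).bdd_mul (c := 1) ?_ (ae_of_all _ fun x => by simp)
    exact (by fun_prop : Continuous fun x =>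
      unitExp (4 * Real.pi * ((x - s) * w))).aestronglyMeasurable
  rw [integral_mul_conj_eq_fourier hg]
  simp only [fourier_reflect]

end Wigner

section WeylForm

open scoped FourierTransform SchwartzMap ComplexConjugate

lemma integrable_bounded_mul_tensor {g : ℝ → ℂ} {b : ℝ × ℝ → ℂ} {m : ℝ × (ℝ × ℝ) → ℂ} {c : ℝ}
    (hg : Integrable g) (hb : Integrable b) (hm : Continuous m) (hc : ∀ q, ‖m q‖ ≤ c) :
    Integrable fun q : ℝ × (ℝ × ℝ) => m q * (g q.1 * b q.2) :=
  (hg.mul_prod hb).bdd_mul hm.aestronglyMeasurable (ae_of_all _ hc)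

lemma integrable_bounded_mul_section {b : ℝ × ℝ → ℂ} {m : ℝ × (ℝ × ℝ) → ℂ} {c : ℝ}
    (hb : Integrable b) (hm : Continuous m) (hc : ∀ q, ‖m q‖ ≤ c) (x : ℝ) :
    Integrable fun q : ℝ × ℝ => m (x, q) * b q :=
  hb.bdd_mul (hm.comp (by fun_prop)).aestronglyMeasurable (ae_of_all _ fun q => hc (x, q))

lemma integral_iterated_eq_prod {g : ℝ → ℂ} {b : ℝ × ℝ → ℂ} {m : ℝ × (ℝ × ℝ) → ℂ} {c : ℝ}
    (hg : Integrable g) (hb : Integrable b) (hm : Continuous m) (hc : ∀ q, ‖m q‖ ≤ c) :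
    ∫ x, (∫ w, ∫ s, m (x, (w, s)) * b (w, s)) * g x =
      ∫ q : ℝ × ℝ, b q * ∫ x, m (x, q) * g x := by
  have h1 : ∀ x, (∫ w, ∫ s, m (x, (w, s)) * b (w, s)) * g x =
      ∫ q : ℝ × ℝ, m (x, q) * (g x * b q) := by
    intro x
    have h := integral_prod _ (integrable_bounded_mul_section hb hm hc x)
    rw [← Measure.volume_eq_prod] at h
    rw [← h, ← integral_mul_const]
    refine integral_congr_ae (ae_of_all _ fun q => ?_)
    ring
  have h2 : ∀ q : ℝ × ℝ, b q * ∫ x, m (x, q) * g x = ∫ x, m (x, q) * (g x * b q) := by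
    intro q
    rw [← integral_const_mul]
    refine integral_congr_ae (ae_of_all _ fun q => ?_)
    ring
  simp only [h1, h2]
  exact integral_integral_swap (f := fun x q => m (x, q) * (g x * b q))
    (integrable_bounded_mul_tensor hg hb hm hc)

lemma weylIntegral_eq (a : ℝ × ℝ → ℂ) (u : ℝ → ℂ) (x : ℝ) :
    weylIntegral a u x = 2 * ∫ w : ℝ, ∫ s : ℝ,
      unitExp (4 * Real.pi * ((x - s) * w)) * u (2 * s - x) * a (s, 2 * Real.pi * w) := by
  have hπ : (0 : ℝ) < 2 * Real.pi := by positivity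
  have h1 : ∀ ξ : ℝ,
      ∫ y : ℝ, Complex.exp (Complex.I * ((x - y) * ξ : ℝ)) * a ((x + y) / 2, ξ) * u y =
      2 * ∫ s : ℝ, Complex.exp (Complex.I * ((x - (2 * s - x)) * ξ : ℝ)) * a (s, ξ) *
        u (2 * s - x) := by
    intro ξ
    set F : ℝ → ℂ := fun y => Complex.exp (Complex.I * ((x - y) * ξ : ℝ)) * a ((x + y) / 2, ξ) * u y
      with hF
    have e := Measure.integral_comp_mul_left (fun t => F (t - x)) 2
    rw [integral_sub_right_eq_self F x] at e
    have e' : ∫ s : ℝ, Complex.exp (Complex.I * ((x - (2 * s - x)) * ξ : ℝ)) * a (s, ξ) *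
        u (2 * s - x) = ∫ s : ℝ, F (2 * s - x) := by
      refine integral_congr_ae (ae_of_all _ fun s => ?_)
      simp only [hF]
      congr 4
      ring
    rw [e', e, abs_of_pos (by norm_num), Complex.real_smul]
    push_cast
    ring
  unfold weylIntegral
  simp only [h1]
  rw [integral_const_mul]
  have e := Measure.integral_comp_mul_left (fun ξ : ℝ => ∫ s : ℝ,
    Complex.exp (Complex.I * ((x - (2 * s - x)) * ξ : ℝ)) * a (s, ξ) * u (2 * s - x)) (2 * Real.pi)
  rw [abs_of_pos (by positivity), Complex.real_smul] at e
  have e2 : ∫ w : ℝ, ∫ s : ℝ,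
      unitExp (4 * Real.pi * ((x - s) * w)) * u (2 * s - x) * a (s, 2 * Real.pi * w) =
      ∫ w : ℝ, ∫ s : ℝ, Complex.exp (Complex.I * ((x - (2 * s - x)) * (2 * Real.pi * w) : ℝ)) *
        a (s, 2 * Real.pi * w) * u (2 * s - x) := by
    refine integral_congr_ae (ae_of_all _ fun w => integral_congr_ae (ae_of_all _ fun s => ?_))
    beta_reduce
    rw [unitExp, mul_right_comm]
    congr 3
    push_cast
    ring
  rw [e2, e]
  ring

/-- The kernel of the Weyl operator after Fourier transform. -/
def weylKernel (a : ℝ × ℝ → ℂ) (p : ℝ × ℝ) : ℂ :=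
  ∫ s : ℝ, unitExp (-2 * Real.pi * (s * (p.1 - p.2))) * a (s, Real.pi * (p.1 + p.2))

lemma SchwartzMap.norm_apply_le_norm (u : 𝓢(ℝ, ℂ)) : ∃ c, ∀ x, ‖u x‖ ≤ c :=
  ⟨_, u.toBoundedContinuousFunction.norm_coe_le_norm⟩

lemma weylForm_eq {a : ℝ × ℝ → ℂ} (ha : Integrable fun q : ℝ × ℝ => a (q.2, 2 * Real.pi * q.1))
    (u : 𝓢(ℝ, ℂ)) :
    ∫ x, weylIntegral a u x * conj (u x) =
      ∫ w, ∫ v, weylKernel a (w, v) * (𝓕 u v * conj (𝓕 u w)) := by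
  have hu : Integrable fun x => conj (u x) :=
    (LinearIsometryEquiv.integrable_comp_iff Complex.conjLIE).2 u.integrable
  have hû : Integrable fun x => conj (𝓕 u x) :=
    (LinearIsometryEquiv.integrable_comp_iff Complex.conjLIE).2 (𝓕 u).integrable
  obtain ⟨c, hc⟩ := SchwartzMap.norm_apply_le_norm u
  obtain ⟨d, hd⟩ := SchwartzMap.norm_apply_le_norm (𝓕 u)
  set m₁ : ℝ × (ℝ × ℝ) → ℂ := fun q =>
    unitExp (4 * Real.pi * ((q.1 - q.2.2) * q.2.1)) * u (2 * q.2.2 - q.1) with hm₁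
  set m₂ : ℝ × (ℝ × ℝ) → ℂ := fun q =>
    unitExp (4 * Real.pi * (q.2.2 * (q.2.1 - q.1))) * 𝓕 u (2 * q.2.1 - q.1) with hm₂
  have c1 : Continuous m₁ := (by fun_prop : Continuous fun q : ℝ × (ℝ × ℝ) =>
    unitExp (4 * Real.pi * ((q.1 - q.2.2) * q.2.1))).mul (u.continuous.comp (by fun_prop))
  have c2 : Continuous m₂ := (by fun_prop : Continuous fun q : ℝ × (ℝ × ℝ) =>
    unitExp (4 * Real.pi * (q.2.2 * (q.2.1 - q.1)))).mul ((𝓕 u).continuous.comp (by fun_prop))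
  have b1 : ∀ q, ‖m₁ q‖ ≤ c := fun q => by
    rw [hm₁, norm_mul, norm_unitExp, one_mul]
    exact hc _
  have b2 : ∀ q, ‖m₂ q‖ ≤ d := fun q => by
    rw [hm₂, norm_mul, norm_unitExp, one_mul]
    exact hd _
  have i1 := integral_iterated_eq_prod hu ha c1 b1
  have i2 := integral_iterated_eq_prod hû ha c2 b2
  have key : ∫ x, (∫ w, ∫ s, m₁ (x, (w, s)) * a (s, 2 * Real.pi * w)) * conj (u x) =
      ∫ ζ, (∫ w, ∫ s, m₂ (ζ, (w, s)) * a (s, 2 * Real.pi * w)) * conj (𝓕 u ζ) := by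
    rw [i1, i2]
    refine integral_congr_ae (ae_of_all _ fun q => ?_)
    beta_reduce
    congr 1
    exact wigner_fourier u q.2 q.1
  have l1 : ∀ x, weylIntegral a u x * conj (u x) =
      2 * ((∫ w, ∫ s, m₁ (x, (w, s)) * a (s, 2 * Real.pi * w)) * conj (u x)) := by
    intro x
    rw [weylIntegral_eq, mul_assoc]
  have l2 : ∀ ζ, ∫ v, weylKernel a (ζ, v) * (𝓕 u v * conj (𝓕 u ζ)) =
      2 * ((∫ w, ∫ s, m₂ (ζ, (w, s)) * a (s, 2 * Real.pi * w)) * conj (𝓕 u ζ)) := by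
    intro ζ
    set F : ℝ → ℂ := fun v => weylKernel a (ζ, v) * (𝓕 u v * conj (𝓕 u ζ)) with hF
    have e := Measure.integral_comp_mul_left (fun t => F (t - ζ)) 2
    rw [integral_sub_right_eq_self F ζ, abs_of_pos (by norm_num), Complex.real_smul] at e
    have e2 : ∫ w : ℝ, F (2 * w - ζ) =
        (∫ w, ∫ s, m₂ (ζ, (w, s)) * a (s, 2 * Real.pi * w)) * conj (𝓕 u ζ) := by
      rw [← integral_mul_const]
      refine integral_congr_ae (ae_of_all _ fun w => ?_)
      simp only [hF, hm₂, weylKernel]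
      rw [← integral_mul_const, ← integral_mul_const]
      refine integral_congr_ae (ae_of_all _ fun s => ?_)
      beta_reduce
      rw [show Real.pi * (ζ + (2 * w - ζ)) = 2 * Real.pi * w by ring,
        show -2 * Real.pi * (s * (ζ - (2 * w - ζ))) = 4 * Real.pi * (s * (w - ζ)) by ring]
      ring
    rw [← e2, e]
    push_cast
    ring
  simp only [l1, l2]
  rw [integral_const_mul, integral_const_mul, key]

end WeylForm

section Sector

open scoped ComplexConjugate

lemma measurable_arg2pi : Measurable arg2pi := by
  unfold arg2pi
  exact Measurable.ite (measurableSet_le measurable_const Complex.measurable_arg)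
    Complex.measurable_arg (Complex.measurable_arg.add_const _)

lemma measurableSet_sector (θ : ℝ) : MeasurableSet (sector θ) := by
  have h : Measurable fun p : ℝ × ℝ => arg2pi (p.1 + p.2 * Complex.I) :=
    measurable_arg2pi.comp (by fun_prop)
  exact (measurableSet_lt measurable_const h).inter (measurableSet_lt h measurable_const)

lemma norm_mul_sin_sub_arg2pi (θ : ℝ) (z : ℂ) :
    ‖z‖ * Real.sin (θ - arg2pi z) = Real.sin θ * z.re - Real.cos θ * z.im := by
  have h1 : Real.sin (arg2pi z) = Real.sin z.arg := by
    unfold arg2pi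
    split_ifs
    · rfl
    · exact Real.sin_add_two_pi _
  have h2 : Real.cos (arg2pi z) = Real.cos z.arg := by
    unfold arg2pi
    split_ifs
    · rfl
    · exact Real.cos_add_two_pi _
  rw [Real.sin_sub, h1, h2, mul_sub, mul_left_comm, Complex.norm_mul_cos_arg, mul_left_comm,
    Complex.norm_mul_sin_arg]

lemma arg2pi_of_im_pos {z : ℂ} (hz : 0 < z.im) : arg2pi z ∈ Set.Ioo 0 Real.pi := by
  have h0 : 0 ≤ z.arg := Complex.arg_nonneg_iff.2 hz.le
  have h1 : z.arg ≠ 0 := fun h => hz.ne' (Complex.arg_eq_zero_iff.1 h).2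
  have h2 : z.arg ≠ Real.pi := fun h => hz.ne' (Complex.arg_eq_pi_iff.1 h).2
  rw [arg2pi, if_pos h0]
  exact ⟨lt_of_le_of_ne h0 h1.symm, lt_of_le_of_ne (Complex.arg_le_pi z) h2⟩

lemma arg2pi_of_im_neg {z : ℂ} (hz : z.im < 0) :
    arg2pi z ∈ Set.Ioo Real.pi (2 * Real.pi) := by
  have h0 : z.arg < 0 := Complex.arg_neg_iff.2 hz
  rw [arg2pi, if_neg (not_le.2 h0)]
  exact ⟨by linarith [Complex.neg_pi_lt_arg z], by linarith⟩

lemma arg2pi_lt_iff {θ : ℝ} {z : ℂ} (hz : z ≠ 0) (h1 : -Real.pi < θ - arg2pi z)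
    (h2 : θ - arg2pi z < Real.pi) :
    arg2pi z < θ ↔ 0 < Real.sin θ * z.re - Real.cos θ * z.im := by
  rw [← norm_mul_sin_sub_arg2pi, mul_pos_iff_of_pos_left (norm_pos_iff.2 hz)]
  constructor
  · intro h
    exact Real.sin_pos_of_pos_of_lt_pi (by linarith) h2
  · intro h
    by_contra hn
    exact absurd h (not_lt.2 (Real.sin_nonpos_of_nonpos_of_neg_pi_le (by linarith) h1.le))

lemma ne_zero_of_im {x ξ : ℝ} (hξ : ξ ≠ 0) : (x + ξ * Complex.I : ℂ) ≠ 0 := fun h =>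
  hξ (by simpa using congrArg Complex.im h)

section

variable {θ x ξ : ℝ}

lemma mem_sector_of_lt_pi (hθ : θ ∈ Set.Ioo 0 Real.pi) (hξ : 0 < ξ) :
    (x, ξ) ∈ sector θ ↔ Real.cos θ / Real.sin θ * ξ < x := by
  have him : (x + ξ * Complex.I : ℂ).im = ξ := by simp
  have hre : (x + ξ * Complex.I : ℂ).re = x := by simp
  have h := arg2pi_of_im_pos (z := x + ξ * Complex.I) (by rwa [him])
  have hs := Real.sin_pos_of_pos_of_lt_pi hθ.1 hθ.2
  have e := arg2pi_lt_iff (θ := θ) (ne_zero_of_im (x := x) hξ.ne') (by linarith [h.2, hθ.1])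
    (by linarith [h.1, hθ.2])
  rw [him, hre] at e
  rw [sector, Set.mem_ofPred_eq]
  rw [and_iff_right h.1, e, div_mul_eq_mul_div, div_lt_iff₀ hs, sub_pos, mul_comm x]

lemma not_mem_sector_of_lt_pi (hθ : θ ∈ Set.Ioo 0 Real.pi) (hξ : ξ < 0) : (x, ξ) ∉ sector θ := by
  have h := arg2pi_of_im_neg (z := x + ξ * Complex.I) (by simpa using hξ)
  intro hm
  linarith [hm.2, h.1, hθ.2]

lemma mem_sector_of_pi_lt (hθ : θ ∈ Set.Ioo Real.pi (2 * Real.pi)) (hξ : 0 < ξ) :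
    (x, ξ) ∈ sector θ := by
  have h := arg2pi_of_im_pos (z := x + ξ * Complex.I) (by simpa using hξ)
  exact ⟨h.1, h.2.trans hθ.1⟩

lemma mem_sector_of_pi_lt_of_neg (hθ : θ ∈ Set.Ioo Real.pi (2 * Real.pi)) (hξ : ξ < 0) :
    (x, ξ) ∈ sector θ ↔ x < Real.cos θ / Real.sin θ * ξ := by
  have him : (x + ξ * Complex.I : ℂ).im = ξ := by simp
  have hre : (x + ξ * Complex.I : ℂ).re = x := by simp
  have h := arg2pi_of_im_neg (z := x + ξ * Complex.I) (by rwa [him])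
  have hs : Real.sin θ < 0 := by
    have := Real.sin_pos_of_pos_of_lt_pi (x := θ - Real.pi) (by linarith [hθ.1])
        (by linarith [hθ.2])
    rw [Real.sin_sub_pi] at this
    linarith
  have e := arg2pi_lt_iff (θ := θ) (ne_zero_of_im (x := x) hξ.ne) (by linarith [h.2, hθ.1])
    (by linarith [h.1, hθ.2])
  rw [him, hre] at e
  rw [sector, Set.mem_ofPred_eq]
  rw [and_iff_right (Real.pi_pos.trans h.1), e, div_mul_eq_mul_div, lt_div_iff_of_neg hs, sub_pos,
    mul_comm x]

end

end Sector

section Kernel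

open scoped ComplexConjugate

/-- The quadratic phase straightening the slanted edge of the sector. -/
def chirp (c w : ℝ) : ℂ := unitExp (-2 * Real.pi ^ 2 * c * w ^ 2)

lemma weylKernel_shift (a : ℝ × ℝ → ℂ) (c w v : ℝ) :
    weylKernel a (w, v) = chirp c w * conj (chirp c v) *
      ∫ y : ℝ, unitExp (-(2 * Real.pi * (w - v)) * y) *
        a (y + Real.pi * c * (w + v), Real.pi * (w + v)) := by
  rw [weylKernel, ← integral_add_right_eq_self _ (Real.pi * c * (w + v)), ← integral_const_mul]
  refine integral_congr_ae (ae_of_all _ fun y => ?_)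
  beta_reduce
  rw [chirp, chirp, conj_unitExp, ← unitExp_add, ← mul_assoc (unitExp _) (unitExp _),
    ← unitExp_add]
  congr 2
  ring

lemma osc_eq_setIntegral {R lam : ℝ} {ψ : ℝ → ℂ} (hR : 0 ≤ R) (hψ : ∀ y, R ≤ |y| → ψ y = 0) :
    osc R lam ψ = ∫ y in Set.Ioi 0, unitExp (lam * y) * ψ y := by
  rw [osc, intervalIntegral.integral_of_le hR]
  refine (setIntegral_eq_of_subset_of_forall_sdiff_eq_zero measurableSet_Ioi
    (fun y hy => hy.1) fun y hy => ?_).symm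
  have : R ≤ |y| := by
    by_contra h
    exact hy.2 ⟨hy.1, (le_abs_self y).trans (not_le.1 h).le⟩
  rw [hψ y this, mul_zero]

variable {c C R κ : ℝ} {a φ : ℝ × ℝ → ℂ}

/-- The sheared profile. -/
def shearProfile (c : ℝ) (φ : ℝ × ℝ → ℂ) (p : ℝ × ℝ) : ℂ :=
  φ (p.1 + Real.pi * c * p.2, Real.pi * p.2)

lemma weylKernel_of_lt (hR : 0 ≤ R) (hφR : ∀ p : ℝ × ℝ, R ≤ |p.1| → shearProfile c φ p = 0)
    (hpos : ∀ x ξ, 0 < ξ → a (x, ξ) = if c * ξ < x then φ (x, ξ) else 0)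
    (hneg : ∀ x ξ, ξ < 0 → a (x, ξ) = 0) {w v : ℝ} (h0 : w + v ≠ 0) :
    weylKernel a (w, v) = chirp c w * conj (chirp c v) *
      jumpKernel (oscKernel R (-1) 0) (oscKernel R 1 (shearProfile c φ)) (w, v) := by
  rw [weylKernel_shift a c, jumpKernel]
  congr 1
  have hz : oscKernel R (-1) 0 (w, v) = 0 := by simp [oscKernel, osc]
  rw [hz, zero_add]
  rcases h0.lt_or_gt with h | h
  · rw [Set.indicator_of_notMem (by simpa [upperHalf] using h.le)]
    simp [hneg _ _ (mul_neg_of_pos_of_neg Real.pi_pos h)]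
  · rw [Set.indicator_of_mem (by simpa [upperHalf] using h), oscKernel,
      osc_eq_setIntegral hR (fun y hy => hφR (y, w + v) hy), ← integral_indicator measurableSet_Ioi]
    refine integral_congr_ae (ae_of_all _ fun y => ?_)
    beta_reduce
    rw [hpos _ _ (mul_pos Real.pi_pos h), Set.indicator_apply]
    have : c * (Real.pi * (w + v)) < y + Real.pi * c * (w + v) ↔ y ∈ Set.Ioi (0 : ℝ) := by
      rw [Set.mem_Ioi]
      constructor <;> intro h <;> nlinarith
    simp only [this, shearProfile, mul_ite, mul_zero, mul_one]

lemma weylKernel_of_gt (hφ : Continuous φ) (hR : 0 ≤ R)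
    (hφR : ∀ p : ℝ × ℝ, R ≤ |p.1| → shearProfile c φ p = 0)
    (hpos : ∀ x ξ, 0 < ξ → a (x, ξ) = φ (x, ξ))
    (hneg : ∀ x ξ, ξ < 0 → a (x, ξ) = if x < c * ξ then φ (x, ξ) else 0) {w v : ℝ}
    (h0 : w + v ≠ 0) :
    weylKernel a (w, v) = chirp c w * conj (chirp c v) *
      jumpKernel (oscKernel R (-1) fun p => shearProfile c φ (-p.1, p.2))
        (oscKernel R 1 (shearProfile c φ)) (w, v) := by
  rw [weylKernel_shift a c, jumpKernel]
  congr 1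
  set F : ℝ → ℂ := fun y => unitExp (-(2 * Real.pi * (w - v)) * y) * shearProfile c φ (y, w + v)
    with hF
  have hG : oscKernel R (-1) (fun p => shearProfile c φ (-p.1, p.2)) (w, v) =
      ∫ y in Set.Iio 0, F y := by
    rw [oscKernel, osc_eq_setIntegral hR (fun y hy => hφR (-y, w + v) (by rwa [abs_neg])),
      ← integral_Iic_eq_integral_Iio, ← neg_zero, ← integral_comp_neg_Ioi, neg_zero]
    refine setIntegral_congr_fun measurableSet_Ioi fun y _ => ?_
    simp only [hF]
    congr 2
    ring
  rw [hG]
  rcases h0.lt_or_gt with h | h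
  · rw [Set.indicator_of_notMem (by simpa [upperHalf] using h.le), add_zero,
      ← integral_indicator measurableSet_Iio]
    refine integral_congr_ae (ae_of_all _ fun y => ?_)
    beta_reduce
    rw [hneg _ _ (mul_neg_of_pos_of_neg Real.pi_pos h), Set.indicator_apply]
    have : y + Real.pi * c * (w + v) < c * (Real.pi * (w + v)) ↔ y ∈ Set.Iio (0 : ℝ) := by
      rw [Set.mem_Iio]
      constructor <;> intro h <;> nlinarith
    simp only [this, hF, shearProfile, mul_ite, mul_zero]
  · have hJ : oscKernel R 1 (shearProfile c φ) (w, v) = ∫ y in Set.Ioi 0, F y := by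
      rw [oscKernel, osc_eq_setIntegral hR (fun y hy => hφR (y, w + v) hy), mul_one]
    have hFc : Continuous F := by
      refine (by fun_prop : Continuous fun y : ℝ =>
        unitExp (-(2 * Real.pi * (w - v)) * y)).mul ?_
      exact hφ.comp (by fun_prop)
    have hFs : HasCompactSupport F := by
      refine HasCompactSupport.intro (isCompact_Icc (a := -R) (b := R)) fun y hy => ?_
      have : R ≤ |y| := by
        by_contra hn
        exact hy (abs_le.1 (not_le.1 hn).le)
      simp only [hF]
      rw [hφR (y, w + v) this, mul_zero]
    have hFi := hFc.integrable_of_hasCompactSupport hFs (μ := volume)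
    rw [Set.indicator_of_mem (by simpa [upperHalf] using h), hJ, ← integral_Iic_eq_integral_Iio,
      intervalIntegral.integral_Iic_add_Ioi hFi.integrableOn hFi.integrableOn]
    refine integral_congr_ae (ae_of_all _ fun y => ?_)
    beta_reduce
    rw [hpos _ _ (mul_pos Real.pi_pos h)]
    rfl

end Kernel

section Reduction

open scoped FourierTransform SchwartzMap ComplexConjugate

@[simp] lemma norm_chirp (c w : ℝ) : ‖chirp c w‖ = 1 := norm_unitExp _

lemma conj_chirp (c w : ℝ) : conj (chirp c w) = chirp (-c) w := by
  rw [chirp, conj_unitExp, chirp]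
  congr 1
  ring

lemma chirp_mul_conj (c w : ℝ) : chirp c w * conj (chirp c w) = 1 := unitExp_mul_conj _

lemma continuous_chirp (c : ℝ) : Continuous (chirp c) := by
  unfold chirp
  fun_prop

lemma memLp_chirp_mul (c : ℝ) (f : L2R) : MemLp (fun x => chirp c x * f x) 2 volume :=
  (Lp.memLp f).congr_norm
    ((continuous_chirp c).aestronglyMeasurable.mul (Lp.aestronglyMeasurable f))
    (ae_of_all _ fun x => by rw [norm_mul, norm_chirp, one_mul])

/-- Multiplication by the chirp, as a linear map. -/
def chirpLin (c : ℝ) : L2R →ₗ[ℂ] L2R where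
  toFun f := (memLp_chirp_mul c f).toLp _
  map_add' f g := by
    rw [← MemLp.toLp_add]
    refine MemLp.toLp_congr _ _ ?_
    filter_upwards [Lp.coeFn_add f g] with x hx
    simp only [hx, Pi.add_apply, mul_add]
  map_smul' r f := by
    rw [← MemLp.toLp_const_smul]
    refine MemLp.toLp_congr _ _ ?_
    filter_upwards [Lp.coeFn_smul r f] with x hx
    simp only [hx, Pi.smul_apply, smul_eq_mul, RingHom.id_apply]
    ring

lemma coeFn_chirpLin (c : ℝ) (f : L2R) : ⇑(chirpLin c f) =ᵐ[volume] fun x => chirp c x * f x :=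
  MemLp.coeFn_toLp (memLp_chirp_mul c f)

lemma chirpLin_comp_neg (c : ℝ) (f : L2R) : chirpLin c (chirpLin (-c) f) = f := by
  refine Lp.ext ?_
  filter_upwards [coeFn_chirpLin c (chirpLin (-c) f), coeFn_chirpLin (-c) f] with x h1 h2
  rw [h1, h2, ← mul_assoc, ← conj_chirp, chirp_mul_conj, one_mul]

/-- Multiplication by the chirp, as a unitary operator. -/
def chirpEquiv (c : ℝ) : L2R ≃ₗᵢ[ℂ] L2R where
  toLinearEquiv := LinearEquiv.ofLinearMap (chirpLin c) (chirpLin (-c))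
    (LinearMap.ext (chirpLin_comp_neg c))
    (LinearMap.ext fun f => by simpa using chirpLin_comp_neg (-c) f)
  norm_map' f := by
    change ‖chirpLin c f‖ = ‖f‖
    rw [Lp.norm_def, Lp.norm_def]
    congr 1
    refine eLpNorm_congr_norm_ae ?_
    filter_upwards [coeFn_chirpLin c f] with x hx
    rw [hx, norm_mul, norm_chirp, one_mul]

lemma coeFn_chirpEquiv (c : ℝ) (f : L2R) :
    ⇑(chirpEquiv c f) =ᵐ[volume] fun x => chirp c x * f x :=
  coeFn_chirpLin c f

/-- Fourier transform followed by removal of the chirp. -/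
def chirpFourier (c : ℝ) : L2R ≃ₗᵢ[ℂ] L2R :=
  (Lp.fourierTransformₗᵢ ℝ ℂ).trans (chirpEquiv (-c))

lemma coeFn_chirpFourier (c : ℝ) (u : 𝓢(ℝ, ℂ)) :
    ⇑(chirpFourier c (u.toLp 2)) =ᵐ[volume] fun x => conj (chirp c x) * 𝓕 u x := by
  have h : Lp.fourierTransformₗᵢ ℝ ℂ (u.toLp 2) = (𝓕 u).toLp 2 := SchwartzMap.toLp_fourier_eq u
  rw [chirpFourier, LinearIsometryEquiv.trans_apply, h]
  filter_upwards [coeFn_chirpEquiv (-c) ((𝓕 u).toLp 2), (𝓕 u).coeFn_toLp 2] with x h1 h2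
  rw [h1, h2, conj_chirp]

lemma ae_add_ne_zero : ∀ᵐ p : ℝ × ℝ, p.1 + p.2 ≠ 0 := by
  rw [Measure.volume_eq_prod, ae_iff]
  have hm : MeasurableSet {p : ℝ × ℝ | ¬p.1 + p.2 ≠ 0} := by
    simp only [not_not]
    exact measurableSet_eq_fun (by fun_prop) measurable_const
  rw [Measure.measure_prod_null hm]
  refine ae_of_all _ fun x => ?_
  change volume (Prod.mk x ⁻¹' {p : ℝ × ℝ | ¬p.1 + p.2 ≠ 0}) = 0
  have h : Prod.mk x ⁻¹' {p : ℝ × ℝ | ¬p.1 + p.2 ≠ 0} = {-x} := by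
    ext y
    simp only [Set.mem_preimage, Set.mem_ofPred_eq, not_not, Set.mem_singleton_iff]
    constructor <;> intro h <;> linarith
  rw [h, Real.volume_singleton]

variable {c C R κ : ℝ} {a G J : ℝ × ℝ → ℂ}

lemma re_inner_eq_kernelForm (ha : Integrable fun q : ℝ × ℝ => a (q.2, 2 * Real.pi * q.1))
    {K : ℝ × ℝ → ℂ} (hK : MemLp K 2 volume)
    (haK : ∀ w v : ℝ, w + v ≠ 0 →
      weylKernel a (w, v) = chirp c w * conj (chirp c v) * K (w, v))
    {T : L2R →L[ℂ] L2R} (hT : IsWeylOp a T) (f : L2R) :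
    (⟪T f, f⟫_ℂ).re = (kernelForm K (chirpFourier c f)).re := by
  have hd := SchwartzMap.denseRange_toLpCLM (E := ℝ) (F := ℂ) (p := 2)
    (μ := volume) ENNReal.ofNat_ne_top
  refine hd.induction_on (p := fun f => (⟪T f, f⟫_ℂ).re = (kernelForm K (chirpFourier c f)).re) f
    ?_ ?_
  · exact isClosed_eq (Complex.continuous_re.comp (T.continuous.inner continuous_id))
      (Complex.continuous_re.comp
        ((continuous_kernelForm hK).comp (chirpFourier c).continuous))
  · intro u
    change (⟪T (u.toLp 2), u.toLp 2⟫_ℂ).re = (kernelForm K (chirpFourier c (u.toLp 2))).re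
    have hu := u.coeFn_toLp 2
    have h1 : ⟪(u.toLp 2 : L2R), T (u.toLp 2)⟫_ℂ = ∫ x, weylIntegral a u x * conj (u x) := by
      rw [L2.inner_def]
      refine integral_congr_ae ?_
      filter_upwards [hu, hT u (u.toLp 2) hu] with x e1 e2
      rw [e1, e2, RCLike.inner_apply]
    have hg := coeFn_chirpFourier c u
    generalize chirpFourier c (u.toLp 2) = g at hg ⊢
    have hae : (fun p : ℝ × ℝ => K p * (g p.2 * conj (g p.1))) =ᵐ[volume]
        fun p => weylKernel a p * (𝓕 u p.2 * conj (𝓕 u p.1)) := by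
      filter_upwards [ae_add_ne_zero, ae_comp_fst hg, ae_comp_snd hg] with p hp e1 e2
      have h3 := haK p.1 p.2 hp
      rw [Prod.mk.eta] at h3
      rw [h3, e1, e2, map_mul, Complex.conj_conj]
      ring
    have hi := (integrable_kernelForm hK g).congr hae
    have h2 : kernelForm K g =
        ∫ w, ∫ v, weylKernel a (w, v) * (𝓕 u v * conj (𝓕 u w)) := by
      rw [kernelForm, integral_congr_ae hae]
      exact integral_prod _ hi
    rw [h2, ← weylForm_eq ha u, ← h1, ← inner_conj_symm, Complex.conj_re]

lemma tendsto_eigPlus_of_weylKernel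
    (ha : Integrable fun q : ℝ × ℝ => a (q.2, 2 * Real.pi * q.1)) (hJ : JumpKernel κ C R G J)
    (haK : ∀ w v : ℝ, w + v ≠ 0 →
      weylKernel a (w, v) = chirp c w * conj (chirp c v) * jumpKernel G J (w, v))
    {T : L2R →L[ℂ] L2R} (hT : IsWeylOp a T) :
    Tendsto (fun k : ℕ => eigPlus T k * k / Real.log k) atTop (nhds (|κ| / Real.pi)) :=
  tendsto_eigPlus_of_jumpKernel hJ T (chirpFourier c)
    (re_inner_eq_kernelForm ha (memLp_jumpKernel hJ) haK hT)

/-- The linear shear `(y, s) ↦ (y + π c s, π s)`. -/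
def shearHomeomorph (c : ℝ) : ℝ × ℝ ≃ₜ ℝ × ℝ where
  toFun p := (p.1 + Real.pi * c * p.2, Real.pi * p.2)
  invFun q := (q.1 - c * q.2, q.2 / Real.pi)
  left_inv p := by
    have := Real.pi_ne_zero
    ext
    · simp only
      ring
    · simp only
      field_simp
  right_inv q := by
    have := Real.pi_ne_zero
    ext
    · simp only
      field_simp
      ring
    · simp only
      field_simp

lemma integrable_symbAOm {Ω : Set (ℝ × ℝ)} (hΩ : MeasurableSet Ω) {φ : ℝ × ℝ → ℝ}
    (hφ : Continuous φ) (hs : HasCompactSupport φ) :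
    Integrable fun q : ℝ × ℝ => symbAOm Ω φ (q.2, 2 * Real.pi * q.1) := by
  have hπ : 2 * Real.pi ≠ 0 := by positivity
  let e : ℝ × ℝ ≃ₜ ℝ × ℝ :=
    (Homeomorph.prodComm ℝ ℝ).trans ((Homeomorph.refl ℝ).prodCongr (Homeomorph.mulLeft₀ _ hπ))
  have hc : Continuous fun τ : ℝ × ℝ => (φ τ : ℂ) := Complex.continuous_ofReal.comp hφ
  have hcs : HasCompactSupport fun τ : ℝ × ℝ => (φ τ : ℂ) :=
    hs.comp_left (g := fun r : ℝ => (r : ℂ)) Complex.ofReal_zero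
  have hi : Integrable fun q : ℝ × ℝ => (φ (e q) : ℂ) :=
    (hc.comp e.continuous).integrable_of_hasCompactSupport (hcs.comp_homeomorph e)
  exact hi.indicator (e.continuous.measurable hΩ)

lemma tendsto_eigPlus_sector {θ : ℝ}
    (hθ : θ ∈ Set.Ioo 0 Real.pi ∨ θ ∈ Set.Ioo Real.pi (2 * Real.pi)) {φ : ℝ × ℝ → ℝ}
    (hφ : ContDiff ℝ (⊤ : ℕ∞) φ) (hs : HasCompactSupport φ) {T : L2R →L[ℂ] L2R}
    (hT : IsWeylOp (symbAOm (sector θ) φ) T) :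
    Tendsto (fun k : ℕ => eigPlus T k * k / Real.log k) atTop
      (nhds (|φ (0, 0)| / (4 * Real.pi ^ 2))) := by
  have hπ := Real.pi_pos
  set c := Real.cos θ / Real.sin θ
  have hlim : |φ (0, 0)| / (4 * Real.pi ^ 2) = |φ (0, 0) / (4 * Real.pi)| / Real.pi := by
    rw [abs_div, abs_of_pos (by positivity : 0 < 4 * Real.pi)]
    field_simp
  rw [hlim]
  set ψ : ℝ × ℝ → ℂ := fun τ => (φ τ : ℂ) with hψ
  have hψc : ContDiff ℝ (⊤ : ℕ∞) ψ := Complex.ofRealCLM.contDiff.comp hφ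
  have hψs : HasCompactSupport ψ := hs.comp_left (g := fun r : ℝ => (r : ℂ)) Complex.ofReal_zero
  have hΦ : ContDiff ℝ (⊤ : ℕ∞) (shearProfile c ψ) := hψc.comp (by fun_prop)
  have hΦs : HasCompactSupport (shearProfile c ψ) := hψs.comp_homeomorph (shearHomeomorph c)
  have hκ : shearProfile c ψ (0, 0) =
      ((4 * Real.pi * (φ (0, 0) / (4 * Real.pi)) : ℝ) : ℂ) := by
    rw [mul_div_cancel₀ _ (by positivity)]
    simp [shearProfile, hψ]
  have ha := integrable_symbAOm (measurableSet_sector θ) hφ.continuous hs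
  rcases hθ with hθ | hθ
  · obtain ⟨C, R, hJ, hR⟩ := exists_jumpKernel (Ψ := 0) hΦ hΦs contDiff_const
      HasCompactSupport.zero hκ
    refine tendsto_eigPlus_of_weylKernel (c := c) ha hJ (fun w v h0 => ?_) hT
    refine weylKernel_of_lt hJ.hR (fun p hp => (hR p hp).1) (fun x ξ hξ => ?_) (fun x ξ hξ => ?_) h0
    · split_ifs with h
      · exact Set.indicator_of_mem ((mem_sector_of_lt_pi hθ hξ).2 h) _
      · exact Set.indicator_of_notMem (fun hm => h ((mem_sector_of_lt_pi hθ hξ).1 hm)) _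
    · exact Set.indicator_of_notMem (not_mem_sector_of_lt_pi hθ hξ) _
  · have hΨ : ContDiff ℝ (⊤ : ℕ∞) fun p : ℝ × ℝ => shearProfile c ψ (-p.1, p.2) :=
      hΦ.comp (by fun_prop)
    have hΨs : HasCompactSupport fun p : ℝ × ℝ => shearProfile c ψ (-p.1, p.2) :=
      hΦs.comp_homeomorph ((Homeomorph.neg ℝ).prodCongr (Homeomorph.refl ℝ))
    obtain ⟨C, R, hJ, hR⟩ := exists_jumpKernel hΦ hΦs hΨ hΨs hκ
    refine tendsto_eigPlus_of_weylKernel (c := c) ha hJ (fun w v h0 => ?_) hT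
    refine weylKernel_of_gt hψc.continuous hJ.hR (fun p hp => (hR p hp).1) (fun x ξ hξ => ?_)
      (fun x ξ hξ => ?_) h0
    · exact Set.indicator_of_mem (mem_sector_of_pi_lt hθ hξ) _
    · split_ifs with h
      · exact Set.indicator_of_mem ((mem_sector_of_pi_lt_of_neg hθ hξ).2 h) _
      · exact Set.indicator_of_notMem (fun hm => h ((mem_sector_of_pi_lt_of_neg hθ hξ).1 hm)) _

lemma IsWeylOp.neg {φ : ℝ × ℝ → ℝ} {Ω : Set (ℝ × ℝ)} {T : L2R →L[ℂ] L2R}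
    (hT : IsWeylOp (symbAOm Ω φ) T) : IsWeylOp (symbAOm Ω (-φ)) (-T) := by
  intro u f hf
  have h : weylIntegral (symbAOm Ω (-φ)) u = -weylIntegral (symbAOm Ω φ) u := by
    have e : ∀ p, symbAOm Ω (-φ) p = -symbAOm Ω φ p := fun p => by
      simp only [symbAOm, Pi.neg_apply, Complex.ofReal_neg]
      exact congrFun (Set.indicator_neg Ω fun τ => (φ τ : ℂ)) p
    ext x
    simp only [weylIntegral, e, mul_neg, neg_mul, integral_neg, Pi.neg_apply]
  rw [h, neg_apply]
  filter_upwards [Lp.coeFn_neg (T f), hT u f hf] with x h1 h2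
  rw [h1, Pi.neg_apply, Pi.neg_apply, h2]

end Reduction

/-- **Theorem (main result).** For a sector `Ω = Ω_θ` of opening angle `θ ∈ (0,π) ∪ (π,2π)`
and a real-valued `φ ∈ C_0^∞(ℝ²)`, the positive and negative eigenvalues of
`A_Ω[φ] = Op^w(1_Ω φ)` satisfy `λ_k^{(±)} · k / log k → |φ(0,0)| / (4π²)`. -/
theorem sector_eigenvalue_asymptotics
    (θ : ℝ) (hθ : θ ∈ Set.Ioo 0 Real.pi ∨ θ ∈ Set.Ioo Real.pi (2 * Real.pi))
    (φ : ℝ × ℝ → ℝ) (hφ_smooth : ContDiff ℝ (⊤ : ℕ∞) φ) (hφ_supp : HasCompactSupport φ)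
    (T : L2R →L[ℂ] L2R) (hT : IsWeylOp (symbAOm (sector θ) φ) T) :
    Tendsto (fun k : ℕ => eigPlus T k * k / Real.log k) atTop
      (nhds (|φ (0, 0)| / (4 * Real.pi ^ 2))) ∧
    Tendsto (fun k : ℕ => eigMinus T k * k / Real.log k) atTop
      (nhds (|φ (0, 0)| / (4 * Real.pi ^ 2))) := by
  refine ⟨tendsto_eigPlus_sector hθ hφ_smooth hφ_supp hT, ?_⟩
  have h := tendsto_eigPlus_sector hθ hφ_smooth.neg hφ_supp.neg hT.neg
  rwa [abs_neg] at h

end
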